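/- arXiv:1807.09485 — 2 statements merged into one kernel-verified Lean document; each statement's English description precedes it below -/
import Mathlib

section
/- Every lattice polytope in ℝ³ can be partitioned into finitely many pairwise disjoint relatively open simplices, each of which is the relative interior of the image under a unimodular transformation of one of the seven half-unimodular simplices Δ_0^1, Δ_1^1, Δ_2^1, Δ_3^1, Δ_0^0, Δ_1^0, Δ_2^0. -/
open Pointwise

/-- A unimodular transformation of `ℝ^n`: an affine map `x ↦ A·x + b` with
`A ∈ GL_n(ℤ)` and `b ∈ ℤ^n`. -/
def IsUnimodular {n : ℕ} (f : (Fin n → ℝ) → (Fin n → ℝ)) : Prop :=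
  ∃ A : Matrix (Fin n) (Fin n) ℤ, IsUnit A.det ∧ ∃ b : Fin n → ℤ,
    ∀ x, f x = (A.map (Int.cast : ℤ → ℝ)).mulVec x + fun i => (b i : ℝ)

/-- `conv(0, e_1, …, e_i)` in `ℝ^n`, where `e_1, …, e_n` is the standard basis. -/
def baseSimplex (n i : ℕ) : Set (Fin n → ℝ) :=
  convexHull ℝ (insert 0 ((fun j : Fin n => (Pi.single j 1 : Fin n → ℝ)) '' {j | (j : ℕ) < i}))

/-- A half-unimodular simplex: a set `Δ` such that `2Δ` is the image of some
`conv(0, e_1, …, e_i)` under a unimodular transformation. -/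
def IsHalfUnimodular {n : ℕ} (Δ : Set (Fin n → ℝ)) : Prop :=
  ∃ i ≤ n, ∃ f, IsUnimodular f ∧ (2 : ℝ) • Δ = f '' baseSimplex n i

/-- A lattice polytope in `ℝ³`: the convex hull of a finite set of points of `ℤ³`. -/
def IsLatticePolytope3 (P : Set (Fin 3 → ℝ)) : Prop :=
  ∃ V : Finset (Fin 3 → ℤ),
    P = convexHull ℝ ((fun v : Fin 3 → ℤ => fun i => (v i : ℝ)) '' (V : Set (Fin 3 → ℤ)))

/-- `Δ_i^1 = ½·conv(0, e_1, …, e_i)` in `ℝ^n`. -/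
noncomputable def Δone (n i : ℕ) : Set (Fin n → ℝ) := (2⁻¹ : ℝ) • baseSimplex n i

/-- `Δ_i^0 = ½·conv(e_1, …, e_{i+1})` in `ℝ^n`. -/
noncomputable def Δzero (n i : ℕ) : Set (Fin n → ℝ) :=
  (2⁻¹ : ℝ) •
    convexHull ℝ ((fun j : Fin n => (Pi.single j 1 : Fin n → ℝ)) '' {j | (j : ℕ) < i + 1})

/-- The seven half-unimodular simplices `Δ_0^1, Δ_1^1, Δ_2^1, Δ_3^1, Δ_0^0, Δ_1^0, Δ_2^0`. -/
noncomputable def sevenSimplices : Fin 7 → Set (Fin 3 → ℝ) :=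
  ![Δone 3 0, Δone 3 1, Δone 3 2, Δone 3 3, Δzero 3 0, Δzero 3 1, Δzero 3 2]

/-- The set of combinations of the points `v i` whose coefficients add up to one, are positive
on `σ` and vanish off `σ`. -/
def openSimplex {ι E : Type*} [Fintype ι] [AddCommGroup E] [Module ℝ E] (v : ι → E)
    (σ : Finset ι) : Set E :=
  {x | ∃ c : ι → ℝ, (∀ i ∈ σ, 0 < c i) ∧ (∀ i ∉ σ, c i = 0) ∧ ∑ i, c i = 1 ∧ ∑ i, c i • v i = x}

/-- The first weight in the list that does not annihilate `m`, if there is one, is positive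
on `m`. -/
def LexNonneg {ι : Type*} [Fintype ι] : List (ι → ℝ) → (ι → ℝ) → Prop
  | [], _ => True
  | w :: ws, m => 0 < ∑ i, w i * m i ∨ (∑ i, w i * m i = 0 ∧ LexNonneg ws m)

/-- The support condition under which a convex combination of the points `v i` with support `σ`
is lexicographically minimal among all those representing the same point. -/
def IsLexCell {ι E : Type*} [Fintype ι] [AddCommGroup E] [Module ℝ E] (ws : List (ι → ℝ))
    (v : ι → E) (σ : Finset ι) : Prop :=
  ∀ m : ι → ℝ, (∀ i ∉ σ, 0 ≤ m i) → ∑ i, m i = 0 → ∑ i, m i • v i = 0 → LexNonneg ws m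

section LexNonneg

variable {ι : Type*} [Fintype ι]

lemma LexNonneg.smul {ws : List (ι → ℝ)} {m : ι → ℝ} (h : LexNonneg ws m) {t : ℝ} (ht : 0 < t) :
    LexNonneg ws (t • m) := by
  induction ws with
  | nil => trivial
  | cons w ws ih =>
    have e : ∑ i, w i * (t • m) i = t * ∑ i, w i * m i := by
      rw [Finset.mul_sum]
      exact Finset.sum_congr rfl fun i _ => by simp only [Pi.smul_apply, smul_eq_mul]; ring
    simp only [LexNonneg, e] at h ⊢
    rcases h with h | ⟨h, h'⟩
    · exact Or.inl (mul_pos ht h)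
    · exact Or.inr ⟨by rw [h, mul_zero], ih h'⟩

lemma LexNonneg.sum_eq_zero {ws : List (ι → ℝ)} {m : ι → ℝ} (h : LexNonneg ws m)
    (h' : LexNonneg ws (-m)) : ∀ w ∈ ws, ∑ i, w i * m i = 0 := by
  induction ws with
  | nil => simp
  | cons w ws ih =>
    have e : ∑ i, w i * (-m) i = -∑ i, w i * m i := by simp
    simp only [LexNonneg, e] at h h'
    intro w' hw'
    rcases List.mem_cons.1 hw' with rfl | hw'
    · rcases h with h | h <;> rcases h' with h' | h' <;> linarith
    · refine ih ?_ ?_ w' hw'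
      · rcases h with h | h
        · rcases h' with h' | h' <;> linarith
        · exact h.2
      · rcases h' with h' | h'
        · rcases h with h | h <;> linarith
        · exact h'.2

lemma exists_lexMin (ws : List (ι → ℝ)) {K : Set (ι → ℝ)} (hK : IsCompact K)
    (hne : K.Nonempty) : ∃ c ∈ K, ∀ d ∈ K, LexNonneg ws (d - c) := by
  induction ws generalizing K with
  | nil =>
    obtain ⟨c, hc⟩ := hne
    exact ⟨c, hc, fun _ _ => trivial⟩
  | cons w ws ih =>
    have hcont : Continuous fun c : ι → ℝ => ∑ i, w i * c i := by fun_prop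
    obtain ⟨c₀, hc₀, hmin⟩ := hK.exists_isMinOn hne hcont.continuousOn
    have hK' : IsCompact (K ∩ {c | ∑ i, w i * c i = ∑ i, w i * c₀ i}) :=
      hK.inter_right (isClosed_eq hcont continuous_const)
    obtain ⟨c, ⟨hcK, hc⟩, h⟩ := ih hK' ⟨c₀, hc₀, rfl⟩
    refine ⟨c, hcK, fun d hd => ?_⟩
    have hle : ∑ i, w i * c₀ i ≤ ∑ i, w i * d i := hmin hd
    have e : ∑ i, w i * (d - c) i = ∑ i, w i * d i - ∑ i, w i * c i := by
      simp [mul_sub, Finset.sum_sub_distrib]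
    have hc' : ∑ i, w i * c i = ∑ i, w i * c₀ i := hc
    simp only [LexNonneg, e]
    rcases hle.lt_or_eq with hlt | heq
    · left; linarith
    · right
      exact ⟨by linarith, h d ⟨hd, heq.symm⟩⟩

end LexNonneg

section Triangulation

variable {ι E : Type*} [Fintype ι]

lemma exists_coeff_of_mem_convexHull_range [AddCommGroup E] [Module ℝ E] {v : ι → E} {x : E}
    (hx : x ∈ convexHull ℝ (Set.range v)) :
    ∃ c : ι → ℝ, (∀ i, 0 ≤ c i) ∧ ∑ i, c i = 1 ∧ ∑ i, c i • v i = x := by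
  classical
  have hconv : Convex ℝ ((Fintype.linearCombination ℝ v) '' stdSimplex ℝ ι) :=
    (convex_stdSimplex ℝ ι).linear_image _
  have hsub : Set.range v ⊆ (Fintype.linearCombination ℝ v) '' stdSimplex ℝ ι := by
    rintro _ ⟨i, rfl⟩
    exact ⟨Pi.single i 1, single_mem_stdSimplex ℝ i,
      by simp [Fintype.linearCombination_apply, Pi.single_apply]⟩
  obtain ⟨c, hc, rfl⟩ := convexHull_min hsub hconv hx
  exact ⟨c, hc.1, hc.2, by simp [Fintype.linearCombination_apply]⟩

lemma openSimplex_subset_convexHull [AddCommGroup E] [Module ℝ E] (v : ι → E) (σ : Finset ι) :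
    openSimplex v σ ⊆ convexHull ℝ (Set.range v) := by
  rintro x ⟨c, h1, h2, h3, h4⟩
  refine mem_convexHull_of_exists_fintype c v (fun i => ?_) h3 (fun i => ⟨i, rfl⟩) h4
  by_cases hi : i ∈ σ
  · exact (h1 i hi).le
  · exact (h2 i hi).ge

/-- A regular triangulation of a finite family of points, refining the subdivision given by two
weights. -/
theorem exists_regular_triangulation [NormedAddCommGroup E] [NormedSpace ℝ E] (v : ι → E)
    (w₁ w₂ : ι → ℝ) : ∃ C : Set (Finset ι),
      (∀ x ∈ convexHull ℝ (Set.range v), ∃ σ ∈ C, x ∈ openSimplex v σ) ∧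
      (∀ σ ∈ C, ∀ τ ∈ C, ∀ x, x ∈ openSimplex v σ → x ∈ openSimplex v τ → σ = τ) ∧
      (∀ σ ∈ C, ∀ m : ι → ℝ, (∀ i ∉ σ, m i = 0) → ∑ i, m i = 0 → ∑ i, m i • v i = 0 → m = 0) ∧
      (∀ σ ∈ C, ∀ m : ι → ℝ, (∀ i ∉ σ, 0 ≤ m i) → ∑ i, m i = 0 → ∑ i, m i • v i = 0 →
        0 ≤ ∑ i, w₁ i * m i ∧ (∑ i, w₁ i * m i = 0 → 0 ≤ ∑ i, w₂ i * m i)) := by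
  classical
  set ws : List (ι → ℝ) :=
    w₁ :: w₂ :: (Finset.univ : Finset ι).toList.map fun i => Pi.single i 1 with hws
  have hsep : ∀ m : ι → ℝ, LexNonneg ws m → LexNonneg ws (-m) → m = 0 := by
    intro m h h'
    funext i
    have := h.sum_eq_zero h' (Pi.single i 1) (by simp [hws])
    simpa [Pi.single_apply] using this
  refine ⟨{σ | IsLexCell ws v σ}, ?_, ?_, ?_, ?_⟩
  · intro x hx
    obtain ⟨c₀, h1, h2, h3⟩ := exists_coeff_of_mem_convexHull_range hx
    have hK : IsCompact (stdSimplex ℝ ι ∩ {c | ∑ i, c i • v i = x}) :=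
      (isCompact_stdSimplex ℝ ι).inter_right
        (isClosed_eq (by fun_prop) continuous_const)
    obtain ⟨c, ⟨hc, hcx⟩, hmin⟩ := exists_lexMin ws hK ⟨c₀, ⟨h1, h2⟩, h3⟩
    refine ⟨Finset.univ.filter fun i => 0 < c i, ?_, c, by simp, ?_, hc.2, hcx⟩
    · intro m hm hm1 hmv
      have hev : ∀ᶠ t : ℝ in nhdsWithin 0 (Set.Ioi 0), ∀ i, 0 ≤ c i + t * m i := by
        rw [Filter.eventually_all]
        intro i
        by_cases hi : 0 < c i
        · have : Filter.Tendsto (fun t : ℝ => c i + t * m i) (nhdsWithin 0 (Set.Ioi 0))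
              (nhds (c i + 0 * m i)) :=
            (Continuous.tendsto (by fun_prop) 0).mono_left nhdsWithin_le_nhds
          have := this.eventually (lt_mem_nhds (show (0 : ℝ) < c i + 0 * m i by simpa using hi))
          exact this.mono fun _ h => h.le
        · filter_upwards [self_mem_nhdsWithin] with t ht
          have := hm i (by simpa using hi)
          have := hc.1 i
          have : (0 : ℝ) < t := ht
          positivity
      obtain ⟨t, ht, htpos⟩ := (hev.and self_mem_nhdsWithin).exists
      have htpos : (0 : ℝ) < t := htpos
      have := hmin (c + t • m) ⟨⟨fun i => by simpa using ht i, ?_⟩, ?_⟩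
      · have := this.smul (inv_pos.2 htpos)
        simpa [smul_smul, inv_mul_cancel₀ htpos.ne'] using this
      · simp [Finset.sum_add_distrib, ← Finset.mul_sum, hm1, hc.2]
      · have hcx : ∑ i, c i • v i = x := hcx
        simp [add_smul, Finset.sum_add_distrib, mul_smul, ← Finset.smul_sum, hmv, hcx]
    · intro i hi
      exact le_antisymm (by simpa using hi) (hc.1 i)
  · rintro σ hσ τ hτ x ⟨c, h1, h2, h3, h4⟩ ⟨d, k1, k2, k3, k4⟩
    have hc : ∀ i, 0 ≤ c i := fun i => by
      by_cases hi : i ∈ σ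
      · exact (h1 i hi).le
      · exact (h2 i hi).ge
    have hd : ∀ i, 0 ≤ d i := fun i => by
      by_cases hi : i ∈ τ
      · exact (k1 i hi).le
      · exact (k2 i hi).ge
    have e1 := hσ (d - c) (fun i hi => by simpa [h2 i hi] using hd i)
      (by simp [Finset.sum_sub_distrib, h3, k3])
      (by simp [sub_smul, Finset.sum_sub_distrib, h4, k4])
    have e2 := hτ (-(d - c)) (fun i hi => by simpa [k2 i hi] using hc i)
      (by simp [Finset.sum_sub_distrib, h3, k3])
      (by simp [sub_smul, Finset.sum_sub_distrib, h4, k4])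
    have hcd : d = c := sub_eq_zero.1 (hsep _ e1 e2)
    subst hcd
    ext i
    constructor
    · intro hi
      by_contra hi'
      exact (h1 i hi).ne' (k2 i hi')
    · intro hi
      by_contra hi'
      exact (k1 i hi).ne' (h2 i hi')
  · intro σ hσ m hm hm1 hmv
    exact hsep m (hσ m (fun i hi => (hm i hi).ge) hm1 hmv)
      (hσ (-m) (fun i hi => by simp [hm i hi]) (by simpa using hm1) (by simpa using hmv))
  · intro σ hσ m hm hm1 hmv
    have := hσ m hm hm1 hmv
    simp only [hws, LexNonneg] at this
    rcases this with h | ⟨h, h' | ⟨h', -⟩⟩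
    · exact ⟨h.le, fun h' => absurd h' h.ne'⟩
    · exact ⟨h.ge, fun _ => h'.le⟩
    · exact ⟨h.ge, fun _ => h'.ge⟩

end Triangulation

lemma mem_openSimplex_iff {ι E : Type*} [Fintype ι] [AddCommGroup E] [Module ℝ E] {v : ι → E}
    {σ : Finset ι} {x : E} : x ∈ openSimplex v σ ↔
      ∃ c : ι → ℝ, (∀ i ∈ σ, 0 < c i) ∧ ∑ i ∈ σ, c i = 1 ∧ ∑ i ∈ σ, c i • v i = x := by
  classical
  constructor
  · rintro ⟨c, h1, h2, h3, h4⟩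
    refine ⟨c, h1, ?_, ?_⟩
    · rw [← h3]
      exact Finset.sum_subset (Finset.subset_univ _) fun i _ hi => h2 i hi
    · rw [← h4]
      exact Finset.sum_subset (Finset.subset_univ _) fun i _ hi => by rw [h2 i hi, zero_smul]
  · rintro ⟨c, h1, h2, h3⟩
    refine ⟨fun i => if i ∈ σ then c i else 0, fun i hi => by simpa [hi] using h1 i hi,
      fun i hi => by simp [hi], by simpa using h2, ?_⟩
    simpa [ite_smul] using h3

lemma openSimplex_image {ι E F : Type*} [Fintype ι] [AddCommGroup E] [Module ℝ E]
    [AddCommGroup F] [Module ℝ F] (φ : E →ᵃ[ℝ] F) (v : ι → E) (σ : Finset ι) :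
    openSimplex (φ ∘ v) σ = φ '' openSimplex v σ := by
  have key : ∀ c : ι → ℝ, ∑ i, c i = 1 → ∑ i, c i • φ (v i) = φ (∑ i, c i • v i) := by
    intro c hc
    have := Finset.univ.map_affineCombination v c hc φ
    rw [Finset.affineCombination_eq_linear_combination _ _ _ hc,
      Finset.affineCombination_eq_linear_combination _ _ _ hc] at this
    exact this.symm
  ext x
  constructor
  · rintro ⟨c, h1, h2, h3, h4⟩
    exact ⟨_, ⟨c, h1, h2, h3, rfl⟩, by rw [← h4]; exact (key c h3).symm⟩
  · rintro ⟨_, ⟨c, h1, h2, h3, rfl⟩, rfl⟩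
    exact ⟨c, h1, h2, h3, key c h3⟩

lemma openSimplex_reindex {ι κ E : Type*} [Fintype ι] [Fintype κ] [DecidableEq κ]
    [AddCommGroup E] [Module ℝ E] {v : ι → E} {u : κ → E} {σ : Finset ι} {e : ι → κ}
    (he : Set.InjOn e σ) (hv : ∀ i ∈ σ, v i = u (e i)) :
    openSimplex v σ = openSimplex u (σ.image e) := by
  ext x
  rw [mem_openSimplex_iff, mem_openSimplex_iff]
  rcases σ.eq_empty_or_nonempty with rfl | ⟨i₀, hi₀⟩
  · simp
  have : Nonempty ι := ⟨i₀⟩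
  constructor
  · rintro ⟨c, h1, h2, h3⟩
    have hl : ∀ i ∈ σ, Function.invFunOn e σ (e i) = i := fun i hi =>
      he.leftInvOn_invFunOn hi
    refine ⟨fun k => c (Function.invFunOn e σ k), ?_, ?_, ?_⟩
    · intro k hk
      obtain ⟨i, hi, rfl⟩ := Finset.mem_image.1 hk
      simpa only [hl i hi] using h1 i hi
    · rw [Finset.sum_image he, ← h2]
      exact Finset.sum_congr rfl fun i hi => by rw [hl i hi]
    · rw [Finset.sum_image he, ← h3]
      exact Finset.sum_congr rfl fun i hi => by simp only [hl i hi, hv i hi]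
  · rintro ⟨c, h1, h2, h3⟩
    refine ⟨c ∘ e, fun i hi => h1 _ (Finset.mem_image_of_mem e hi), ?_, ?_⟩
    · rw [← h2, Finset.sum_image he]
      rfl
    · rw [← h3, Finset.sum_image he]
      exact Finset.sum_congr rfl fun i hi => by rw [hv i hi, Function.comp]

lemma intrinsicInterior_eq_interior {E : Type*} [NormedAddCommGroup E] [NormedSpace ℝ E]
    {s : Set E} (hs : affineSpan ℝ s = ⊤) : intrinsicInterior ℝ s = interior s := by
  refine Set.Subset.antisymm (interior_maximal intrinsicInterior_subset ?_)
    interior_subset_intrinsicInterior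
  have : IsOpen ((affineSpan ℝ s : AffineSubspace ℝ E) : Set E) := by
    rw [hs]
    exact isOpen_univ
  exact this.isOpenEmbedding_subtypeVal.isOpenMap _ isOpen_interior

lemma intrinsicInterior_convexHull_range {ι E : Type*} [Fintype ι] [NormedAddCommGroup E]
    [NormedSpace ℝ E] {v : ι → E} (hv : AffineIndependent ℝ v) :
    intrinsicInterior ℝ (convexHull ℝ (Set.range v)) = openSimplex v Finset.univ := by
  rcases isEmpty_or_nonempty ι with h | ⟨⟨i₀⟩⟩
  · ext x
    simp [mem_openSimplex_iff, Set.range_eq_empty]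
  set D : Submodule ℝ E := (affineSpan ℝ (Set.range v)).direction with hD
  have hmem : ∀ i, v i - v i₀ ∈ D := fun i =>
    AffineSubspace.vsub_mem_direction (mem_affineSpan ℝ ⟨i, rfl⟩) (mem_affineSpan ℝ ⟨i₀, rfl⟩)
  let w : ι → D := fun i => ⟨v i - v i₀, hmem i⟩
  let φ : D →ᵃⁱ[ℝ] E :=
    { toFun := fun x => (x : E) + v i₀
      linear := D.subtype
      map_vadd' := fun p x => by simp [add_assoc]
      norm_map := fun x => rfl }
  have hφ : ∀ i, φ (w i) = v i := fun i => by
    change (v i - v i₀) + v i₀ = v i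
    abel
  have hφw : (φ : D → E) ∘ w = v := funext hφ
  have hwi : AffineIndependent ℝ w := by
    apply AffineIndependent.of_comp φ.toAffineMap
    change AffineIndependent ℝ ((φ : D → E) ∘ w)
    rwa [hφw]
  have hspan : affineSpan ℝ (Set.range w) = ⊤ := by
    have hinj : Function.Injective φ.toAffineMap := φ.injective
    have h1 : (affineSpan ℝ (Set.range w)).map φ.toAffineMap = affineSpan ℝ (Set.range v) := by
      rw [AffineSubspace.map_span, ← Set.range_comp]
      congr 2
    rw [eq_top_iff]
    intro x _
    have hx : φ.toAffineMap x ∈ affineSpan ℝ (Set.range v) :=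
      AffineSubspace.vadd_mem_of_mem_direction x.2 (mem_affineSpan ℝ ⟨i₀, rfl⟩)
    rw [← h1] at hx
    obtain ⟨y, hy, hyx⟩ := hx
    rwa [← hinj hyx]
  let b : AffineBasis ι ℝ D := ⟨w, hwi, hspan⟩
  have hinterior : intrinsicInterior ℝ (convexHull ℝ (Set.range w)) = openSimplex w Finset.univ := by
    rw [intrinsicInterior_eq_interior (by rw [affineSpan_convexHull, hspan])]
    change interior (convexHull ℝ (Set.range b)) = _
    rw [b.interior_convexHull]
    ext x
    constructor
    · intro hx
      exact ⟨fun i => b.coord i x, fun i _ => hx i, by simp, b.sum_coord_apply_eq_one x,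
        b.linear_combination_coord_eq_self x⟩
    · rintro ⟨c, h1, -, h3, rfl⟩ i
      have : ∑ j, c j • w j = Finset.univ.affineCombination ℝ b c :=
        (Finset.affineCombination_eq_linear_combination _ _ _ h3).symm
      rw [this, b.coord_apply_combination_of_mem (Finset.mem_univ i) h3]
      exact h1 i (Finset.mem_univ i)
  have hhull : convexHull ℝ (Set.range v) = φ '' convexHull ℝ (Set.range w) := by
    have := φ.toAffineMap.image_convexHull (Set.range w)
    rw [AffineIsometry.coe_toAffineMap, ← Set.range_comp, hφw] at this
    exact this.symm
  rw [hhull, AffineIsometry.intrinsicInterior_image, hinterior, ← hφw]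
  exact (openSimplex_image φ.toAffineMap w Finset.univ).symm

lemma intrinsicInterior_convexHull_image {κ E : Type*} [Fintype κ] [NormedAddCommGroup E]
    [NormedSpace ℝ E] {u : κ → E} (hu : AffineIndependent ℝ u) (s : Finset κ) :
    intrinsicInterior ℝ (convexHull ℝ (u '' s)) = openSimplex u s := by
  classical
  have h := intrinsicInterior_convexHull_range (hu.comp_embedding (Function.Embedding.subtype (· ∈ s)))
  have hr : Set.range (u ∘ (Function.Embedding.subtype (· ∈ s))) = u '' s := by
    ext x
    simp
  rw [hr] at h
  rw [h]
  have h2 : openSimplex (u ∘ ⇑(Function.Embedding.subtype (· ∈ s))) Finset.univ =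
      openSimplex u (Finset.univ.image Subtype.val) :=
    openSimplex_reindex Subtype.val_injective.injOn (fun _ _ => rfl)
  rw [h2]
  congr 1
  ext i
  simp

lemma IsUnimodular.exists_affineEquiv {n : ℕ} {f : (Fin n → ℝ) → (Fin n → ℝ)}
    (hf : IsUnimodular f) : ∃ φ : (Fin n → ℝ) ≃ᵃ[ℝ] (Fin n → ℝ), ⇑φ = f := by
  obtain ⟨A, hA, b, h⟩ := hf
  have hA' : IsUnit (A.map (Int.cast : ℤ → ℝ)) := by
    rw [Matrix.isUnit_iff_isUnit_det]
    have : (A.map (Int.cast : ℤ → ℝ)).det = (Int.castRingHom ℝ) A.det :=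
      (RingHom.map_det (Int.castRingHom ℝ) A).symm
    rw [this]
    exact hA.map _
  refine ⟨(Matrix.toLin'OfInv (M' := A.map (Int.cast : ℤ → ℝ))
    (M := (A.map (Int.cast : ℤ → ℝ))⁻¹) ?_ ?_).toAffineEquiv.trans
      (AffineEquiv.constVAdd ℝ (Fin n → ℝ) fun i => (b i : ℝ)), ?_⟩
  · exact Matrix.nonsing_inv_mul _ ((Matrix.isUnit_iff_isUnit_det _).1 hA')
  · exact Matrix.mul_nonsing_inv _ ((Matrix.isUnit_iff_isUnit_det _).1 hA')
  · funext x
    rw [h x, add_comm, ← Matrix.toLin'_apply]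
    rfl

lemma IsUnimodular.comp {n : ℕ} {f g : (Fin n → ℝ) → (Fin n → ℝ)}
    (hf : IsUnimodular f) (hg : IsUnimodular g) : IsUnimodular (f ∘ g) := by
  obtain ⟨A, hA, b, h⟩ := hf
  obtain ⟨B, hB, c, k⟩ := hg
  refine ⟨A * B, by rw [Matrix.det_mul]; exact hA.mul hB, A.mulVec c + b, fun x => ?_⟩
  have e : (A * B).map (Int.cast : ℤ → ℝ) = A.map Int.cast * B.map Int.cast :=
    Matrix.map_mul (f := Int.castRingHom ℝ)
  simp only [Function.comp, h, k, e, Matrix.mulVec_add, Matrix.mulVec_mulVec]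
  funext i
  simp [Matrix.mulVec, dotProduct, add_assoc]

lemma IsUnimodular.exists_inverse {n : ℕ} {f : (Fin n → ℝ) → (Fin n → ℝ)}
    (hf : IsUnimodular f) : ∃ g, IsUnimodular g ∧ (∀ x, g (f x) = x) ∧ ∀ x, f (g x) = x := by
  obtain ⟨φ, rfl⟩ := hf.exists_affineEquiv
  refine ⟨φ.symm, ?_, φ.symm_apply_apply, φ.apply_symm_apply⟩
  obtain ⟨A, hA, b, h⟩ := hf
  have e : (A⁻¹).map (Int.cast : ℤ → ℝ) * A.map Int.cast = 1 := by
    have : (A⁻¹ * A).map (Int.cast : ℤ → ℝ) = A⁻¹.map Int.cast * A.map Int.cast :=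
      Matrix.map_mul (f := Int.castRingHom ℝ)
    rw [← this, Matrix.nonsing_inv_mul _ hA]
    simp
  refine ⟨A⁻¹, (Matrix.isUnit_nonsing_inv_det_iff).2 hA, -(A⁻¹.mulVec b), fun x => ?_⟩
  apply φ.injective
  rw [φ.apply_symm_apply]
  obtain ⟨y, rfl⟩ := φ.surjective x
  congr 1
  rw [h y, Matrix.mulVec_add, Matrix.mulVec_mulVec, e, Matrix.one_mulVec]
  funext i
  simp [Matrix.mulVec, dotProduct]

/-- A relatively open unimodular image of one of the seven half-unimodular simplices. -/
def IsPiece (S : Set (Fin 3 → ℝ)) : Prop :=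
  ∃ j : Fin 7, ∃ f, IsUnimodular f ∧ S = intrinsicInterior ℝ (f '' sevenSimplices j)

/-- The origin and the halves of the standard basis vectors. -/
noncomputable def halfBasis : Fin 4 → (Fin 3 → ℝ) :=
  Fin.cons 0 fun k => Pi.single k 2⁻¹

lemma affineIndependent_halfBasis : AffineIndependent ℝ halfBasis := by
  rw [affineIndependent_iff_of_fintype]
  intro w hw h i
  rw [Finset.univ.weightedVSub_eq_weightedVSubOfPoint_of_sum_eq_zero w halfBasis hw 0,
    Finset.weightedVSubOfPoint_apply] at h
  have h' : ∀ k : Fin 3, w k.succ = 0 := fun k => by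
    have := congrFun h k
    simpa [Fin.sum_univ_succ, halfBasis, Finset.sum_apply, Pi.single_apply] using this
  refine Fin.cases ?_ h' i
  rw [Fin.sum_univ_succ] at hw
  simpa [h'] using hw

lemma exists_unimodular_halfBasis (b : Fin 3 → ℤ) (M : Matrix (Fin 3) (Fin 3) ℤ)
    (hM : IsUnit M.det) : ∃ f, IsUnimodular f ∧ f (halfBasis 0) = (fun i => (b i : ℝ)) ∧
      ∀ k : Fin 3, f (halfBasis k.succ) = fun i => (b i : ℝ) + (M i k : ℝ) / 2 := by
  refine ⟨_, ⟨M, hM, b, fun _ => rfl⟩, ?_, fun k => ?_⟩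
  · simp [halfBasis]
  · funext i
    simp [halfBasis, div_eq_mul_inv, add_comm]

lemma halfBasis_eq_smul (k : Fin 3) :
    halfBasis k.succ = (2⁻¹ : ℝ) • (Pi.single k 1 : Fin 3 → ℝ) := by
  simp [halfBasis, ← Pi.single_smul]

/-- The vertex sets, among the points `halfBasis`, of the seven half-unimodular simplices. -/
def sevenVertices : Fin 7 → Finset (Fin 4) :=
  ![{0}, {0, 1}, {0, 1, 2}, {0, 1, 2, 3}, {1}, {1, 2}, {1, 2, 3}]

lemma sevenSimplices_eq (j : Fin 7) :
    sevenSimplices j = convexHull ℝ (halfBasis '' sevenVertices j) := by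
  have h0 : halfBasis 0 = 0 := rfl
  have h1 : halfBasis 1 = (2⁻¹ : ℝ) • (Pi.single 0 1 : Fin 3 → ℝ) := halfBasis_eq_smul 0
  have h2 : halfBasis 2 = (2⁻¹ : ℝ) • (Pi.single 1 1 : Fin 3 → ℝ) := halfBasis_eq_smul 1
  have h3 : halfBasis 3 = (2⁻¹ : ℝ) • (Pi.single 2 1 : Fin 3 → ℝ) := halfBasis_eq_smul 2
  have s0 : {j : Fin 3 | (j : ℕ) < 0} = ∅ := by ext j; simp
  have s1 : {j : Fin 3 | (j : ℕ) < 1} = {0} := by ext j; fin_cases j <;> simp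
  have s2 : {j : Fin 3 | (j : ℕ) < 2} = {0, 1} := by ext j; fin_cases j <;> simp
  have s3 : {j : Fin 3 | (j : ℕ) < 3} = {0, 1, 2} := by ext j; fin_cases j <;> simp
  have hΔ : ∀ s : Set (Fin 3 → ℝ), (2⁻¹ : ℝ) • convexHull ℝ s = convexHull ℝ ((2⁻¹ : ℝ) • s) :=
    fun s => (convexHull_smul _ _).symm
  fin_cases j
  · change Δone 3 0 = convexHull ℝ (halfBasis '' (({0} : Finset (Fin 4)) : Set (Fin 4)))
    rw [Δone, baseSimplex, hΔ, s0]
    simp [h0]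
  · change Δone 3 1 = convexHull ℝ (halfBasis '' (({0, 1} : Finset (Fin 4)) : Set (Fin 4)))
    rw [Δone, baseSimplex, hΔ, s1]
    congr 1
    simp [Set.image_insert_eq, h0, h1, Set.smul_set_insert]
  · change Δone 3 2 = convexHull ℝ (halfBasis '' (({0, 1, 2} : Finset (Fin 4)) : Set (Fin 4)))
    rw [Δone, baseSimplex, hΔ, s2]
    congr 1
    simp [Set.image_insert_eq, h0, h1, h2, Set.smul_set_insert]
  · change Δone 3 3 = convexHull ℝ (halfBasis '' (({0, 1, 2, 3} : Finset (Fin 4)) : Set (Fin 4)))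
    rw [Δone, baseSimplex, hΔ, s3]
    congr 1
    simp [Set.image_insert_eq, h0, h1, h2, h3, Set.smul_set_insert]
  · change Δzero 3 0 = convexHull ℝ (halfBasis '' (({1} : Finset (Fin 4)) : Set (Fin 4)))
    rw [Δzero, hΔ, s1]
    congr 1
    simp [h1]
  · change Δzero 3 1 = convexHull ℝ (halfBasis '' (({1, 2} : Finset (Fin 4)) : Set (Fin 4)))
    rw [Δzero, hΔ, s2]
    congr 1
    simp [Set.image_insert_eq, h1, h2, Set.smul_set_insert]
  · change Δzero 3 2 = convexHull ℝ (halfBasis '' (({1, 2, 3} : Finset (Fin 4)) : Set (Fin 4)))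
    rw [Δzero, hΔ, s3]
    congr 1
    simp [Set.image_insert_eq, h1, h2, h3, Set.smul_set_insert]

lemma exists_perm_sevenVertices : ∀ s : Finset (Fin 4), s.Nonempty →
    ∃ (j : Fin 7) (π : Equiv.Perm (Fin 3)),
      s = (sevenVertices j).image (Fin.cons 0 fun k => (π k).succ) := by
  decide +kernel

lemma isPiece_openSimplex_halfBasis {s : Finset (Fin 4)} (hs : s.Nonempty) :
    IsPiece (openSimplex halfBasis s) := by
  obtain ⟨j, π, h⟩ := exists_perm_sevenVertices s hs
  obtain ⟨f, hf, hf0, hfk⟩ := exists_unimodular_halfBasis 0 (π⁻¹.permMatrix ℤ) (by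
    rw [Matrix.det_permutation]
    simp)
  obtain ⟨φ, rfl⟩ := hf.exists_affineEquiv
  refine ⟨j, φ, hf, ?_⟩
  rw [AffineEquiv.intrinsicInterior_image, sevenSimplices_eq,
    intrinsicInterior_convexHull_image affineIndependent_halfBasis, h,
    ← AffineEquiv.coe_toAffineMap, ← openSimplex_image]
  refine (openSimplex_reindex ?_ ?_).symm
  · intro a _ b _
    refine Fin.cases ?_ (fun a => ?_) a <;> refine Fin.cases ?_ (fun b => ?_) b <;>
      simp [Fin.succ_ne_zero, (Fin.succ_ne_zero _).symm]
  · intro i _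
    refine Fin.cases ?_ (fun k => ?_) i
    · refine hf0.trans ?_
      funext i
      simp [halfBasis]
    · refine (hfk k).trans ?_
      funext i
      simp [halfBasis, Equiv.Perm.permMatrix, PEquiv.toMatrix_apply, Pi.single_apply,
        Equiv.symm_apply_eq, ite_div]

/-- A set that is a finite disjoint union of pieces. -/
def IsGood (S : Set (Fin 3 → ℝ)) : Prop :=
  ∃ F : Set (Set (Fin 3 → ℝ)), F.Finite ∧ F.PairwiseDisjoint id ∧ ⋃₀ F = S ∧ ∀ t ∈ F, IsPiece t

lemma IsPiece.isGood {S : Set (Fin 3 → ℝ)} (h : IsPiece S) : IsGood S :=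
  ⟨{S}, Set.finite_singleton _, Set.pairwiseDisjoint_singleton _ _, by simp, by simpa using h⟩

lemma isGood_empty : IsGood ∅ := ⟨∅, by simp, by simp, by simp, by simp⟩

lemma IsGood.sUnion {C : Set (Set (Fin 3 → ℝ))} (hC : C.Finite) (hd : C.PairwiseDisjoint id)
    (h : ∀ s ∈ C, IsGood s) : IsGood (⋃₀ C) := by
  choose! F h1 h2 h3 h4 using h
  refine ⟨⋃ s ∈ C, F s, hC.biUnion h1, ?_, ?_, ?_⟩
  · intro a ha b hb hab
    simp only [Set.mem_iUnion] at ha hb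
    obtain ⟨s, hs, has⟩ := ha
    obtain ⟨t, ht, hbt⟩ := hb
    by_cases hst : s = t
    · subst hst
      exact h2 s hs has hbt hab
    · refine (hd hs ht hst).mono ?_ ?_
      · change a ⊆ s
        rw [← h3 s hs]
        exact Set.subset_sUnion_of_mem has
      · change b ⊆ t
        rw [← h3 t ht]
        exact Set.subset_sUnion_of_mem hbt
  · simp only [Set.sUnion_iUnion]
    rw [Set.sUnion_eq_biUnion]
    exact Set.iUnion₂_congr h3
  · intro t ht
    simp only [Set.mem_iUnion] at ht
    obtain ⟨s, hs, hts⟩ := ht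
    exact h4 s hs t hts

lemma IsGood.biUnion {κ : Type*} {K : Set κ} (hK : K.Finite) {S : κ → Set (Fin 3 → ℝ)}
    (hd : ∀ i ∈ K, ∀ j ∈ K, ∀ x, x ∈ S i → x ∈ S j → i = j) (h : ∀ i ∈ K, IsGood (S i)) :
    IsGood (⋃ i ∈ K, S i) := by
  rw [← Set.sUnion_image]
  refine IsGood.sUnion (hK.image S) ?_ (by simpa using h)
  rintro _ ⟨i, hi, rfl⟩ _ ⟨j, hj, rfl⟩ hij
  refine Set.disjoint_left.2 fun x hx hy => hij ?_
  rw [hd i hi j hj x hx hy]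

lemma IsGood.union {S T : Set (Fin 3 → ℝ)} (hS : IsGood S) (hT : IsGood T)
    (h : ∀ x ∈ S, x ∉ T) : IsGood (S ∪ T) := by
  rw [← Set.sUnion_pair]
  refine IsGood.sUnion (by simp) ?_ (by simp [hS, hT])
  exact Set.pairwise_pair_of_symm.2 fun _ => Set.disjoint_left.2 h

lemma IsUnimodular.isPiece_image {f : (Fin 3 → ℝ) → (Fin 3 → ℝ)} (hf : IsUnimodular f)
    {S : Set (Fin 3 → ℝ)} (hS : IsPiece S) : IsPiece (f '' S) := by
  obtain ⟨j, g, hg, rfl⟩ := hS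
  refine ⟨j, f ∘ g, hf.comp hg, ?_⟩
  obtain ⟨φ, rfl⟩ := hf.exists_affineEquiv
  rw [Set.image_comp, AffineEquiv.intrinsicInterior_image]

lemma IsUnimodular.isGood_image {f : (Fin 3 → ℝ) → (Fin 3 → ℝ)} (hf : IsUnimodular f)
    {S : Set (Fin 3 → ℝ)} (hS : IsGood S) : IsGood (f '' S) := by
  obtain ⟨F, h1, h2, rfl, h4⟩ := hS
  have hinj : Function.Injective f := by
    obtain ⟨φ, rfl⟩ := hf.exists_affineEquiv
    exact φ.injective
  rw [Set.image_sUnion]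
  refine IsGood.sUnion (h1.image _) ?_ ?_
  · rintro _ ⟨a, ha, rfl⟩ _ ⟨b, hb, rfl⟩ hab
    exact (Set.disjoint_image_iff hinj).2 (h2 ha hb fun h => hab (by rw [h]))
  · rintro _ ⟨a, ha, rfl⟩
    exact (hf.isPiece_image (h4 a ha)).isGood

lemma isPiece_openSimplex {ι : Type*} [Fintype ι] {v : ι → Fin 3 → ℝ} {σ : Finset ι}
    (hσ : σ.Nonempty) (hv : Set.InjOn v σ) {f : (Fin 3 → ℝ) → (Fin 3 → ℝ)} (hf : IsUnimodular f)
    (h : ∀ i ∈ σ, ∃ k, v i = f (halfBasis k)) : IsPiece (openSimplex v σ) := by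
  choose! e he using h
  have hinj : Set.InjOn e σ := fun i hi j hj hij => hv hi hj (by rw [he i hi, he j hj, hij])
  have := hf.isPiece_image (isPiece_openSimplex_halfBasis (hσ.image e))
  obtain ⟨φ, rfl⟩ := hf.exists_affineEquiv
  rw [← AffineEquiv.coe_toAffineMap, ← openSimplex_image] at this
  rwa [openSimplex_reindex (u := φ.toAffineMap ∘ halfBasis) hinj he]

lemma IsGood.exists_family {S : Set (Fin 3 → ℝ)} (hS : IsGood S) :
    ∃ (r : ℕ) (T : Fin r → Set (Fin 3 → ℝ)), Pairwise (Function.onFun Disjoint T) ∧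
      S = (⋃ t, T t) ∧ ∀ t, ∃ j : Fin 7, ∃ f, IsUnimodular f ∧
        T t = intrinsicInterior ℝ (f '' sevenSimplices j) := by
  obtain ⟨F, h1, h2, rfl, h4⟩ := hS
  obtain ⟨r, T, hT, rfl⟩ := h1.fin_param
  refine ⟨r, T, fun i j hij => h2 ⟨i, rfl⟩ ⟨j, rfl⟩ (hT.ne hij), by simp [Set.sUnion_range],
    fun t => h4 _ ⟨t, rfl⟩⟩

lemma exists_bezout (a b : ℤ) : ∃ g p q r s : ℤ, 0 ≤ g ∧ p * a + q * b = g ∧ r * a + s * b = 0 ∧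
    p * s - q * r = 1 := by
  rcases eq_or_ne (Int.gcd a b) 0 with h | h
  · obtain ⟨rfl, rfl⟩ := Int.gcd_eq_zero_iff.1 h
    exact ⟨0, 1, 0, 0, 1, by norm_num⟩
  · have hg : (Int.gcd a b : ℤ) ≠ 0 := by exact_mod_cast h
    obtain ⟨a', ha⟩ := Int.gcd_dvd_left a b
    obtain ⟨b', hb⟩ := Int.gcd_dvd_right a b
    have hbez := Int.gcd_eq_gcd_ab a b
    refine ⟨Int.gcd a b, Int.gcdA a b, Int.gcdB a b, -b', a', by positivity, ?_, ?_, ?_⟩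
    · linarith
    · linear_combination (-b') * ha + a' * hb
    · apply mul_left_cancel₀ hg
      linear_combination (-hbez) - (Int.gcdA a b) * ha - Int.gcdB a b * hb

lemma exists_linearEquiv_mulVec (M : Matrix (Fin 3) (Fin 3) ℤ) (hM : IsUnit M.det) :
    ∃ A : (Fin 3 → ℤ) ≃ₗ[ℤ] (Fin 3 → ℤ), ∀ x, A x = M.mulVec x :=
  ⟨Matrix.toLin'OfInv (M := M⁻¹) (M' := M) (Matrix.nonsing_inv_mul _ hM)
    (Matrix.mul_nonsing_inv _ hM), fun _ => rfl⟩

lemma exists_linearEquiv_coords (a b c d e f g h i : ℤ)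
    (hdet : IsUnit (a * e * i - a * f * h - b * d * i + b * f * g + c * d * h - c * e * g)) :
    ∃ A : (Fin 3 → ℤ) ≃ₗ[ℤ] (Fin 3 → ℤ), ∀ x y z : ℤ,
      A ![x, y, z] = ![a * x + b * y + c * z, d * x + e * y + f * z, g * x + h * y + i * z] := by
  obtain ⟨A, hA⟩ := exists_linearEquiv_mulVec !![a, b, c; d, e, f; g, h, i] (by
    rw [Matrix.det_fin_three]
    simpa using hdet)
  refine ⟨A, fun x y z => ?_⟩
  rw [hA]
  ext i
  fin_cases i <;> simp [Matrix.mulVec, dotProduct, Fin.sum_univ_succ, add_assoc]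

lemma exists_linearEquiv_tail (x₀ : ℤ) (p q r s : ℤ) (h : p * s - q * r = 1) :
    ∃ A : (Fin 3 → ℤ) ≃ₗ[ℤ] (Fin 3 → ℤ), ∀ x y z : ℤ,
      A ![x, y, z] = ![x + x₀ * y, p * y + q * z, r * y + s * z] := by
  have hu : IsUnit (1 : ℤ) := isUnit_one
  obtain ⟨A, hA⟩ := exists_linearEquiv_coords 1 x₀ 0 0 p q 0 r s (by
    rw [← h] at hu
    convert hu using 1
    ring)
  exact ⟨A, fun x y z => by rw [hA]; simp⟩

lemma exists_linearEquiv_head (p q r s : ℤ) (h : p * s - q * r = 1) :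
    ∃ A : (Fin 3 → ℤ) ≃ₗ[ℤ] (Fin 3 → ℤ), ∀ x y z : ℤ,
      A ![x, y, z] = ![p * x + q * y, r * x + s * y, z] := by
  have hu : IsUnit (1 : ℤ) := isUnit_one
  obtain ⟨A, hA⟩ := exists_linearEquiv_coords p q 0 r s 0 0 0 1 (by
    rw [← h] at hu
    convert hu using 1
    ring)
  exact ⟨A, fun x y z => by rw [hA]; simp⟩

/-- The simplex spanned by the origin and the lattice vectors `d i` is nondegenerate and contains
no lattice points besides its vertices. -/
structure IsEmptySimplex {k : ℕ} (d : Fin k → Fin 3 → ℤ) : Prop where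
  indep : ∀ c : Fin k → ℤ, ∑ i, c i • d i = 0 → c = 0
  empty : ∀ (n : ℤ) (c : Fin k → ℤ) (w : Fin 3 → ℤ), 0 < n → (∀ i, 0 ≤ c i) → ∑ i, c i ≤ n →
    ∑ i, c i • d i = n • w → w = 0 ∨ ∃ i, w = d i

namespace IsEmptySimplex

variable {k : ℕ} {d : Fin k → Fin 3 → ℤ}

lemma map (h : IsEmptySimplex d) (A : (Fin 3 → ℤ) ≃ₗ[ℤ] (Fin 3 → ℤ)) :
    IsEmptySimplex fun i => A (d i) := by
  refine ⟨fun c hc => h.indep c ?_, fun n c w hn hc hs hw => ?_⟩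
  · apply A.injective
    simpa only [map_sum, map_zsmul, map_zero] using hc
  · have := h.empty n c (A.symm w) hn hc hs (A.injective (by
      simpa only [map_sum, map_zsmul, LinearEquiv.apply_symm_apply] using hw))
    simpa [LinearEquiv.symm_apply_eq] using this

lemma castSucc {d : Fin (k + 1) → Fin 3 → ℤ} (h : IsEmptySimplex d) :
    IsEmptySimplex fun i : Fin k => d i.castSucc := by
  refine ⟨fun c hc => ?_, fun n c w hn hc hs hw => ?_⟩
  · have := h.indep (Fin.snoc c 0) (by simpa [Fin.sum_univ_castSucc] using hc)
    funext i
    simpa using congrFun this i.castSucc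
  · have h0 := h.indep
    rcases h.empty n (Fin.snoc c 0) w hn (Fin.lastCases (by simp) (by simpa using hc))
      (by simpa [Fin.sum_univ_castSucc] using hs) (by simpa [Fin.sum_univ_castSucc] using hw)
      with h1 | ⟨i, hi⟩
    · exact Or.inl h1
    · revert hi
      refine Fin.lastCases (fun hi => ?_) (fun i hi => Or.inr ⟨i, hi⟩) i
      exfalso
      have := congrFun (h0 (Fin.snoc c (-n)) (by
        simp only [Fin.sum_univ_castSucc, Fin.snoc_castSucc, Fin.snoc_last, hw, hi, neg_smul,
          add_neg_cancel])) (Fin.last k)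
      simp at this
      omega

lemma exists_one {d : Fin 1 → Fin 3 → ℤ} (h : IsEmptySimplex d) :
    ∃ A : (Fin 3 → ℤ) ≃ₗ[ℤ] (Fin 3 → ℤ), A (d 0) = ![1, 0, 0] := by
  obtain ⟨g, p, q, r, s, hg, h1, h2, h3⟩ := exists_bezout (d 0 1) (d 0 2)
  obtain ⟨A, hA⟩ := exists_linearEquiv_tail 0 p q r s h3
  obtain ⟨g', p', q', r', s', hg', h1', h2', h3'⟩ := exists_bezout (d 0 0) g
  obtain ⟨B, hB⟩ := exists_linearEquiv_head p' q' r' s' h3'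
  have hd : d 0 = ![d 0 0, d 0 1, d 0 2] := by ext i; fin_cases i <;> rfl
  have hAB : (A.trans B) (d 0) = ![g', 0, 0] := by
    rw [hd, LinearEquiv.trans_apply, hA, h1, h2, hB]
    simp [h1', h2']
  have he := h.map (A.trans B)
  generalize A.trans B = E at hAB he
  have hg0 : g' ≠ 0 := by
    rintro rfl
    have := he.indep 1 (by
      ext i
      fin_cases i <;> simp [hAB])
    simpa using congrFun this 0
  refine ⟨E, ?_⟩
  rcases he.empty g' 1 ![1, 0, 0] (by omega) (by simp) (by simp; omega)
    (by simp [hAB]) with h | ⟨i, hi⟩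
  · simpa using congrFun h 0
  · rw [hi, Subsingleton.elim i 0]

lemma exists_two {d : Fin 2 → Fin 3 → ℤ} (h : IsEmptySimplex d) :
    ∃ A : (Fin 3 → ℤ) ≃ₗ[ℤ] (Fin 3 → ℤ), A (d 0) = ![1, 0, 0] ∧ A (d 1) = ![0, 1, 0] := by
  obtain ⟨A, hA⟩ := h.castSucc.exists_one
  obtain ⟨g, p, q, r, s, hg, h1, h2, h3⟩ := exists_bezout (A (d 1) 1) (A (d 1) 2)
  obtain ⟨B, hB⟩ := exists_linearEquiv_tail 0 p q r s h3
  have hd : A (d 1) = ![A (d 1) 0, A (d 1) 1, A (d 1) 2] := by ext i; fin_cases i <;> rfl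
  have he := h.map (A.trans B)
  have e0 : (A.trans B) (d 0) = ![1, 0, 0] := by
    rw [LinearEquiv.trans_apply]
    refine (congrArg B hA).trans ?_
    simp [hB]
  set a := A (d 1) 0
  have e1 : (A.trans B) (d 1) = ![a, g, 0] := by
    rw [LinearEquiv.trans_apply, hd, hB, h1, h2]
    simp
  generalize A.trans B = E at e0 e1 he
  have hg0 : g ≠ 0 := by
    rintro rfl
    have := he.indep ![a, -1] (by
      ext i
      fin_cases i <;> simp [e0, e1])
    simpa using congrFun this 1
  have hpos : 0 < g := by omega
  have hg1 : g = 1 := by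
    have hc1 := Int.emod_nonneg (-a) hg0
    have hc2 := Int.emod_lt_of_pos (-a) hpos
    have hc3 := Int.emod_add_mul_ediv (-a) g
    rcases he.empty g ![(-a) % g, 1] ![-((-a) / g), 1, 0] hpos
      (by intro i; fin_cases i <;> simp [hc1]) (by simp; omega)
      (by
        ext i
        fin_cases i <;> simp [e0, e1]
        linarith) with h | ⟨i, hi⟩
    · simpa using congrFun h 1
    · have := congrFun hi 1
      fin_cases i
      · simp [e0] at this
      · simpa [e1] using this.symm
  obtain ⟨D, hD⟩ := exists_linearEquiv_tail (-a) 1 0 0 1 (by norm_num)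
  refine ⟨E.trans D, ?_, ?_⟩
  · rw [LinearEquiv.trans_apply, e0, hD]
    simp
  · rw [LinearEquiv.trans_apply, e1, hD, hg1]
    simp

lemma exists_three {d : Fin 3 → Fin 3 → ℤ} (h : IsEmptySimplex d) :
    ∃ A : (Fin 3 → ℤ) ≃ₗ[ℤ] (Fin 3 → ℤ), ∃ a b N : ℤ, A (d 0) = ![1, 0, 0] ∧
      A (d 1) = ![0, 1, 0] ∧ A (d 2) = ![a, b, N] ∧ 0 < N := by
  obtain ⟨A, hA0, hA1⟩ := h.castSucc.exists_two
  have hd : A (d 2) = ![A (d 2) 0, A (d 2) 1, A (d 2) 2] := by ext i; fin_cases i <;> rfl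
  have hA0' : A (d 0) = ![1, 0, 0] := hA0
  have hA1' : A (d 1) = ![0, 1, 0] := hA1
  set a := A (d 2) 0
  set b := A (d 2) 1
  set N := A (d 2) 2
  have hN : N ≠ 0 := by
    intro hN
    rw [hN] at hd
    have := (h.map A).indep ![a, b, -1] (by
      ext i
      fin_cases i <;> simp [Fin.sum_univ_succ, hd, hA0', hA1'])
    simpa using congrFun this 2
  rcases lt_or_gt_of_ne hN with h' | h'
  · obtain ⟨D, hD⟩ := exists_linearEquiv_coords 1 0 0 0 1 0 0 0 (-1) (by norm_num)
    refine ⟨A.trans D, a, b, -N, ?_, ?_, ?_, by omega⟩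
    all_goals
      rw [LinearEquiv.trans_apply]
      simp [hA0', hA1', hd, hD]
  · exact ⟨A, a, b, N, hA0, hA1, hd, h'⟩

end IsEmptySimplex

set_option maxHeartbeats 800000 in
lemma false_of_floor_sum {N a b c : ℤ} (hab : b ≤ a) (hbc : c ≤ b) (hc : 2 ≤ c)
    (hsum : a + b + c = N + 1)
    (hF : ∀ z, 0 < z → z < N → a * z / N + b * z / N + c * z / N = z - 1)
    (h0 : ∀ z, 0 < z → z < N → a * z % N ≠ 0) : False := by
  have hN : 0 < N := by omega
  have le_iff : ∀ k x : ℤ, k ≤ x / N ↔ k * N ≤ x := fun k x => Int.le_ediv_iff_mul_le hN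
  have lt_iff : ∀ k x : ℤ, x / N < k ↔ x < k * N := fun k x => Int.ediv_lt_iff_lt_mul hN
  have ceil : ∀ M : ℤ, ∀ e > 0, ∃ m : ℤ, M ≤ e * m ∧ e * (m - 1) < M := fun M e he => by
    refine ⟨-((-M) / e), ?_, ?_⟩
    · have := Int.emod_add_mul_ediv (-M) e
      have := Int.emod_nonneg (-M) he.ne'
      linarith
    · have := Int.emod_add_mul_ediv (-M) e
      have := Int.emod_lt_of_pos (-M) he
      linarith
  obtain ⟨d, hd⟩ : ∃ d, d = N - a := ⟨_, rfl⟩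
  have hdF : ∀ z, 0 ≤ z → z < N → d * z / N = b * z / N + c * z / N := by
    intro z hz hzN
    rcases hz.eq_or_lt with rfl | hz
    · simp
    have h1 := hF z hz hzN
    have h2 := h0 z hz hzN
    have h3 := Int.emod_nonneg (a * z) hN.ne'
    have h4 := Int.emod_lt_of_pos (a * z) hN
    have h5 := Int.emod_add_mul_ediv (a * z) N
    have h6 : d * z / N = z - 1 - a * z / N := by
      apply le_antisymm
      · have : d * z / N < z - 1 - a * z / N + 1 := by
          rw [lt_iff, hd]
          have : 0 < a * z % N := by omega
          nlinarith
        omega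
      · rw [le_iff, hd]
        nlinarith
    omega
  have h2d : 2 * d ≤ N := by
    have h1 := hF 2 (by norm_num) (by omega)
    have h2 : b * 2 / N ≤ a * 2 / N := Int.ediv_le_ediv hN (by omega)
    have h3 : c * 2 / N ≤ a * 2 / N := Int.ediv_le_ediv hN (by omega)
    have h4 : 1 ≤ a * 2 / N := by omega
    rw [le_iff] at h4
    omega
  obtain ⟨m, hm1, hm2⟩ := ceil N b (by omega)
  obtain ⟨z₀, hz1, hz2⟩ := ceil N c (by omega)
  have hm0 : 1 < m := by nlinarith
  have hz0N : z₀ < N := by nlinarith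
  have hmz : m ≤ z₀ := by nlinarith
  have jump : ∀ z, 0 < z → z < N → d * z / N ≤ d * (z - 1) / N + 1 := by
    intro z _ _
    have h1 : d * (z - 1) / N < d * (z - 1) / N + 1 := by omega
    rw [lt_iff] at h1
    have h2 : d * z / N < d * (z - 1) / N + 1 + 1 := by
      rw [lt_iff]
      nlinarith
    omega
  have hbm : b * (m - 1) / N = 0 := Int.ediv_eq_zero_of_lt (by nlinarith) hm2
  have hcz : c * (z₀ - 1) / N = 0 := Int.ediv_eq_zero_of_lt (by nlinarith) hz2
  have hcm : c * (m - 1) / N = 0 := Int.ediv_eq_zero_of_lt (by nlinarith) (by nlinarith)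
  have hbm' : 1 ≤ b * m / N := by rw [le_iff]; linarith
  have hcz' : 1 ≤ c * z₀ / N := by rw [le_iff]; linarith
  have hmlt : m < z₀ := by
    rcases hmz.eq_or_lt with h | h
    · have h1 := jump m (by omega) (by omega)
      rw [hdF m (by omega) (by omega), hdF (m - 1) (by omega) (by omega)] at h1
      rw [← h] at hcz'
      omega
    · exact h
  have hdm : d * (m - 1) < N := by
    have : d * (m - 1) / N < 1 := by
      rw [hdF (m - 1) (by omega) (by omega)]
      omega
    rw [lt_iff] at this
    linarith
  obtain ⟨k, hk⟩ : ∃ k, k = b * z₀ / N := ⟨_, rfl⟩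
  have hmono : b * (z₀ - 1) / N ≤ b * z₀ / N := Int.ediv_le_ediv hN (by nlinarith)
  have hk' : b * (z₀ - 1) / N = k := by
    have h1 := jump z₀ (by omega) (by omega)
    rw [hdF z₀ (by omega) (by omega), hdF (z₀ - 1) (by omega) (by omega)] at h1
    omega
  have hk1 : 1 ≤ k := by
    rw [← hk', le_iff]
    nlinarith
  obtain ⟨z₁, hz11, hz12⟩ := ceil (k * N) b (by omega)
  have hkz : k * N ≤ b * (z₀ - 1) := by
    rw [← le_iff]
    omega
  have hz1z0 : z₁ ≤ z₀ - 1 := by nlinarith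
  have hz1pos : 0 < z₁ := by nlinarith
  have hlow : d * (z₁ - 1) < k * N := by
    rw [← lt_iff, hdF (z₁ - 1) (by omega) (by omega)]
    have h1 : b * (z₁ - 1) / N < k := by rwa [lt_iff]
    have h2 : c * (z₁ - 1) / N < 1 := by
      rw [lt_iff]
      nlinarith
    omega
  have hz2 : z₀ < z₁ + m := by
    have : b * z₀ < (k + 1) * N := by
      rw [← lt_iff]
      omega
    nlinarith
  have hhigh : (k + 2) * N ≤ d * (z₁ + m) := by
    rcases lt_or_ge (z₁ + m) N with h | h
    · rw [← le_iff, hdF _ (by omega) h]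
      have h1 : k + 1 ≤ b * (z₁ + m) / N := by
        rw [le_iff]
        nlinarith
      have h2 : 1 ≤ c * (z₁ + m) / N := by
        rw [le_iff]
        nlinarith
      omega
    · have h1 : k < b := by
        rw [hk, lt_iff]
        exact mul_lt_mul_of_pos_left hz0N (by omega)
      have h2 : k + 2 ≤ d := by omega
      calc (k + 2) * N ≤ d * N := mul_le_mul_of_nonneg_right h2 hN.le
        _ ≤ d * (z₁ + m) := mul_le_mul_of_nonneg_left h (by omega)
  linarith

lemma exists_eq_one_of_emod_sum {N a b c : ℤ} (ha : 0 < a) (hb : 0 < b) (hc : 0 < c)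
    (hsum : a + b + c = N + 1)
    (h : ∀ z, 0 < z → z < N → a * z % N + b * z % N + c * z % N = N + z)
    (ha0 : ∀ z, 0 < z → z < N → a * z % N ≠ 0) (hb0 : ∀ z, 0 < z → z < N → b * z % N ≠ 0)
    (hc0 : ∀ z, 0 < z → z < N → c * z % N ≠ 0) : a = 1 ∨ b = 1 ∨ c = 1 := by
  by_contra! hne
  obtain ⟨ha1, hb1, hc1⟩ := hne
  have hN : 0 < N := by omega
  have hF : ∀ z, 0 < z → z < N → a * z / N + b * z / N + c * z / N = z - 1 := by
    intro z hz hzN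
    have h1 := h z hz hzN
    have h2 := Int.emod_add_mul_ediv (a * z) N
    have h3 := Int.emod_add_mul_ediv (b * z) N
    have h4 := Int.emod_add_mul_ediv (c * z) N
    apply mul_left_cancel₀ hN.ne'
    linear_combination h2 + h3 + h4 - h1 + z * hsum
  rcases le_total a b with h1 | h1 <;> rcases le_total b c with h2 | h2 <;>
    rcases le_total a c with h3 | h3
  · exact false_of_floor_sum h2 h1 (by omega) (by omega)
      (fun z hz hzN => by rw [← hF z hz hzN]; ring) hc0
  · exact false_of_floor_sum h2 h1 (by omega) (by omega)
      (fun z hz hzN => by rw [← hF z hz hzN]; ring) hc0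
  · exact false_of_floor_sum h2 h3 (by omega) (by omega)
      (fun z hz hzN => by rw [← hF z hz hzN]; ring) hb0
  · exact false_of_floor_sum h1 h3 (by omega) (by omega)
      (fun z hz hzN => by rw [← hF z hz hzN]; ring) hb0
  · exact false_of_floor_sum h3 h1 (by omega) (by omega)
      (fun z hz hzN => by rw [← hF z hz hzN]; ring) hc0
  · exact false_of_floor_sum h3 h2 (by omega) (by omega)
      (fun z hz hzN => by rw [← hF z hz hzN]; ring) ha0
  · exact false_of_floor_sum h1 h2 (by omega) (by omega)
      (fun z hz hzN => by rw [← hF z hz hzN]) ha0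
  · exact false_of_floor_sum h1 h2 (by omega) (by omega)
      (fun z hz hzN => by rw [← hF z hz hzN]) ha0

lemma dvd_of_forall_not {a b N : ℤ} (hN : 0 < N)
    (hE : ∀ x y z : ℤ, 0 < z → z < N → 0 ≤ N * x - a * z → 0 ≤ N * y - b * z →
      ¬ (N * x - a * z) + (N * y - b * z) + z ≤ N) :
    N = 1 ∨ N ∣ a - 1 ∨ N ∣ b - 1 ∨ N ∣ a + b := by
  rcases eq_or_ne N 1 with h1 | h1
  · exact Or.inl h1
  have h0 : ∀ x, 0 ≤ x % N := fun x => Int.emod_nonneg x hN.ne'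
  have hlt : ∀ x, x % N < N := fun x => Int.emod_lt_of_pos x hN
  have hdiv : ∀ x, x % N + N * (x / N) = x := fun x => Int.emod_add_mul_ediv x N
  have key : ∀ z, 0 < z → z < N →
      2 * N ≤ -(a * z) % N + -(b * z) % N + (a + b - 1) * z % N + z := by
    intro z hz hzN
    have ha := hdiv (-(a * z))
    have hb := hdiv (-(b * z))
    have hc := hdiv ((a + b - 1) * z)
    have h2 := hE (-(-(a * z) / N)) (-(-(b * z) / N)) z hz hzN
      (by linarith [h0 (-(a * z))]) (by linarith [h0 (-(b * z))])
    have h3 := h0 ((a + b - 1) * z)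
    have h4 : 1 < -(-(a * z) / N) - (-(b * z) / N) - ((a + b - 1) * z / N) := by
      by_contra! h5
      have := mul_le_mul_of_nonneg_left h5 hN.le
      apply h2
      linarith
    have := mul_le_mul_of_nonneg_left (Int.add_one_le_of_lt h4) hN.le
    linarith
  have comp : ∀ t z, t * z % N + t * (N - z) % N ≤ N := by
    intro t z
    have h2 := hdiv (t * z)
    have h3 := hdiv (t * (N - z))
    have h4 : t - t * z / N - t * (N - z) / N < 2 := by
      by_contra! h5
      have := mul_le_mul_of_nonneg_left h5 hN.le
      linarith [hlt (t * z), hlt (t * (N - z))]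
    have := mul_le_mul_of_nonneg_left (Int.le_of_lt_add_one (b := 1) h4) hN.le
    linarith
  have main : ∀ z, 0 < z → z < N → (-a * z % N ≠ 0 ∧ -b * z % N ≠ 0 ∧ (a + b - 1) * z % N ≠ 0) ∧
      -a * z % N + -b * z % N + (a + b - 1) * z % N + z = 2 * N := by
    intro z hz hzN
    have h2 := key z hz hzN
    have h3 := key (N - z) (by omega) (by omega)
    simp only [← neg_mul] at h2 h3
    have h4 := comp (-a) z
    have h5 := comp (-b) z
    have h6 := comp (a + b - 1) z
    have := hlt (-a * (N - z))
    have := hlt (-b * (N - z))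
    have := hlt ((a + b - 1) * (N - z))
    refine ⟨⟨?_, ?_, ?_⟩, ?_⟩ <;> omega
  have flip : ∀ t z, t * z % N ≠ 0 → (-t % N) * z % N = N - t * z % N := by
    intro t z ht
    have h2 := hdiv (t * z)
    have h3 := h0 (t * z)
    have h4 := hlt (t * z)
    have h5 : (-t % N) * z = (N - t * z % N) + N * (-(t * z / N) - 1 - (-t / N) * z) := by
      linear_combination z * hdiv (-t) + h2
    rw [h5, Int.add_mul_emod_self_left]
    exact Int.emod_eq_of_lt (by omega) (by omega)
  have ne : ∀ t z, t * z % N ≠ 0 → (-t % N) * z % N ≠ 0 := by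
    intro t z ht
    rw [flip t z ht]
    have := hlt (t * z)
    omega
  have hsum := main 1 one_pos (by omega)
  have pos : ∀ t, t * 1 % N ≠ 0 → 0 < -t % N := by
    intro t ht
    have h2 := ne t 1 ht
    have h3 := h0 (-t)
    rcases h3.eq_or_lt with h4 | h4
    · rw [← h4] at h2
      simp at h2
    · exact h4
  have one : ∀ t, t * 1 % N ≠ 0 → -t % N = N - t * 1 % N := by
    intro t ht
    have h2 := flip t 1 ht
    rwa [mul_one, Int.emod_emod_of_dvd _ dvd_rfl] at h2
  have e1 := one _ hsum.1.1
  have e2 := one _ hsum.1.2.1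
  have e3 := one _ hsum.1.2.2
  have dvd : ∀ t, t % N = 1 → N ∣ t - 1 := fun t ht => ⟨t / N, by linarith [hdiv t]⟩
  rcases exists_eq_one_of_emod_sum (pos _ hsum.1.1) (pos _ hsum.1.2.1) (pos _ hsum.1.2.2)
    (by linarith [hsum.2])
    (fun z hz hzN => by
      obtain ⟨⟨m1, m2, m3⟩, m4⟩ := main z hz hzN
      rw [flip _ _ m1, flip _ _ m2, flip _ _ m3]
      linarith)
    (fun z hz hzN => ne _ _ (main z hz hzN).1.1) (fun z hz hzN => ne _ _ (main z hz hzN).1.2.1)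
    (fun z hz hzN => ne _ _ (main z hz hzN).1.2.2) with h | h | h
  · right; left
    have := dvd _ h
    rwa [neg_neg] at this
  · right; right; left
    have := dvd _ h
    rwa [neg_neg] at this
  · right; right; right
    have := dvd _ h
    rw [show -(a + b - 1) - 1 = -(a + b) by ring] at this
    exact (dvd_neg).1 this

/-- The vertices of the lattice tetrahedra of width one with no further lattice points. -/
def emptyVertex (p q : ℤ) : Fin 4 → Fin 3 → ℤ :=
  ![![0, 0, 0], ![1, 0, 0], ![0, 0, 1], ![p, q, 1]]

/-- There is no lattice point in the tetrahedron with vertices `0`, `e₁`, `e₂`, `(a, b, N)` at a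
height strictly between `0` and `N`. -/
def IsEmptyTetrahedron (a b N : ℤ) : Prop :=
  ∀ x y z : ℤ, 0 < z → z < N → 0 ≤ N * x - a * z → 0 ≤ N * y - b * z →
    ¬ (N * x - a * z) + (N * y - b * z) + z ≤ N

namespace IsEmptyTetrahedron

variable {a b N : ℤ}

lemma swap (h : IsEmptyTetrahedron a b N) : IsEmptyTetrahedron b a N :=
  fun x y z h1 h2 h3 h4 h5 => h y x z h1 h2 h4 h3 (by linarith)

lemma rotate (h : IsEmptyTetrahedron a b N) : IsEmptyTetrahedron b (1 - a - b) N :=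
  fun x y z h1 h2 h3 h4 h5 => h (1 - x - y) x z h1 h2 (by linarith) h3 (by linarith)

lemma exists_linearEquiv (h : IsEmptyTetrahedron a b N) (hN : 0 < N) (hb : N ∣ b - 1) :
    ∃ (A : (Fin 3 → ℤ) ≃ₗ[ℤ] (Fin 3 → ℤ)) (p q : ℤ), 1 ≤ q ∧ IsCoprime p q ∧
      A ![1, 0, 0] = ![1, 0, 0] ∧ A ![0, 1, 0] = ![0, 0, 1] ∧ A ![a, b, N] = ![p, q, 1] := by
  obtain ⟨k, hk⟩ := hb
  obtain ⟨A, hA⟩ := exists_linearEquiv_coords 1 0 0 0 0 1 0 1 (-k) (by norm_num)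
  refine ⟨A, a, N, hN, ?_, by simp [hA], by simp [hA], ?_⟩
  · rw [Int.isCoprime_iff_gcd_eq_one]
    by_contra hg
    obtain ⟨a', ha'⟩ := Int.gcd_dvd_left a N
    obtain ⟨n, hn⟩ := Int.gcd_dvd_right a N
    have hg0 : Int.gcd a N ≠ 0 := by
      rw [Ne, Int.gcd_eq_zero_iff]
      omega
    have hg2 : (2 : ℤ) ≤ Int.gcd a N := by omega
    set g : ℤ := (Int.gcd a N : ℤ)
    have hn0 : 0 < n := by
      by_contra!
      nlinarith
    have hnN : n < N := by nlinarith
    have e1 : N * a' - a * n = 0 := by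
      linear_combination a' * hn - n * ha'
    have e2 : N * (k * n + 1) - b * n = N - n := by
      linear_combination -n * hk
    refine h a' (k * n + 1) n hn0 hnN e1.ge (by omega) (by omega)
  · rw [hA]
    ext i
    fin_cases i <;> simp
    linear_combination hk

end IsEmptyTetrahedron

lemma IsEmptySimplex.exists_emptyVertex {k : ℕ} {d : Fin k → Fin 3 → ℤ} (h : IsEmptySimplex d) :
    ∃ (A : (Fin 3 → ℤ) ≃ₗ[ℤ] (Fin 3 → ℤ)) (w : Fin 3 → ℤ) (p q : ℤ)
      (e : Fin (k + 1) → Fin 4), 1 ≤ q ∧ IsCoprime p q ∧ Function.Injective e ∧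
      w = emptyVertex p q (e 0) ∧ ∀ i, A (d i) + w = emptyVertex p q (e i.succ) := by
  have hk : k ≤ 3 := by
    have hi : LinearIndependent ℤ d :=
      Fintype.linearIndependent_iff.2 fun c hc i => congrFun (h.indep c hc) i
    simpa using hi.fintype_card_le_finrank
  have hz : ![0, 0, 0] = (0 : Fin 3 → ℤ) := by ext i; fin_cases i <;> rfl
  obtain ⟨W, hW⟩ := exists_linearEquiv_coords 1 0 0 0 0 1 0 1 0 (by norm_num)
  interval_cases k
  · exact ⟨LinearEquiv.refl ℤ _, 0, 0, 1, fun _ => 0, le_rfl, isCoprime_one_right,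
      fun i j _ => Fin.ext (by omega), by simp [emptyVertex, hz], fun i => i.elim0⟩
  · obtain ⟨A, hA⟩ := h.exists_one
    refine ⟨A, 0, 0, 1, ![0, 1], le_rfl, isCoprime_one_right, by decide, by simp [emptyVertex, hz], ?_⟩
    intro i
    fin_cases i
    simp [emptyVertex, hz, hA]
  · obtain ⟨A, hA, hA'⟩ := h.exists_two
    refine ⟨A.trans W, 0, 0, 1, ![0, 1, 2], le_rfl, isCoprime_one_right, by decide,
      by simp [emptyVertex, hz], ?_⟩
    intro i
    fin_cases i <;> simp [emptyVertex, hz, hA, hA', hW]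
  · obtain ⟨A, a, b, N, h1, h2, h3, hN⟩ := h.exists_three
    have hE : IsEmptyTetrahedron a b N := by
      intro x y z hz hzN hx hy hxy
      rcases (h.map A).empty N ![N * x - a * z, N * y - b * z, z] ![x, y, z] hN
        (by intro i; fin_cases i <;> simp <;> omega) (by simpa [Fin.sum_univ_three] using hxy)
        (by
          ext i
          fin_cases i <;> simp [Fin.sum_univ_three, h1, h2, h3] <;> ring) with h' | ⟨i, hi⟩
      · have := congrFun h' 2
        simp at this
        omega
      · have := congrFun hi 2
        fin_cases i <;> simp [h1, h2, h3] at this <;> omega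
    rcases dvd_of_forall_not hN hE with h' | h' | h' | h'
    · obtain ⟨B, p, q, hq, hpq, b1, b2, b3⟩ := hE.exists_linearEquiv hN (by simp [h'])
      refine ⟨A.trans B, 0, p, q, ![0, 1, 2, 3], hq, hpq, by decide, by simp [emptyVertex, hz], ?_⟩
      intro i
      fin_cases i <;> simp [emptyVertex, hz, h1, h2, h3, b1, b2, b3]
    · obtain ⟨B, p, q, hq, hpq, b1, b2, b3⟩ := hE.swap.exists_linearEquiv hN h'
      obtain ⟨V, hV⟩ := exists_linearEquiv_coords 0 1 0 1 0 0 0 0 1 (by norm_num)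
      refine ⟨(A.trans V).trans B, 0, p, q, ![0, 2, 1, 3], hq, hpq, by decide,
        by simp [emptyVertex, hz], ?_⟩
      intro i
      fin_cases i <;> simp [emptyVertex, hz, h1, h2, h3, b1, b2, b3, hV]
    · obtain ⟨B, p, q, hq, hpq, b1, b2, b3⟩ := hE.exists_linearEquiv hN h'
      refine ⟨A.trans B, 0, p, q, ![0, 1, 2, 3], hq, hpq, by decide, by simp [emptyVertex, hz], ?_⟩
      intro i
      fin_cases i <;> simp [emptyVertex, hz, h1, h2, h3, b1, b2, b3]
    · obtain ⟨B, p, q, hq, hpq, b1, b2, b3⟩ := hE.rotate.exists_linearEquiv hN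
        (by rw [show 1 - a - b - 1 = -(a + b) by ring]; exact h'.neg_right)
      obtain ⟨V, hV⟩ := exists_linearEquiv_coords 0 1 0 (-1) (-1) 0 0 0 1 (by norm_num)
      refine ⟨(A.trans V).trans B, ![0, 0, 1], p, q, ![2, 0, 1, 3], hq, hpq, by decide,
        by simp [emptyVertex, hz], ?_⟩
      have key : ∀ x y z : ℤ, B (V ![x, y, z]) + ![0, 0, 1] = B ![y, 1 - x - y, z] := by
        intro x y z
        rw [← b2, hV, ← map_add]
        congr 1
        simp
        ring
      intro i
      fin_cases i
      · simp [emptyVertex, hz, h1, key]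
      · simp [emptyVertex, hz, h2, key, b1]
      · simp [emptyVertex, hz, h3, key, b3]

/-- The lattice points with indices in `σ` are affinely independent, and no other affine relation
that is nonnegative off `σ` decreases the weights `w₁`, `w₂` lexicographically. -/
structure IsCell {ι : Type*} (w : ι → Fin 3 → ℤ) (w₁ w₂ : ι → ℤ) (σ : Finset ι) : Prop where
  indep : ∀ {n : ℕ} (a : Fin n → ι), Function.Injective a → (∀ j, a j ∈ σ) → ∀ c : Fin n → ℤ,
    ∑ j, c j = 0 → ∑ j, c j • w (a j) = 0 → c = 0
  nonneg : ∀ {n : ℕ} (a : Fin n → ι) (c : Fin n → ℤ), (∀ j, 0 ≤ c j ∨ a j ∈ σ) →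
    ∑ j, c j = 0 → ∑ j, c j • w (a j) = 0 → 0 ≤ ∑ j, c j * w₁ (a j) ∧
      (∑ j, c j * w₁ (a j) = 0 → 0 ≤ ∑ j, c j * w₂ (a j))

lemma exists_lattice_triangulation {ι : Type*} [Fintype ι] (w : ι → Fin 3 → ℤ) (w₁ w₂ : ι → ℤ)
    (r : ℝ) (v : ι → Fin 3 → ℝ) (hv : ∀ i, v i = r • fun k => (w i k : ℝ)) :
    ∃ C : Set (Finset ι), (∀ x ∈ convexHull ℝ (Set.range v), ∃ σ ∈ C, x ∈ openSimplex v σ) ∧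
      (∀ σ ∈ C, ∀ τ ∈ C, ∀ x, x ∈ openSimplex v σ → x ∈ openSimplex v τ → σ = τ) ∧
      ∀ σ ∈ C, IsCell w w₁ w₂ σ := by
  classical
  obtain ⟨C, h1, h2, h3, h4⟩ :=
    exists_regular_triangulation v (fun i => (w₁ i : ℝ)) (fun i => (w₂ i : ℝ))
  have sum : ∀ {n : ℕ} (a : Fin n → ι) (c : Fin n → ℤ) (F : ι → ℝ),
      ∑ i, F i * ∑ j, (if a j = i then (c j : ℝ) else 0) = ∑ j, c j * F (a j) := by
    intro n a c F
    simp only [Finset.mul_sum]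
    rw [Finset.sum_comm]
    refine Finset.sum_congr rfl fun j _ => ?_
    simp [mul_comm]
  have sumv : ∀ {n : ℕ} (a : Fin n → ι) (c : Fin n → ℤ), ∑ j, c j • w (a j) = 0 →
      ∑ i, (∑ j, (if a j = i then (c j : ℝ) else 0)) • v i = 0 := by
    intro n a c hc
    funext k
    have hk := congrFun hc k
    simp only [Finset.sum_apply, Pi.smul_apply, smul_eq_mul, Pi.zero_apply] at hk ⊢
    have hk' : ∑ j, (c j : ℝ) * (w (a j) k : ℝ) = 0 := by exact_mod_cast hk
    have e := sum a c fun i => v i k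
    simp only [mul_comm _ (v _ k)]
    rw [e]
    simp only [hv, Pi.smul_apply, smul_eq_mul, mul_left_comm _ r]
    rw [← Finset.mul_sum, hk', mul_zero]
  have sum1 : ∀ {n : ℕ} (a : Fin n → ι) (c : Fin n → ℤ), ∑ j, c j = 0 →
      ∑ i, ∑ j, (if a j = i then (c j : ℝ) else 0) = 0 := by
    intro n a c hc
    have e := sum a c fun _ => 1
    simp only [one_mul, mul_one] at e
    rw [e]
    exact_mod_cast hc
  refine ⟨C, h1, h2, fun σ hσ => ⟨fun a ha haσ c hc hw => ?_, fun a c hcσ hc hw => ?_⟩⟩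
  · have := h3 σ hσ (fun i => ∑ j, (if a j = i then (c j : ℝ) else 0)) (fun i hi => ?_)
      (sum1 a c hc) (sumv a c hw)
    · funext j
      have hj := congrFun this (a j)
      simp only [ha.eq_iff, Finset.sum_ite_eq', Finset.mem_univ, if_true, Pi.zero_apply] at hj
      exact_mod_cast hj
    · refine Finset.sum_eq_zero fun j _ => if_neg ?_
      rintro rfl
      exact hi (haσ j)
  · have := h4 σ hσ (fun i => ∑ j, (if a j = i then (c j : ℝ) else 0)) (fun i hi => ?_)
      (sum1 a c hc) (sumv a c hw)
    · rw [sum, sum] at this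
      exact_mod_cast this
    · refine Finset.sum_nonneg fun j _ => ?_
      split_ifs with h
      · subst h
        exact_mod_cast (hcσ j).resolve_right hi
      · exact le_rfl

lemma exists_pos_le {k : ℕ} {t x : Fin k → ℤ} {n y : ℤ} (hn : 0 < n) (ht : ∀ j, 0 ≤ t j)
    (h1 : ∑ j, t j = n) (hx : ∑ j, t j * x j = n * y) : ∃ j, 0 < t j ∧ x j ≤ y := by
  by_contra! h
  have h2 : ∑ j, t j * (x j - y) = 0 := by
    simp only [mul_sub, Finset.sum_sub_distrib, hx, ← Finset.sum_mul, h1, sub_self]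
  have h3 : ∀ j, 0 ≤ t j * (x j - y) := fun j => by
    rcases (ht j).eq_or_lt with h4 | h4
    · simp [← h4]
    · exact mul_nonneg h4.le (by linarith [h j h4])
  rw [Finset.sum_eq_zero_iff_of_nonneg fun j _ => h3 j] at h2
  have h5 : ∀ j, t j = 0 := fun j => by
    by_contra hj
    have h6 := lt_of_le_of_ne (ht j) (Ne.symm hj)
    have := (mul_pos h6 (sub_pos.2 (h j h6))).ne' 
    exact this (h2 j (Finset.mem_univ j))
  simp [h5] at h1
  omega

lemma exists_pos_ge {k : ℕ} {t x : Fin k → ℤ} {n y : ℤ} (hn : 0 < n) (ht : ∀ j, 0 ≤ t j)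
    (h1 : ∑ j, t j = n) (hx : ∑ j, t j * x j = n * y) : ∃ j, 0 < t j ∧ y ≤ x j := by
  obtain ⟨j, h2, h3⟩ := exists_pos_le (x := fun j => -x j) (y := -y) hn ht h1 (by simp [hx])
  exact ⟨j, h2, by linarith⟩

/-- If the points whose squares occur in a weight satisfying Jensen's inequality in reverse carry
positive coefficients, then they agree. -/
lemma eq_of_sum_mul_sq_le {k : ℕ} {t x : Fin k → ℤ} {n y : ℤ} (ht : ∀ j, 0 ≤ t j)
    (h1 : ∑ j, t j = n) (hx : ∑ j, t j * x j = n * y) (h : ∑ j, t j * x j ^ 2 ≤ n * y ^ 2) {j}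
    (hj : 0 < t j) : x j = y := by
  have h2 : ∑ j, t j * (x j - y) ^ 2 = ∑ j, t j * x j ^ 2 - n * y ^ 2 := by
    have : ∀ j, t j * (x j - y) ^ 2 = t j * x j ^ 2 - 2 * y * (t j * x j) + y ^ 2 * t j :=
      fun j => by ring
    simp only [this, Finset.sum_add_distrib, Finset.sum_sub_distrib, ← Finset.mul_sum, hx, h1]
    ring
  have h3 : ∑ j, t j * (x j - y) ^ 2 = 0 :=
    le_antisymm (by linarith) (Finset.sum_nonneg fun j _ => mul_nonneg (ht j) (sq_nonneg _))
  rw [Finset.sum_eq_zero_iff_of_nonneg fun j _ => mul_nonneg (ht j) (sq_nonneg _)] at h3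
  have := h3 j (Finset.mem_univ j)
  have h4 : (x j - y) ^ 2 = 0 := (mul_eq_zero.1 this).resolve_left hj.ne'
  linarith [pow_eq_zero_iff (two_ne_zero) |>.1 h4]

lemma IsCell.isEmptySimplex {ι : Type*} {w : ι → Fin 3 → ℤ} {w₁ w₂ : ι → ℤ} {σ : Finset ι}
    (h : IsCell w w₁ w₂ σ) {k : ℕ} {a : Fin (k + 1) → ι} (ha : Function.Injective a)
    (haσ : ∀ j, a j ∈ σ)
    (hp : ∀ (n : ℤ) (t : Fin (k + 1) → ℤ) (p : Fin 3 → ℤ), 0 < n → (∀ j, 0 ≤ t j) →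
      ∑ j, t j = n → ∑ j, t j • w (a j) = n • p → ∃ i j, w i = p ∧
        (0 ≤ n * w₁ i - ∑ j, t j * w₁ (a j) → p = w (a j))) :
    IsEmptySimplex fun i : Fin k => w (a i.succ) - w (a 0) := by
  refine ⟨fun c hc => ?_, fun n c u hn hc hs hu => ?_⟩
  · have := h.indep a ha haσ (Fin.cons (-∑ i, c i) c) (by simp [Fin.sum_univ_succ]) (by
      simp only [smul_sub, Finset.sum_sub_distrib, ← Finset.sum_smul] at hc
      simp only [Fin.sum_univ_succ, Fin.cons_zero, Fin.cons_succ, neg_smul]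
      rw [← hc]
      abel)
    funext i
    simpa using congrFun this i.succ
  · have e1 : ∑ j, (Fin.cons (n - ∑ i, c i) c : Fin (k + 1) → ℤ) j = n := by
      simp [Fin.sum_univ_succ]
    have e2 : ∑ j, (Fin.cons (n - ∑ i, c i) c : Fin (k + 1) → ℤ) j • w (a j) =
        n • (u + w (a 0)) := by
      simp only [smul_sub, Finset.sum_sub_distrib, ← Finset.sum_smul] at hu
      simp only [Fin.sum_univ_succ, Fin.cons_zero, Fin.cons_succ, sub_smul, smul_add]
      rw [← hu]
      abel
    obtain ⟨i, j, hi, hj⟩ := hp n _ _ hn (Fin.cases (by simpa using hs) (by simpa using hc)) e1 e2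
    have h2 := (h.nonneg (Fin.cons i a) (Fin.cons n (-(Fin.cons (n - ∑ i, c i) c))) (fun j => by
      refine Fin.cases ?_ (fun j => ?_) j
      · exact Or.inl hn.le
      · exact Or.inr (haσ j)) (by
      rw [Fin.sum_univ_succ]
      simp only [Fin.cons_zero, Fin.cons_succ, Pi.neg_apply, Finset.sum_neg_distrib, e1]
      ring) (by
      rw [Fin.sum_univ_succ]
      simp only [Fin.cons_zero, Fin.cons_succ, Pi.neg_apply, Finset.sum_neg_distrib, neg_smul, e2,
        hi]
      abel)).1
    rw [Fin.sum_univ_succ] at h2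
    simp only [Fin.cons_zero, Fin.cons_succ, Pi.neg_apply, neg_mul, Finset.sum_neg_distrib] at h2
    have h3 := hj (by linarith)
    revert h3
    refine Fin.cases (fun h3 => Or.inl ?_) (fun j h3 => Or.inr ⟨j, ?_⟩) j
    · simpa using h3
    · rw [← h3]
      abel

lemma funext_fin_three {u v : Fin 3 → ℤ} (h0 : u 0 = v 0) (h1 : u 1 = v 1) (h2 : u 2 = v 2) :
    u = v := by
  funext i
  fin_cases i
  exacts [h0, h1, h2]

lemma LinearEquiv.exists_isUnit_det_symm (A : (Fin 3 → ℤ) ≃ₗ[ℤ] (Fin 3 → ℤ)) :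
    ∃ N : Matrix (Fin 3) (Fin 3) ℤ, IsUnit N.det ∧ ∀ x, A.symm x = N.mulVec x := by
  refine ⟨LinearMap.toMatrix' (A.symm : (Fin 3 → ℤ) →ₗ[ℤ] (Fin 3 → ℤ)), ?_, fun x => ?_⟩
  · rw [LinearMap.det_toMatrix']
    exact LinearEquiv.isUnit_det' A.symm
  · rw [LinearMap.toMatrix'_mulVec]
    rfl

lemma IsEmptySimplex.isCoprime {d : Fin 1 → Fin 3 → ℤ} (h : IsEmptySimplex d)
    (h0 : d 0 2 = 0) : IsCoprime (d 0 0) (d 0 1) := by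
  obtain ⟨A, hA⟩ := h.exists_one
  obtain ⟨N, hN, hx⟩ := A.exists_isUnit_det_symm
  have e : d 0 = N.mulVec ![1, 0, 0] := by rw [← hx, ← hA, LinearEquiv.symm_apply_apply]
  have e0 := congrFun e 0
  have e1 := congrFun e 1
  have e2 := congrFun e 2
  simp [Matrix.mulVec, dotProduct, Fin.sum_univ_succ] at e0 e1 e2
  rw [h0] at e2
  rw [Matrix.det_fin_three, ← e0, ← e1, ← e2] at hN
  obtain ⟨u, hu⟩ := hN.exists_left_inv
  exact ⟨u * (N 1 1 * N 2 2 - N 1 2 * N 2 1), u * (N 0 2 * N 2 1 - N 0 1 * N 2 2), by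
    linear_combination hu⟩

lemma IsEmptySimplex.isUnit_det {d : Fin 2 → Fin 3 → ℤ} (h : IsEmptySimplex d)
    (h0 : d 0 2 = 0) (h1 : d 1 2 = 0) : IsUnit (d 0 0 * d 1 1 - d 0 1 * d 1 0) := by
  obtain ⟨A, hA, hB⟩ := h.exists_two
  obtain ⟨N, hN, hx⟩ := A.exists_isUnit_det_symm
  have e : d 0 = N.mulVec ![1, 0, 0] := by rw [← hx, ← hA, LinearEquiv.symm_apply_apply]
  have f : d 1 = N.mulVec ![0, 1, 0] := by rw [← hx, ← hB, LinearEquiv.symm_apply_apply]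
  have e0 := congrFun e 0
  have e1 := congrFun e 1
  have e2 := congrFun e 2
  have f0 := congrFun f 0
  have f1 := congrFun f 1
  have f2 := congrFun f 2
  simp [Matrix.mulVec, dotProduct, Fin.sum_univ_succ] at e0 e1 e2 f0 f1 f2
  rw [h0] at e2
  rw [h1] at f2
  rw [Matrix.det_fin_three, ← e0, ← e1, ← e2, ← f0, ← f1, ← f2] at hN
  refine isUnit_of_mul_isUnit_left (y := N 2 2) ?_
  convert hN using 1
  ring

/-- The doubled points of `½ℤ³` in the part `z ≤ ½` of the tetrahedron with vertices
`emptyVertex p q` that are used to triangulate this part. -/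
def IsLow (p q : ℤ) (w : Fin 3 → ℤ) : Prop :=
  (w 2 = 0 ∧ w 1 = 0 ∧ 0 ≤ w 0 ∧ w 0 ≤ 2) ∨
    (w 2 = 1 ∧ 0 ≤ w 1 ∧ w 1 ≤ q ∧ 0 ≤ q * w 0 - p * w 1 ∧ q * w 0 - p * w 1 ≤ q)

/-- The secondary weight for the triangulation of the lower part. -/
def lowWeight (w : Fin 3 → ℤ) : ℤ :=
  if w 2 = 0 then if w 0 = 1 then 0 else 1 else -2 * w 0

/-- The cells of the triangulation of the lower part. -/
abbrev IsLowCell {p q : ℤ} (σ : Finset {w : Fin 3 → ℤ // IsLow p q w}) : Prop :=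
  IsCell Subtype.val (fun w => w.1 1 ^ 2) (fun w => lowWeight w.1) σ

section low

variable {p q : ℤ} {σ : Finset {w : Fin 3 → ℤ // IsLow p q w}}

lemma isLow_left (p q : ℤ) : IsLow p q ![0, 0, 0] := Or.inl (by simp)
lemma isLow_mid (p q : ℤ) : IsLow p q ![1, 0, 0] := Or.inl (by simp)
lemma isLow_right (p q : ℤ) : IsLow p q ![2, 0, 0] := Or.inl (by simp)

lemma low_ends (h : IsLowCell σ) (h0 : ⟨_, isLow_left p q⟩ ∈ σ) (h2 : ⟨_, isLow_right p q⟩ ∈ σ) :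
    False := by
  have := h.nonneg ![⟨_, isLow_mid p q⟩, ⟨_, isLow_left p q⟩, ⟨_, isLow_right p q⟩] ![2, -1, -1]
    (by simp [Fin.forall_fin_succ, h0, h2]) (by simp [Fin.sum_univ_succ])
    (by apply funext_fin_three <;> simp [Fin.sum_univ_succ])
  simp [Fin.sum_univ_succ, lowWeight] at this

lemma low_shift (h : IsLowCell σ) (hm : ⟨_, isLow_mid p q⟩ ∈ σ) {x y : ℤ}
    (hu : IsLow p q ![x, y, 1]) (huσ : ⟨_, hu⟩ ∈ σ) (hv : IsLow p q ![x + 1, y, 1]) : False := by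
  have := h.nonneg ![⟨_, isLow_left p q⟩, ⟨_, hv⟩, ⟨_, isLow_mid p q⟩, ⟨_, hu⟩] ![1, 1, -1, -1]
    (by simp [Fin.forall_fin_succ, hm, huσ]) (by simp [Fin.sum_univ_succ])
    (by simp [Fin.sum_univ_succ])
  simp [Fin.sum_univ_succ, lowWeight] at this
  omega

lemma low_injective (hq : 1 ≤ q) (h : IsLowCell σ) (hm : ⟨_, isLow_mid p q⟩ ∈ σ) {x x' y : ℤ}
    (hu : IsLow p q ![x, y, 1]) (huσ : ⟨_, hu⟩ ∈ σ) (hv : IsLow p q ![x', y, 1])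
    (hvσ : ⟨_, hv⟩ ∈ σ) : x = x' := by
  have a := hu
  have b := hv
  simp [IsLow] at a b
  have h1 : x ≤ x' + 1 := by nlinarith
  have h2 : x' ≤ x + 1 := by nlinarith
  rcases lt_trichotomy x x' with hx | hx | hx
  · obtain rfl : x' = x + 1 := by omega
    exact (low_shift h hm hu huσ hv).elim
  · exact hx
  · obtain rfl : x = x' + 1 := by omega
    exact (low_shift h hm hv hvσ hu).elim

lemma low_close (hq : 1 ≤ q) (h : IsLowCell σ) (hm : ⟨_, isLow_mid p q⟩ ∈ σ) {x x' y D : ℤ}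
    (hD : 2 ≤ D) (hu : IsLow p q ![x, y, 1]) (huσ : ⟨_, hu⟩ ∈ σ)
    (hv : IsLow p q ![x', y + D, 1]) (hvσ : ⟨_, hv⟩ ∈ σ) : False := by
  obtain ⟨X, hX0, hX1⟩ : ∃ X, 0 ≤ q * X - p * (y + 1) ∧ q * X - p * (y + 1) ≤ q := by
    refine ⟨-((-(p * (y + 1))) / q), ?_, ?_⟩
    · nlinarith [Int.mul_ediv_self_le (x := -(p * (y + 1))) (k := q) (by omega)]
    · nlinarith [Int.lt_mul_ediv_self_add (x := -(p * (y + 1))) (k := q) (by omega)]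
  have hn : IsLow p q ![X, y + 1, 1] := by
    simp [IsLow] at hu hv ⊢
    refine ⟨by omega, by omega, by linarith, by linarith⟩
  obtain ⟨s, hs⟩ : ∃ s, s = D * X - ((D - 1) * x + x') := ⟨_, rfl⟩
  rcases le_or_gt 0 s with h0 | h0
  · have := (h.nonneg ![⟨_, hn⟩, ⟨_, isLow_left p q⟩, ⟨_, hu⟩, ⟨_, hv⟩, ⟨_, isLow_mid p q⟩]
      ![D, s, -(D - 1), -1, -s]
      (by simp [Fin.forall_fin_succ, hm, huσ, hvσ]; omega)
      (by simp [Fin.sum_univ_succ]; ring)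
      (by apply funext_fin_three <;> simp [Fin.sum_univ_succ] <;> linarith)).1
    simp [Fin.sum_univ_succ] at this
    nlinarith
  · have := (h.nonneg ![⟨_, hn⟩, ⟨_, isLow_right p q⟩, ⟨_, hu⟩, ⟨_, hv⟩, ⟨_, isLow_mid p q⟩]
      ![D, -s, -(D - 1), -1, s]
      (by simp [Fin.forall_fin_succ, hm, huσ, hvσ]; omega)
      (by simp [Fin.sum_univ_succ]; ring)
      (by apply funext_fin_three <;> simp [Fin.sum_univ_succ] <;> linarith)).1
    simp [Fin.sum_univ_succ] at this
    nlinarith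

lemma low_isEmptySimplex (hq : 1 ≤ q) (h : IsLowCell σ) {k : ℕ}
    {a : Fin (k + 1) → {w : Fin 3 → ℤ // IsLow p q w}} (ha : Function.Injective a)
    (haσ : ∀ j, a j ∈ σ) (hz : ∀ j, (a j).1 2 = 1) :
    IsEmptySimplex fun i : Fin k => (a i.succ).1 - (a 0).1 := by
  refine h.isEmptySimplex ha haσ fun n t v hn ht hs hv => ?_
  have hlow : ∀ j, 0 ≤ (a j).1 1 ∧ (a j).1 1 ≤ q ∧ 0 ≤ q * (a j).1 0 - p * (a j).1 1 ∧
      q * (a j).1 0 - p * (a j).1 1 ≤ q := fun j => by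
    have := (a j).2
    simpa [IsLow, hz j] using this
  have e : ∀ r, ∑ j, t j * (a j).1 r = n * v r := fun r => by
    have := congrFun hv r
    simpa [Finset.sum_apply] using this
  have e' : ∑ j, t j * (q * (a j).1 0 - p * (a j).1 1) = n * (q * v 0 - p * v 1) := by
    simp only [mul_sub, Finset.sum_sub_distrib, mul_left_comm (t _), ← Finset.mul_sum, e]
    ring
  have hv2 : v 2 = 1 := by
    have := e 2
    simp only [hz, mul_one, hs] at this
    nlinarith
  have hl : IsLow p q v := by
    refine Or.inr ⟨hv2, ?_, ?_, ?_, ?_⟩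
    · obtain ⟨j, -, hj⟩ := exists_pos_le hn ht hs (e 1)
      exact (hlow j).1.trans hj
    · obtain ⟨j, -, hj⟩ := exists_pos_ge hn ht hs (e 1)
      exact hj.trans (hlow j).2.1
    · obtain ⟨j, -, hj⟩ := exists_pos_le hn ht hs e'
      exact (hlow j).2.2.1.trans hj
    · obtain ⟨j, -, hj⟩ := exists_pos_ge hn ht hs e'
      exact hj.trans (hlow j).2.2.2
  by_cases H : 0 ≤ n * (v 1) ^ 2 - ∑ j, t j * (a j).1 1 ^ 2
  · have hy : ∀ j, 0 < t j → (a j).1 1 = v 1 := fun j hj =>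
      eq_of_sum_mul_sq_le ht hs (e 1) (by linarith) hj
    obtain ⟨i, hi, hi'⟩ := exists_pos_le hn ht hs (e 0)
    obtain ⟨j, hj, hj'⟩ := exists_pos_ge hn ht hs (e 0)
    by_cases hx : v 0 = (a i).1 0
    · exact ⟨⟨v, hl⟩, i, rfl, fun _ => funext_fin_three hx (hy i hi).symm (by rw [hv2, hz])⟩
    · refine ⟨⟨v, hl⟩, j, rfl, fun _ => funext_fin_three ?_ (hy j hj).symm (by rw [hv2, hz])⟩
      have h1 := hlow i
      have h2 := hlow j
      rw [hy i hi] at h1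
      rw [hy j hj] at h2
      have : (a j).1 0 ≤ (a i).1 0 + 1 := by nlinarith
      omega
  · exact ⟨⟨v, hl⟩, 0, rfl, fun h => (H h).elim⟩

end low

lemma Finset.exists_enum {ι : Type*} (s : Finset ι) : ∃ (n : ℕ) (a : Fin n → ι),
    Function.Injective a ∧ (∀ j, a j ∈ s) ∧ ∀ i ∈ s, ∃ j, a j = i :=
  ⟨_, fun j => (s.equivFin.symm j).1, Subtype.val_injective.comp s.equivFin.symm.injective,
    fun j => (s.equivFin.symm j).2, fun i hi => ⟨s.equivFin ⟨i, hi⟩, by simp⟩⟩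

section low

variable {p q : ℤ} {σ : Finset {w : Fin 3 → ℤ // IsLow p q w}}

lemma low_eq {i : {w : Fin 3 → ℤ // IsLow p q w}} (hi : i.1 2 = 1) :
    ∃ h : IsLow p q ![i.1 0, i.1 1, 1], (⟨_, h⟩ : {w : Fin 3 → ℤ // IsLow p q w}) = i := by
  have e : ![i.1 0, i.1 1, 1] = i.1 := funext_fin_three rfl rfl hi.symm
  exact ⟨e ▸ i.2, Subtype.ext e⟩

lemma low_two_columns (hq : 1 ≤ q) (h : IsLowCell σ) (hm : ⟨_, isLow_mid p q⟩ ∈ σ) :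
    ∃ X X' Y : ℤ, ∀ i ∈ σ, i.1 2 = 1 → i.1 = ![X, Y, 1] ∨ i.1 = ![X', Y + 1, 1] := by
  classical
  rcases (σ.filter fun i => i.1 2 = 1).eq_empty_or_nonempty with h0 | h0
  · refine ⟨0, 0, 0, fun i hi hz => ?_⟩
    have : i ∈ σ.filter fun i => i.1 2 = 1 := Finset.mem_filter.2 ⟨hi, hz⟩
    simp [h0] at this
  obtain ⟨u, hu, hmin⟩ := Finset.exists_min_image _ (fun i => i.1 1) h0
  rw [Finset.mem_filter] at hu
  obtain ⟨hu1, hu2⟩ := low_eq hu.2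
  have key : ∀ i ∈ σ, i.1 2 = 1 → i.1 1 = u.1 1 ∨ i.1 1 = u.1 1 + 1 := by
    intro i hi hz
    have h1 := hmin i (Finset.mem_filter.2 ⟨hi, hz⟩)
    by_contra hne
    obtain ⟨D, hD⟩ : ∃ D, i.1 1 = u.1 1 + D := ⟨i.1 1 - u.1 1, by ring⟩
    obtain ⟨hi1, hi2⟩ := low_eq hz
    rw [← hi2] at hi
    have hu' := hu.1
    rw [← hu2] at hu'
    simp only [hD] at hi hi1
    exact low_close hq h hm (D := D) (by omega) hu1 hu' hi1 hi
  have uniq : ∀ i ∈ σ, i.1 2 = 1 → ∀ j ∈ σ, j.1 2 = 1 → i.1 1 = j.1 1 → i.1 0 = j.1 0 := by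
    intro i hi hiz j hj hjz hij
    obtain ⟨hi1, hi2⟩ := low_eq hiz
    obtain ⟨hj1, hj2⟩ := low_eq hjz
    rw [← hi2] at hi
    rw [← hj2] at hj
    simp only [hij] at hi hi1
    exact low_injective hq h hm hi1 hi hj1 hj
  by_cases hv : ∃ v ∈ σ, v.1 2 = 1 ∧ v.1 1 = u.1 1 + 1
  · obtain ⟨v, hv, hvz, hvy⟩ := hv
    refine ⟨u.1 0, v.1 0, u.1 1, fun i hi hz => ?_⟩
    rcases key i hi hz with h | h
    · exact Or.inl (funext_fin_three (uniq i hi hz u hu.1 hu.2 h) h hz)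
    · exact Or.inr (funext_fin_three (uniq i hi hz v hv hvz (h.trans hvy.symm)) h hz)
  · refine ⟨u.1 0, 0, u.1 1, fun i hi hz => ?_⟩
    rcases key i hi hz with h | h
    · exact Or.inl (funext_fin_three (uniq i hi hz u hu.1 hu.2 h) h hz)
    · exact (hv ⟨i, hi, hz, h⟩).elim

lemma low_base (h : IsLowCell σ) : ∃ b : ℤ, IsUnit (1 - 2 * b) ∧ ∀ i ∈ σ,
    i.1 = ![2 * b, 0, 0] ∨ i.1 = ![1, 0, 0] ∨ i.1 2 = 1 := by
  classical
  have key : ∀ i ∈ σ, i = ⟨_, isLow_left p q⟩ ∨ i = ⟨_, isLow_right p q⟩ ∨ i.1 = ![1, 0, 0] ∨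
      i.1 2 = 1 := by
    intro i _
    rcases i.2 with ⟨h2, h1, h0, h0'⟩ | h
    · obtain h | h | h : i.1 0 = 0 ∨ i.1 0 = 1 ∨ i.1 0 = 2 := by omega
      · exact Or.inl (Subtype.ext (funext_fin_three h h1 h2))
      · exact Or.inr (Or.inr (Or.inl (funext_fin_three h h1 h2)))
      · exact Or.inr (Or.inl (Subtype.ext (funext_fin_three h h1 h2)))
    · exact Or.inr (Or.inr (Or.inr h.1))
  by_cases h0 : ⟨_, isLow_left p q⟩ ∈ σ
  · refine ⟨0, by simp, fun i hi => ?_⟩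
    rcases key i hi with rfl | rfl | h'
    · simp
    · exact (low_ends h h0 hi).elim
    · exact Or.inr h'
  · refine ⟨1, by decide, fun i hi => ?_⟩
    rcases key i hi with rfl | rfl | h'
    · exact (h0 hi).elim
    · simp
    · exact Or.inr h'

lemma low_three_columns (hq : 1 ≤ q) (h : IsLowCell σ) : ∃ u u' u'' : Fin 3 → ℤ,
    u 2 = 1 ∧ u' 2 = 1 ∧ u'' 2 = 1 ∧
    IsUnit ((u' 0 - u 0) * (u'' 1 - u 1) - (u' 1 - u 1) * (u'' 0 - u 0)) ∧
    ∀ i ∈ σ, i.1 2 = 1 → i.1 = u ∨ i.1 = u' ∨ i.1 = u'' := by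
  classical
  obtain ⟨n, a, ha, haσ, hσ⟩ := (σ.filter fun i => i.1 2 = 1).exists_enum
  simp only [Finset.mem_filter] at haσ hσ
  have tri : ∀ b : Fin 3 → {w : Fin 3 → ℤ // IsLow p q w}, Function.Injective b →
      (∀ j, b j ∈ σ ∧ (b j).1 2 = 1) →
      IsUnit (((b 1).1 0 - (b 0).1 0) * ((b 2).1 1 - (b 0).1 1) -
        ((b 1).1 1 - (b 0).1 1) * ((b 2).1 0 - (b 0).1 0)) := by
    intro b hb hbσ
    exact (low_isEmptySimplex hq h hb (fun j => (hbσ j).1) fun j => (hbσ j).2).isUnit_det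
      (by simp [(hbσ _).2]) (by simp [(hbσ _).2])
  match n, a, ha, haσ, hσ with
  | 0, a, ha, haσ, hσ =>
    refine ⟨![0, 0, 1], ![1, 0, 1], ![0, 1, 1], rfl, rfl, rfl, by simp, fun i hi hz => ?_⟩
    obtain ⟨j, -⟩ := hσ i ⟨hi, hz⟩
    exact j.elim0
  | 1, a, ha, haσ, hσ =>
    refine ⟨(a 0).1, (a 0).1 + ![1, 0, 0], (a 0).1 + ![0, 1, 0], (haσ 0).2, by simp [haσ 0],
      by simp [haσ 0], by simp, fun i hi hz => ?_⟩
    obtain ⟨j, rfl⟩ := hσ i ⟨hi, hz⟩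
    exact Or.inl (by rw [Subsingleton.elim j 0])
  | 2, a, ha, haσ, hσ =>
    obtain ⟨s, t, hst⟩ := (low_isEmptySimplex hq h ha (fun j => (haσ j).1)
      fun j => (haσ j).2).isCoprime (by simp [(haσ _).2])
    refine ⟨(a 0).1, (a 1).1, (a 0).1 + ![-t, s, 0], (haσ 0).2, (haσ 1).2, by simp [haσ 0],
      ?_, fun i hi hz => ?_⟩
    · simp at hst ⊢
      rw [show ((a 1).1 0 - (a 0).1 0) * s + ((a 1).1 1 - (a 0).1 1) * t = 1 by linarith]
      exact isUnit_one
    obtain ⟨j, rfl⟩ := hσ i ⟨hi, hz⟩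
    fin_cases j <;> simp
  | 3, a, ha, haσ, hσ =>
    refine ⟨(a 0).1, (a 1).1, (a 2).1, (haσ 0).2, (haσ 1).2, (haσ 2).2, tri a ha haσ,
      fun i hi hz => ?_⟩
    obtain ⟨j, rfl⟩ := hσ i ⟨hi, hz⟩
    fin_cases j <;> simp
  | n + 4, a, ha, haσ, hσ =>
    exfalso
    have h3 : Function.Injective (![0, 1, 2, 3] : Fin 4 → Fin (n + 4)) := by
      intro i j hij
      fin_cases i <;> fin_cases j <;> simp [Fin.ext_iff, Nat.mod_eq_of_lt] at hij ⊢
    set b : Fin 4 → {w : Fin 3 → ℤ // IsLow p q w} := a ∘ ![0, 1, 2, 3] with hb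
    have hbi : Function.Injective b := ha.comp h3
    have hbσ : ∀ j, b j ∈ σ ∧ (b j).1 2 = 1 := fun j => haσ _
    have hu := tri (b ∘ Fin.castSucc) (hbi.comp (Fin.castSucc_injective _)) fun j => hbσ _
    have hi := low_isEmptySimplex hq h hbi (fun j => (hbσ j).1) fun j => (hbσ j).2
    obtain ⟨d, hd⟩ : ∃ d : Fin 3 → Fin 3 → ℤ, d = fun i => (b i.succ).1 - (b 0).1 := ⟨_, rfl⟩
    rw [← hd] at hi
    have hd2 : ∀ i, d i 2 = 0 := fun i => by simp [hd, hbσ]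
    have := congrFun (hi.indep ![d 1 0 * d 2 1 - d 1 1 * d 2 0, d 2 0 * d 0 1 - d 2 1 * d 0 0,
      d 0 0 * d 1 1 - d 0 1 * d 1 0] (by
        apply funext_fin_three <;> simp [Fin.sum_univ_succ, hd2] <;> ring)) 2
    refine hu.ne_zero ?_
    simpa [hd] using this

lemma low_frame (hq : 1 ≤ q) (h : IsLowCell σ) : ∃ (b : Fin 3 → ℤ) (M : Matrix (Fin 3) (Fin 3) ℤ),
    IsUnit M.det ∧ ∀ i ∈ σ, (∀ r, i.1 r = 2 * b r) ∨ ∃ k, ∀ r, i.1 r = 2 * b r + M r k := by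
  obtain ⟨b, hb, hσ⟩ := low_base h
  by_cases hm : ⟨_, isLow_mid p q⟩ ∈ σ
  · obtain ⟨X, X', Y, hc⟩ := low_two_columns hq h hm
    refine ⟨![b, 0, 0], !![1 - 2 * b, X - 2 * b, X' - 2 * b; 0, Y, Y + 1; 0, 1, 1], ?_,
      fun i hi => ?_⟩
    · rw [← IsUnit.neg_iff]
      convert hb using 1
      simp [Matrix.det_fin_three]
      ring
    · rcases hσ i hi with h | h | h
      · exact Or.inl (by simp [h, Fin.forall_fin_succ])
      · exact Or.inr ⟨0, by simp [h, Fin.forall_fin_succ]⟩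
      · rcases hc i hi h with h | h
        · exact Or.inr ⟨1, by simp [h, Fin.forall_fin_succ]⟩
        · exact Or.inr ⟨2, by simp [h, Fin.forall_fin_succ]⟩
  · obtain ⟨u, u', u'', hu, hu', hu'', hunit, hc⟩ := low_three_columns hq h
    refine ⟨![b, 0, 0], !![u 0 - 2 * b, u' 0 - 2 * b, u'' 0 - 2 * b; u 1, u' 1, u'' 1; 1, 1, 1], ?_,
      fun i hi => ?_⟩
    · convert hunit using 1
      simp [Matrix.det_fin_three]
      ring
    · rcases hσ i hi with h | h | h
      · exact Or.inl (by simp [h, Fin.forall_fin_succ])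
      · refine (hm ?_).elim
        convert hi
        exact h.symm
      · rcases hc i hi h with h | h | h
        · exact Or.inr ⟨0, by simp [h, Fin.forall_fin_succ, hu]⟩
        · exact Or.inr ⟨1, by simp [h, Fin.forall_fin_succ, hu']⟩
        · exact Or.inr ⟨2, by simp [h, Fin.forall_fin_succ, hu'']⟩

lemma low_isPiece (hq : 1 ≤ q) [Fintype {w : Fin 3 → ℤ // IsLow p q w}] (h : IsLowCell σ)
    (hne : σ.Nonempty) :
    IsPiece (openSimplex (fun i : {w : Fin 3 → ℤ // IsLow p q w} =>
      (2⁻¹ : ℝ) • fun k => (i.1 k : ℝ)) σ) := by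
  obtain ⟨b, M, hM, hσ⟩ := low_frame hq h
  obtain ⟨f, hf, hf0, hfk⟩ := exists_unimodular_halfBasis b M hM
  refine isPiece_openSimplex hne ?_ hf fun i hi => ?_
  · intro i _ j _ hij
    refine Subtype.ext (funext fun k => ?_)
    have := congrFun hij k
    simp at this
    exact this
  · rcases hσ i hi with h | ⟨k, h⟩
    · refine ⟨0, ?_⟩
      rw [hf0]
      funext r
      simp [h r]
    · refine ⟨k.succ, ?_⟩
      rw [hfk]
      funext r
      simp [h r]
      ring

end low

section region

variable {ι κ : Type*} [Fintype ι] {v : ι → Fin 3 → ℝ}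

lemma affine_apply_sum {c : ι → ℝ} (hc : ∑ i, c i = 1) (α : Fin 3 → ℝ) (β : ℝ) :
    ∑ r, α r * (∑ i, c i • v i) r + β = ∑ i, c i * (∑ r, α r * v i r + β) := by
  simp only [mul_add, Finset.sum_add_distrib, ← Finset.sum_mul, hc, one_mul, Finset.sum_apply,
    Pi.smul_apply, smul_eq_mul, Finset.mul_sum]
  rw [Finset.sum_comm]
  simp only [mul_left_comm]

lemma openSimplex.affine_pos {τ : Finset ι} {α : Fin 3 → ℝ} {β : ℝ}
    (h : ∀ i, 0 ≤ ∑ r, α r * v i r + β) {x y : Fin 3 → ℝ} (hx : x ∈ openSimplex v τ)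
    (hy : y ∈ openSimplex v τ) (hxp : 0 < ∑ r, α r * x r + β) : 0 < ∑ r, α r * y r + β := by
  obtain ⟨c, hc, hc0, hc1, rfl⟩ := hx
  obtain ⟨d, hd, hd0, hd1, rfl⟩ := hy
  rw [affine_apply_sum hc1] at hxp
  rw [affine_apply_sum hd1]
  obtain ⟨i, -, hi⟩ := Finset.exists_lt_of_sum_lt (f := fun _ => (0 : ℝ)) (by simpa using hxp)
  have hiτ : i ∈ τ := by
    by_contra hne
    simp [hc0 i hne] at hi
  refine Finset.sum_pos' (fun j _ => mul_nonneg ?_ (h j)) ⟨i, Finset.mem_univ _,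
    mul_pos (hd i hiτ) (pos_of_mul_pos_right hi (hc i hiτ).le)⟩
  by_cases hj : j ∈ τ
  · exact (hd j hj).le
  · rw [hd0 j hj]

lemma affine_nonneg_of_mem_convexHull {α : Fin 3 → ℝ} {β : ℝ}
    (h : ∀ i, 0 ≤ ∑ r, α r * v i r + β) {x : Fin 3 → ℝ} (hx : x ∈ convexHull ℝ (Set.range v)) :
    0 ≤ ∑ r, α r * x r + β := by
  obtain ⟨c, hc0, hc1, rfl⟩ := exists_coeff_of_mem_convexHull_range hx
  rw [affine_apply_sum hc1]
  exact Finset.sum_nonneg fun j _ => mul_nonneg (hc0 j) (h j)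

lemma isGood_region {C : Set (Finset ι)}
    (hcov : ∀ x ∈ convexHull ℝ (Set.range v), ∃ σ ∈ C, x ∈ openSimplex v σ)
    (hdisj : ∀ σ ∈ C, ∀ τ ∈ C, ∀ x, x ∈ openSimplex v σ → x ∈ openSimplex v τ → σ = τ)
    (hgood : ∀ σ ∈ C, IsGood (openSimplex v σ)) (α : κ → Fin 3 → ℝ) (β : κ → ℝ)
    (h : ∀ k i, 0 ≤ ∑ r, α k r * v i r + β k) (P : κ → Prop) :
    IsGood {x | x ∈ convexHull ℝ (Set.range v) ∧ ∀ k, (P k → 0 < ∑ r, α k r * x r + β k) ∧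
      (¬ P k → ∑ r, α k r * x r + β k = 0)} := by
  set R := {x | x ∈ convexHull ℝ (Set.range v) ∧ ∀ k, (P k → 0 < ∑ r, α k r * x r + β k) ∧
      (¬ P k → ∑ r, α k r * x r + β k = 0)} with hR
  have e : R = ⋃ σ ∈ {σ | σ ∈ C ∧ openSimplex v σ ⊆ R}, openSimplex v σ := by
    refine Set.Subset.antisymm (fun x hx => ?_) (Set.iUnion₂_subset fun σ hσ => hσ.2)
    obtain ⟨σ, hσ, hxσ⟩ := hcov x hx.1
    refine Set.mem_biUnion (x := σ) ⟨hσ, fun y hy => ?_⟩ hxσ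
    have hyc := openSimplex_subset_convexHull v σ hy
    refine ⟨hyc, fun k => ⟨fun hk => openSimplex.affine_pos (h k) hxσ hy ((hx.2 k).1 hk),
      fun hk => ?_⟩⟩
    by_contra hne
    have hpos := (affine_nonneg_of_mem_convexHull (h k) hyc).lt_of_ne' hne
    exact (openSimplex.affine_pos (h k) hy hxσ hpos).ne' ((hx.2 k).2 hk)
  rw [e]
  exact IsGood.biUnion (Set.toFinite _) (fun σ hσ τ hτ => hdisj σ hσ.1 τ hτ.1)
    fun σ hσ => hgood σ hσ.1

end region

/-- The vertices `emptyVertex p q` as points of `ℝ³`. -/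
def realVertex (p q : ℤ) : Fin 4 → Fin 3 → ℝ := fun i k => (emptyVertex p q i k : ℝ)

/-- The linear parts of the barycentric coordinates with respect to `realVertex p q`. -/
noncomputable def baryLinear (p q : ℤ) : Fin 4 → Fin 3 → ℝ :=
  ![![-1, p / q, -1], ![1, -p / q, 0], ![0, -1 / q, 1], ![0, 1 / q, 0]]

/-- The constant terms of the barycentric coordinates with respect to `realVertex p q`. -/
def baryConst : Fin 4 → ℝ := ![1, 0, 0, 0]

section low

variable {p q : ℤ}

lemma sum_smul_realVertex (c : Fin 4 → ℝ) :
    ∑ i, c i • realVertex p q i = ![c 1 + c 3 * p, c 3 * q, c 2 + c 3] := by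
  funext k
  fin_cases k <;> simp [Fin.sum_univ_succ, realVertex, emptyVertex]

lemma mem_openSimplex_realVertex (hq : 1 ≤ q) {s : Finset (Fin 4)} {x : Fin 3 → ℝ} :
    x ∈ openSimplex (realVertex p q) s ↔
      ∀ i, (i ∈ s → 0 < ∑ r, baryLinear p q i r * x r + baryConst i) ∧
        (i ∉ s → ∑ r, baryLinear p q i r * x r + baryConst i = 0) := by
  have hq0 : (q : ℝ) ≠ 0 := by
    have : q ≠ 0 := by omega
    exact_mod_cast this
  constructor
  · rintro ⟨c, hc, hc0, hc1, rfl⟩ i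
    have : ∑ r, baryLinear p q i r * (∑ j, c j • realVertex p q j) r + baryConst i = c i := by
      rw [sum_smul_realVertex]
      simp only [Fin.sum_univ_succ, Fin.sum_univ_zero] at hc1
      simp at hc1
      fin_cases i <;> simp [Fin.sum_univ_succ, baryLinear, baryConst] <;> field_simp <;>
        first | linear_combination (-1 : ℝ) * hc1 | ring
    rw [this]
    exact ⟨hc i, hc0 i⟩
  · intro h
    refine ⟨fun i => ∑ r, baryLinear p q i r * x r + baryConst i, fun i => (h i).1,
      fun i => (h i).2, ?_, ?_⟩
    · simp [Fin.sum_univ_succ, baryLinear, baryConst]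
      ring
    · rw [sum_smul_realVertex]
      funext k
      fin_cases k <;> simp [Fin.sum_univ_succ, baryLinear, baryConst] <;> field_simp <;> ring

lemma finite_isLow (hq : 1 ≤ q) : Finite {w : Fin 3 → ℤ // IsLow p q w} := by
  refine ((Set.finite_Icc ![-(|p| + 2), 0, 0] ![|p| + 2, q, 1]).subset fun w hw => ?_).to_subtype
  have h1 := le_abs_self p
  have h2 := neg_abs_le p
  simp only [Set.mem_Icc, Pi.le_def, Fin.forall_fin_succ]
  have h3 := abs_nonneg p
  rcases hw with ⟨a, b, c, d⟩ | ⟨a, b, c, d, e⟩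
  · simp [a, b]
    omega
  · have h4 : p * w 1 ≤ |p| * q := by nlinarith
    have h5 : -(|p| * q) ≤ p * w 1 := by nlinarith
    have h6 : w 0 ≤ |p| + 2 := by nlinarith
    have h7 : -(|p| + 2) ≤ w 0 := by nlinarith
    simp [a, b, c, h6]
    linarith

lemma mem_convexHull_low (hq : 1 ≤ q) {s : Finset (Fin 4)} {x : Fin 3 → ℝ}
    (hx : x ∈ openSimplex (realVertex p q) s) (hz : x 2 ≤ 2⁻¹) :
    x ∈ convexHull ℝ (Set.range fun i : {w : Fin 3 → ℤ // IsLow p q w} =>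
      (2⁻¹ : ℝ) • fun k => (i.1 k : ℝ)) := by
  obtain ⟨c, hc, hc0, hc1, rfl⟩ := hx
  have hnn : ∀ i, 0 ≤ c i := fun i => by
    by_cases hi : i ∈ s
    · exact (hc i hi).le
    · rw [hc0 i hi]
  rw [sum_smul_realVertex] at hz ⊢
  simp only [Fin.sum_univ_succ, Fin.sum_univ_zero] at hc1
  simp at hc1 hz
  have h0 := hnn 0
  have h1 := hnn 1
  have h2 := hnn 2
  have h3 := hnn 3
  obtain ⟨S, hS⟩ : ∃ S, S = c 0 + c 1 := ⟨_, rfl⟩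
  have hSp : 0 < S := by linarith
  have hle : 0 ≤ 1 - (c 2 + c 3) / S := by
    rw [sub_nonneg, div_le_one hSp]
    linarith
  have hl : ∀ j : Fin 6, IsLow p q (![![0, 0, 0], ![2, 0, 0], ![0, 0, 1], ![1, 0, 1], ![p, q, 1],
      ![p + 1, q, 1]] j) := by
    intro j
    have h1 : 0 ≤ q := by omega
    have h2 : q * p - p * q = 0 := by ring
    have h3 : q * (p + 1) - p * q = q := by ring
    fin_cases j <;> simp [IsLow, h1, h2, h3]
  have := (convex_convexHull ℝ (Set.range fun i : {w : Fin 3 → ℤ // IsLow p q w} =>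
      (2⁻¹ : ℝ) • fun k => (i.1 k : ℝ))).sum_mem (t := Finset.univ)
      (w := ![c 0 * (1 - (c 2 + c 3) / S), c 1 * (1 - (c 2 + c 3) / S), 2 * c 0 * c 2 / S,
        2 * c 1 * c 2 / S, 2 * c 0 * c 3 / S, 2 * c 1 * c 3 / S])
      (z := fun j => (2⁻¹ : ℝ) • fun k => ((![![0, 0, 0], ![2, 0, 0], ![0, 0, 1], ![1, 0, 1],
        ![p, q, 1], ![p + 1, q, 1]] : Fin 6 → Fin 3 → ℤ) j k : ℝ)) ?_ ?_ ?_
  · convert this using 1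
    funext k
    fin_cases k <;> simp [Fin.sum_univ_succ] <;> field_simp <;> rw [hS] <;> ring
  · intro j _
    fin_cases j <;> simp <;> positivity
  · simp [Fin.sum_univ_succ]
    field_simp
    rw [hS]
    linear_combination (c 0 + c 1) * hc1
  · intro j _
    exact subset_convexHull _ _ ⟨⟨_, hl j⟩, rfl⟩

lemma isGood_low (hq : 1 ≤ q) (s : Finset (Fin 4)) (Q : Prop) :
    IsGood {x | x ∈ openSimplex (realVertex p q) s ∧ (Q → x 2 < 2⁻¹) ∧ (¬ Q → x 2 = 2⁻¹)} := by
  have := finite_isLow (p := p) hq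
  have := Fintype.ofFinite {w : Fin 3 → ℤ // IsLow p q w}
  have hq0 : (0 : ℝ) < q := by
    have : 0 < q := by omega
    exact_mod_cast this
  obtain ⟨C, hcov, hdisj, hC⟩ := exists_lattice_triangulation
    (Subtype.val : {w : Fin 3 → ℤ // IsLow p q w} → Fin 3 → ℤ) (fun w => w.1 1 ^ 2)
    (fun w => lowWeight w.1) 2⁻¹ _ fun _ => rfl
  have key := isGood_region (κ := Option (Fin 4)) hcov hdisj (fun σ hσ => ?_)
    (fun k => k.elim ![0, 0, -1] (baryLinear p q)) (fun k => k.elim 2⁻¹ baryConst) ?_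
    (fun k => k.elim Q (· ∈ s))
  · convert key using 1
    ext x
    simp only [Option.forall, Set.mem_ofPred_eq, Option.elim_none, Option.elim_some,
      ← mem_openSimplex_realVertex hq]
    have e : ∑ r, (![0, 0, -1] : Fin 3 → ℝ) r * x r + 2⁻¹ = 2⁻¹ - x 2 := by
      simp [Fin.sum_univ_succ]
      ring
    rw [e, sub_pos, sub_eq_zero]
    constructor
    · rintro ⟨h1, h2, h3⟩
      refine ⟨mem_convexHull_low hq h1 ?_, ⟨h2, fun h => (h3 h).symm⟩, h1⟩
      by_cases h : Q
      · exact (h2 h).le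
      · exact (h3 h).le
    · rintro ⟨-, ⟨h2, h3⟩, h1⟩
      exact ⟨h1, h2, fun h => (h3 h).symm⟩
  · rcases σ.eq_empty_or_nonempty with rfl | hne
    · convert isGood_empty
      refine Set.eq_empty_of_forall_notMem fun x hx => ?_
      rw [mem_openSimplex_iff] at hx
      simp at hx
    · exact (low_isPiece hq (hC σ hσ) hne).isGood
  · rintro k ⟨w, hw⟩
    have hw' : (w 2 = 0 ∧ w 1 = 0 ∧ (0 : ℝ) ≤ w 0 ∧ (w 0 : ℝ) ≤ 2) ∨
        (w 2 = 1 ∧ (0 : ℝ) ≤ w 1 ∧ (w 1 : ℝ) ≤ q ∧ (0 : ℝ) ≤ q * w 0 - p * w 1 ∧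
          (q * w 0 - p * w 1 : ℝ) ≤ q) := by exact_mod_cast hw
    rcases k with _ | k
    · rcases hw' with ⟨a, b, c, d⟩ | ⟨a, b, c, d, e⟩ <;> simp [Fin.sum_univ_succ, a]
    · rcases hw' with ⟨a, b, c, d⟩ | ⟨a, b, c, d, e⟩
      · fin_cases k <;> simp [Fin.sum_univ_succ, a, b, baryLinear, baryConst] <;>
          first | linarith | exact_mod_cast c
      · fin_cases k <;> simp [Fin.sum_univ_succ, a, baryLinear, baryConst] <;> field_simp <;>
          nlinarith

end low

lemma isGood_openSimplex_realVertex {p q : ℤ} (hq : 1 ≤ q) (hpq : IsCoprime p q)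
    (s : Finset (Fin 4)) : IsGood (openSimplex (realVertex p q) s) := by
  obtain ⟨u, w, huw⟩ := hpq
  have hmid := isGood_low (p := p) hq s False
  have hlow := isGood_low (p := p) hq s True
  have hhigh : IsGood {x | x ∈ openSimplex (realVertex p q) s ∧ 2⁻¹ < x 2} := by
    obtain ⟨g, hg, hgx⟩ : ∃ g : (Fin 3 → ℝ) → Fin 3 → ℝ, IsUnimodular g ∧
        ∀ x, g x = ![u * x 0 + w * x 1, q * x 0 - p * x 1, 1 - x 2] := by
      refine ⟨_, ⟨!![u, w, 0; q, -p, 0; 0, 0, -1], ?_, ![0, 0, 1], fun x => rfl⟩, fun x => ?_⟩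
      · rw [Matrix.det_fin_three]
        simp
        rw [huw]
        exact isUnit_one
      · funext k
        fin_cases k <;> simp [Matrix.mulVec, dotProduct, Fin.sum_univ_succ] <;> ring
    obtain ⟨f, hf, hfg, hgf⟩ := hg.exists_inverse
    obtain ⟨φ, rfl⟩ := hg.exists_affineEquiv
    have himg : φ '' openSimplex (realVertex p q) s =
        openSimplex (realVertex u q) (s.image ![2, 3, 0, 1]) := by
      rw [← AffineEquiv.coe_toAffineMap, ← openSimplex_image]
      refine openSimplex_reindex ?_ fun i _ => ?_
      · intro i _ j _ hij
        fin_cases i <;> fin_cases j <;> simp at hij ⊢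
      · have huw' : (u * p + w * q : ℝ) = 1 := by exact_mod_cast huw
        simp only [Function.comp, AffineEquiv.coe_toAffineMap, hgx]
        funext k
        fin_cases i <;> fin_cases k <;> simp [realVertex, emptyVertex, huw']; ring
    convert hf.isGood_image (isGood_low (p := u) hq (s.image ![2, 3, 0, 1]) True) using 1
    rw [← himg]
    have h2 : ∀ x, φ x 2 = 1 - x 2 := fun x => by rw [hgx]; rfl
    ext x
    constructor
    · rintro ⟨hx, hz⟩
      refine ⟨φ x, ⟨⟨x, hx, rfl⟩, fun _ => ?_, fun h => (h trivial).elim⟩, hfg x⟩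
      rw [h2]
      norm_num at hz ⊢
      linarith
    · rintro ⟨_, ⟨⟨y, hy, rfl⟩, hz, -⟩, rfl⟩
      rw [hfg]
      refine ⟨hy, ?_⟩
      have := hz trivial
      rw [h2] at this
      norm_num at this ⊢
      linarith
  convert (hlow.union hmid ?_).union hhigh ?_ using 1
  · ext x
    simp only [Set.mem_union, Set.mem_ofPred_eq]
    have := lt_trichotomy (x 2) 2⁻¹
    tauto
  · rintro x ⟨-, h1, -⟩ ⟨-, -, h2⟩
    exact (h1 trivial).ne (h2 not_false)
  · rintro x (⟨-, h1, -⟩ | ⟨-, -, h1⟩) ⟨-, h2⟩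
    · exact (h1 trivial).not_gt h2
    · exact h2.ne' (h1 not_false)

lemma exists_isUnimodular_symm (A : (Fin 3 → ℤ) ≃ₗ[ℤ] (Fin 3 → ℤ)) (w b : Fin 3 → ℤ) :
    ∃ f : (Fin 3 → ℝ) → Fin 3 → ℝ, IsUnimodular f ∧ ∀ d : Fin 3 → ℤ,
      f (fun i => ((A d + w) i : ℝ)) = fun i => ((d + b) i : ℝ) := by
  obtain ⟨N, hN, hA⟩ := A.exists_isUnit_det_symm
  refine ⟨_, ⟨N, hN, b - A.symm w, fun x => rfl⟩, fun d => ?_⟩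
  have e : ∀ y : Fin 3 → ℤ, (N.map (Int.cast : ℤ → ℝ)).mulVec (fun i => (y i : ℝ)) =
      fun i => ((A.symm y) i : ℝ) := fun y => by
    funext i
    rw [hA]
    simp [Matrix.mulVec, dotProduct]
  rw [e]
  funext i
  simp

lemma IsCell.isGood {ι : Type*} [Fintype ι] {w : ι → Fin 3 → ℤ} {w₂ : ι → ℤ} {σ : Finset ι}
    (h : IsCell w (fun i => ∑ r, w i r ^ 2) w₂ σ) (hw : ∀ (k : ℕ) (a : Fin (k + 1) → ι) (n : ℤ)
      (t : Fin (k + 1) → ℤ) (z : Fin 3 → ℤ), 0 < n → (∀ j, 0 ≤ t j) → ∑ j, t j = n →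
      ∑ j, t j • w (a j) = n • z → ∃ i, w i = z) :
    IsGood (openSimplex (fun i k => (w i k : ℝ)) σ) := by
  classical
  obtain ⟨m, a, ha, haσ, hσ⟩ := σ.exists_enum
  obtain rfl | ⟨k, rfl⟩ : m = 0 ∨ ∃ k, m = k + 1 := by
    cases m
    exacts [Or.inl rfl, Or.inr ⟨_, rfl⟩]
  · convert isGood_empty
    obtain rfl : σ = ∅ := Finset.eq_empty_of_forall_notMem fun i hi => (hσ i hi).choose.elim0
    refine Set.eq_empty_of_forall_notMem fun x hx => ?_
    rw [mem_openSimplex_iff] at hx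
    simp at hx
  have hE := h.isEmptySimplex ha haσ fun n t z hn ht hs hz => by
    obtain ⟨i, hi⟩ := hw k a n t z hn ht hs hz
    obtain ⟨j, -, hj⟩ := Finset.exists_lt_of_sum_lt (s := Finset.univ) (f := fun _ => (0 : ℤ))
      (g := t) (by simpa [hs] using hn)
    refine ⟨i, j, hi, fun H => ?_⟩
    have ez : ∀ r, ∑ j, t j * w (a j) r = n * z r := fun r => by
      have := congrFun hz r
      simpa [Finset.sum_apply] using this
    have e0 := ez 0
    have e1 := ez 1
    have e2 := ez 2
    have key : ∑ j, t j * ((w (a j) 0 - z 0) ^ 2 + (w (a j) 1 - z 1) ^ 2 + (w (a j) 2 - z 2) ^ 2)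
        = ∑ j, t j * ∑ r, w (a j) r ^ 2 - n * ∑ r, z r ^ 2 := by
      have : ∀ j, t j * ((w (a j) 0 - z 0) ^ 2 + (w (a j) 1 - z 1) ^ 2 + (w (a j) 2 - z 2) ^ 2) =
          t j * ∑ r, w (a j) r ^ 2 - 2 * z 0 * (t j * w (a j) 0) - 2 * z 1 * (t j * w (a j) 1) -
            2 * z 2 * (t j * w (a j) 2) + (∑ r, z r ^ 2) * t j := fun j => by
        simp only [Fin.sum_univ_three]
        ring
      simp only [this, Finset.sum_add_distrib, Finset.sum_sub_distrib, ← Finset.mul_sum, e0, e1, e2,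
        hs]
      simp only [Fin.sum_univ_three]
      ring
    have hle := Finset.single_le_sum (f := fun j => t j * ((w (a j) 0 - z 0) ^ 2 +
      (w (a j) 1 - z 1) ^ 2 + (w (a j) 2 - z 2) ^ 2)) (fun j _ => mul_nonneg (ht j) (by positivity))
      (Finset.mem_univ j)
    rw [key] at hle
    rw [hi] at H
    have h0 : (w (a j) 0 - z 0) ^ 2 + (w (a j) 1 - z 1) ^ 2 + (w (a j) 2 - z 2) ^ 2 ≤ 0 := by
      nlinarith
    refine (funext_fin_three ?_ ?_ ?_).symm <;> nlinarith
  obtain ⟨A, c, p, q, e, hq, hpq, he, h0, hs⟩ := hE.exists_emptyVertex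
  obtain ⟨f, hf, hfA⟩ := exists_isUnimodular_symm A c (w (a 0))
  have hv : ∀ j, f (realVertex p q (e j)) = fun k => (w (a j) k : ℝ) := by
    intro j
    refine Fin.cases ?_ (fun j => ?_) j
    · have := hfA 0
      rw [map_zero, zero_add, zero_add, h0] at this
      exact this
    · have := hfA (w (a j.succ) - w (a 0))
      rw [hs, sub_add_cancel] at this
      exact this
  obtain ⟨φ, rfl⟩ := hf.exists_affineEquiv
  have : openSimplex (fun i k => (w i k : ℝ)) σ =
      φ '' openSimplex (realVertex p q) (Finset.univ.image e) := by
    rw [← AffineEquiv.coe_toAffineMap, ← openSimplex_image]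
    have h1 := openSimplex_reindex (e := a) (σ := Finset.univ)
      (v := fun j : Fin (k + 1) => φ (realVertex p q (e j))) (u := fun i k => (w i k : ℝ))
      ha.injOn fun j _ => hv j
    have h2 := openSimplex_reindex (e := e) (σ := Finset.univ)
      (v := fun j : Fin (k + 1) => φ (realVertex p q (e j))) (u := φ ∘ realVertex p q)
      he.injOn fun j _ => rfl
    have h3 : Finset.univ.image a = σ := by
      ext i
      simp only [Finset.mem_image, Finset.mem_univ, true_and]
      exact ⟨fun ⟨j, hj⟩ => hj ▸ haσ j, hσ i⟩
    rw [← h3, ← h1, h2]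
    rfl
  rw [this]
  exact hf.isGood_image (isGood_openSimplex_realVertex hq hpq _)

lemma finite_intPoints {P : Set (Fin 3 → ℝ)} (hP : Bornology.IsBounded P) :
    Finite {z : Fin 3 → ℤ // (fun i => (z i : ℝ)) ∈ P} := by
  obtain ⟨R, hR⟩ := hP.exists_norm_le
  refine ((Set.finite_Icc (fun _ : Fin 3 => -⌈R⌉) fun _ => ⌈R⌉).subset fun z hz => ?_).to_subtype
  have h : ∀ i, |(z i : ℝ)| ≤ R := fun i => (norm_le_pi_norm _ i).trans (hR _ hz)
  refine ⟨fun i => ?_, fun i => ?_⟩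
  · have := (abs_le.1 ((h i).trans (Int.le_ceil R))).1
    exact_mod_cast this
  · have := (abs_le.1 ((h i).trans (Int.le_ceil R))).2
    exact_mod_cast this

/-- Every lattice polytope in `ℝ³` can be partitioned into finitely many pairwise disjoint
relatively open simplices, each the relative interior of a unimodular image of one of the
seven simplices. -/
theorem lattice_polytope_decomposition (P : Set (Fin 3 → ℝ)) (hP : IsLatticePolytope3 P) :
    ∃ (r : ℕ) (T : Fin r → Set (Fin 3 → ℝ)),
      Pairwise (Function.onFun Disjoint T) ∧
      P = (⋃ t, T t) ∧
      ∀ t, ∃ j : Fin 7, ∃ f, IsUnimodular f ∧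
        T t = intrinsicInterior ℝ (f '' sevenSimplices j) := by
  obtain ⟨V, hV⟩ := hP
  have hconv : Convex ℝ P := hV ▸ convex_convexHull ℝ _
  have hfin : Finite {z : Fin 3 → ℤ // (fun i => (z i : ℝ)) ∈ P} := by
    refine finite_intPoints ?_
    rw [hV]
    exact ((V.finite_toSet.image _).isCompact_convexHull ℝ).isBounded
  have := Fintype.ofFinite {z : Fin 3 → ℤ // (fun i => (z i : ℝ)) ∈ P}
  set v : {z : Fin 3 → ℤ // (fun i => (z i : ℝ)) ∈ P} → Fin 3 → ℝ := fun i k => (i.1 k : ℝ)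
  have hPv : convexHull ℝ (Set.range v) = P := by
    refine (convexHull_min (Set.range_subset_iff.2 fun i => i.2) hconv).antisymm ?_
    refine hV.subset.trans (convexHull_mono ?_)
    rintro _ ⟨z, hz, rfl⟩
    exact ⟨⟨z, hV ▸ subset_convexHull ℝ _ ⟨z, hz, rfl⟩⟩, rfl⟩
  obtain ⟨C, hcov, hdisj, hC⟩ := exists_lattice_triangulation
    (Subtype.val : {z : Fin 3 → ℤ // (fun i => (z i : ℝ)) ∈ P} → Fin 3 → ℤ)
    (fun i => ∑ r, i.1 r ^ 2) 0 1 v fun i => by simp [v]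
  refine IsGood.exists_family ?_
  have e : P = ⋃ σ ∈ C, openSimplex v σ := by
    refine Set.Subset.antisymm (fun x hx => ?_) (Set.iUnion₂_subset fun σ _ => ?_)
    · rw [← hPv] at hx
      obtain ⟨σ, hσ, h⟩ := hcov x hx
      exact Set.mem_biUnion hσ h
    · exact (openSimplex_subset_convexHull v σ).trans hPv.subset
  refine e ▸ IsGood.biUnion (Set.toFinite C) hdisj fun σ hσ => ?_
  refine (hC σ hσ).isGood fun k a n t z hn ht hs hz => ⟨⟨z, ?_⟩, rfl⟩
  have hn' : (0 : ℝ) < n := by exact_mod_cast hn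
  have hs' : ∑ j, (t j : ℝ) = n := by exact_mod_cast hs
  have := hconv.sum_mem (t := Finset.univ) (w := fun j => (t j : ℝ) / n)
    (z := fun j k => ((a j).1 k : ℝ)) (fun j _ => div_nonneg (by exact_mod_cast ht j) hn'.le)
    (by rw [← Finset.sum_div, hs', div_self hn'.ne']) fun j _ => (a j).2
  convert this using 1
  funext k
  have hk := congrFun hz k
  simp only [Finset.sum_apply, Pi.smul_apply, smul_eq_mul] at hk ⊢
  have hk' : ∑ j, (t j : ℝ) * ((a j).1 k : ℝ) = n * z k := by exact_mod_cast hk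
  simp only [div_mul_eq_mul_div]
  rw [← Finset.sum_div, hk']
  field_simp
end

section
/- Fix n ≥ 1. For every polytope P ⊂ ℝ^n all of whose vertices lie in ½ℤ^n, there exist rational numbers c_0^1, …, c_n^1 and c_0^0, …, c_{n−1}^0 such that for every integer k ≥ 1, |kP ∩ ℤ^n| = Σ_{i=0}^{n} c_i^1·E_i^1(k) + Σ_{i=0}^{n−1} c_i^0·E_i^0(k). -/
open Pointwise

/-- The number of lattice points in a subset of `ℝ^n`. -/
noncomputable def latticeCount {n : ℕ} (S : Set (Fin n → ℝ)) : ℕ :=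
  Set.ncard {x : Fin n → ℤ | (fun i => (x i : ℝ)) ∈ S}

/-- `E_i^1(k)`: the number of lattice points in the relative interior of `k·Δ_i^1`. -/
noncomputable def Eone (n i k : ℕ) : ℕ :=
  latticeCount (intrinsicInterior ℝ ((k : ℝ) • Δone n i))

/-- `E_i^0(k)`: the number of lattice points in the relative interior of `k·Δ_i^0`. -/
noncomputable def Ezero (n i k : ℕ) : ℕ :=
  latticeCount (intrinsicInterior ℝ ((k : ℝ) • Δzero n i))

open Filter Topology MeasureTheory

theorem Polynomial.natDegree_le_and_coeff_eq_of_tendsto (p : Polynomial ℚ) (n : ℕ) (c : ℝ)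
    (h : Tendsto (fun j : ℕ => ((p.eval (j : ℚ) : ℚ) : ℝ) / (j : ℝ) ^ n) atTop (𝓝 c)) :
    p.natDegree ≤ n ∧ (p.coeff n : ℝ) = c := by
  set P : Polynomial ℝ := p.map (algebraMap ℚ ℝ) with hP
  have hdeg : P.degree = p.degree := Polynomial.degree_map _ _
  have hX : (Polynomial.X ^ n : Polynomial ℝ).degree = n := Polynomial.degree_X_pow n
  have heval : ∀ j : ℕ, P.eval (j : ℝ) = ((p.eval (j : ℚ) : ℚ) : ℝ) := fun j => by
    rw [hP, ← Rat.cast_natCast (α := ℝ) j]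
    exact Polynomial.eval_map_apply (algebraMap ℚ ℝ) (j : ℚ)
  have key : ∀ l : Filter ℝ, Tendsto (fun x => P.eval x / (Polynomial.X ^ n : Polynomial ℝ).eval x)
      atTop l → Tendsto (fun j : ℕ => ((p.eval (j : ℚ) : ℚ) : ℝ) / (j : ℝ) ^ n) atTop l := by
    intro l hl
    refine (hl.comp tendsto_natCast_atTop_atTop).congr fun j => ?_
    simp [heval]
  rcases lt_trichotomy P.degree (n : WithBot ℕ) with hlt | heq | hgt
  · have h0 := key _ (Polynomial.div_tendsto_atTop_zero_of_degree_lt P (Polynomial.X ^ n)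
      (by rwa [hX]))
    rw [hdeg] at hlt
    refine ⟨Polynomial.natDegree_le_of_degree_le hlt.le, ?_⟩
    rw [Polynomial.coeff_eq_zero_of_degree_lt hlt, tendsto_nhds_unique h h0]
    simp
  · have h0 := key _ (Polynomial.div_tendsto_atTop_leadingCoeff_div_of_degree_eq P
      (Polynomial.X ^ n) (by rwa [hX]))
    have hn : P.natDegree = n := Polynomial.natDegree_eq_of_degree_eq_some heq
    rw [hdeg] at heq
    refine ⟨Polynomial.natDegree_le_of_degree_le heq.le, ?_⟩
    rw [tendsto_nhds_unique h h0, Polynomial.leadingCoeff, hn]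
    simp [hP]
  · have h0 := Polynomial.abs_div_tendsto_atTop_atTop_of_degree_gt P (Polynomial.X ^ n)
      (by rwa [hX]) (by simp)
    have h1 := (h0.comp tendsto_natCast_atTop_atTop)
    have h2 := h.abs
    have h3 : Tendsto (fun j : ℕ => |((p.eval (j : ℚ) : ℚ) : ℝ) / (j : ℝ) ^ n|) atTop atTop := by
      refine h1.congr fun j => ?_
      simp [heval]
    exact absurd h2 (not_tendsto_nhds_of_tendsto_atTop h3 _)

theorem Polynomial.exists_eval_natCast_eq_choose (b : ℕ) :
    ∃ q : Polynomial ℚ, q.natDegree ≤ b ∧ q.coeff b * b.factorial = 1 ∧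
      ∀ j : ℕ, q.eval (j : ℚ) = (j.choose b : ℚ) := by
  refine ⟨Polynomial.C ((b.factorial : ℚ)⁻¹) * descPochhammer ℚ b, ?_, ?_, fun j => ?_⟩
  · exact (Polynomial.natDegree_C_mul_le _ _).trans (descPochhammer_natDegree ℚ b).le
  · have := (monic_descPochhammer ℚ b).coeff_natDegree
    rw [descPochhammer_natDegree] at this
    rw [Polynomial.coeff_C_mul, this]
    field_simp
  · rw [Nat.cast_choose_eq_descPochhammer_div]
    simp [div_eq_inv_mul]

theorem Polynomial.exists_eval_natCast_eq_sum_choose (n : ℕ) :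
    ∀ p : Polynomial ℚ, p.natDegree ≤ n → ∃ a : ℕ → ℚ,
      (∀ j : ℕ, p.eval (j : ℚ) = ∑ i ∈ Finset.range (n + 1), a i * (j.choose i : ℚ)) ∧
        a n = n.factorial * p.coeff n := by
  induction n with
  | zero =>
    intro p hp
    rw [Polynomial.eq_C_of_natDegree_le_zero hp]
    exact ⟨fun _ => p.coeff 0, by simp, by simp⟩
  | succ n ih =>
    intro p hp
    obtain ⟨q, hq, hc, he⟩ := Polynomial.exists_eval_natCast_eq_choose (n + 1)
    have hdeg : (p - Polynomial.C (((n + 1).factorial : ℚ) * p.coeff (n + 1)) * q).natDegree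
        ≤ n := by
      rw [Polynomial.natDegree_le_iff_coeff_eq_zero]
      intro N hN
      rw [Polynomial.coeff_sub, Polynomial.coeff_C_mul]
      rcases (Nat.succ_le_of_lt hN).eq_or_lt with rfl | h
      · linear_combination (-p.coeff (n + 1)) * hc
      · rw [Polynomial.coeff_eq_zero_of_natDegree_lt (hp.trans_lt h),
          Polynomial.coeff_eq_zero_of_natDegree_lt (hq.trans_lt h)]
        simp
    obtain ⟨a, ha, -⟩ := ih _ hdeg
    refine ⟨Function.update a (n + 1) (((n + 1).factorial : ℚ) * p.coeff (n + 1)), fun j => ?_,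
      by simp⟩
    rw [Finset.sum_range_succ, Function.update_self, ← he]
    have := ha j
    rw [Polynomial.eval_sub, Polynomial.eval_mul, Polynomial.eval_C, sub_eq_iff_eq_add] at this
    rw [this]
    congr 1
    refine Finset.sum_congr rfl fun i hi => ?_
    rw [Function.update_of_ne (Finset.mem_range.1 hi).ne]

theorem latticeCount_smul_eq_card {n : ℕ} (P : Set (Fin n → ℝ)) (k : ℕ) (hk : 1 ≤ k) :
    latticeCount ((k : ℝ) • P) = Nat.card
      (P ∩ (k : ℝ)⁻¹ • (Submodule.span ℤ (Set.range (Pi.basisFun ℝ (Fin n))) :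
        Set (Fin n → ℝ)) : Set (Fin n → ℝ)) := by
  have hk0 : (k : ℝ) ≠ 0 := by positivity
  rw [latticeCount, Nat.card_coe_set_eq]
  refine Set.ncard_congr (fun x _ => (k : ℝ)⁻¹ • (fun i => (x i : ℝ))) ?_ ?_ ?_
  · intro x hx
    refine ⟨(Set.mem_smul_set_iff_inv_smul_mem₀ hk0 _ _).1 hx, Set.smul_mem_smul_set ?_⟩
    rw [SetLike.mem_coe, Module.Basis.mem_span_iff_repr_mem]
    intro i
    exact ⟨x i, by simp⟩
  · intro x y _ _ h
    have := smul_right_injective _ (inv_ne_zero hk0) h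
    funext i
    exact_mod_cast congrFun this i
  · rintro y ⟨hy, z, hz, rfl⟩
    rw [SetLike.mem_coe, Module.Basis.mem_span_iff_repr_mem] at hz
    choose x hx using hz
    have hxz : (fun i => (x i : ℝ)) = z := by
      funext i
      simpa using hx i
    refine ⟨x, ?_, by simp [hxz]⟩
    rw [Set.mem_ofPred_eq, hxz]
    exact (Set.mem_smul_set_iff_inv_smul_mem₀ hk0 _ _).2 hy

theorem tendsto_latticeCount_div_pow {n : ℕ} {P : Set (Fin n → ℝ)} (hP : IsCompact P)
    (hc : Convex ℝ P) :
    Tendsto (fun k : ℕ => (latticeCount ((k : ℝ) • P) : ℝ) / (k : ℝ) ^ n) atTop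
      (𝓝 (volume.real P)) := by
  have := tendsto_card_div_pow_atTop_volume P hP.isBounded hP.measurableSet
    (hc.addHaar_frontier volume)
  rw [Fintype.card_fin] at this
  refine this.congr' ?_
  filter_upwards [eventually_ge_atTop 1] with k hk
  rw [latticeCount_smul_eq_card P k hk]

/-- The volume growth of the lattice point count along an arithmetic progression of step two. -/
theorem tendsto_latticeCount_arith {n : ℕ} {P : Set (Fin n → ℝ)} (hP : IsCompact P)
    (hc : Convex ℝ P) (a : ℕ) :
    Tendsto (fun j : ℕ => (latticeCount (((2 * j + a : ℕ) : ℝ) • P) : ℝ) / (j : ℝ) ^ n) atTop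
      (𝓝 (volume.real P * 2 ^ n)) := by
  have hsub : Tendsto (fun j : ℕ => 2 * j + a) atTop atTop :=
    tendsto_atTop_mono (fun j => by simp only [id]; omega) tendsto_id
  have h1 := (tendsto_latticeCount_div_pow hP hc).comp hsub
  have h2 : Tendsto (fun j : ℕ => ((2 : ℝ) + a / (j : ℝ)) ^ n) atTop (𝓝 (2 ^ n)) := by
    have := (tendsto_const_div_atTop_nhds_zero_nat (a : ℝ)).const_add 2
    rw [add_zero] at this
    exact this.pow n
  refine (h1.mul h2).congr' ?_
  filter_upwards [eventually_ge_atTop 1] with j hj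
  have hj0 : (j : ℝ) ≠ 0 := by positivity
  have hj1 : (2 * (j : ℝ) + a) ≠ 0 := by positivity
  have : (2 : ℝ) + a / j = (2 * j + a) / j := by field_simp
  simp only [Function.comp_apply]
  rw [this, div_pow]
  push_cast
  field_simp

/-- The first nonzero coordinate is negative. -/
def IsLexNeg {N : ℕ} (δ : Fin N → ℝ) : Prop := ∃ i, δ i < 0 ∧ ∀ j < i, δ j = 0

theorem isLexNeg_or_isLexNeg_neg {N : ℕ} {δ : Fin N → ℝ} (hδ : δ ≠ 0) :
    IsLexNeg δ ∨ IsLexNeg (-δ) := by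
  obtain ⟨i, hi⟩ := Function.ne_iff.1 hδ
  obtain ⟨m, hm, hmin⟩ := WellFounded.has_min (wellFounded_lt (α := Fin N)) {i | δ i ≠ 0} ⟨i, hi⟩
  have h0 : ∀ j < m, δ j = 0 := fun j hj => by
    by_contra h
    exact hmin j h hj
  rcases lt_or_gt_of_ne (show δ m ≠ 0 from hm) with h | h
  · exact Or.inl ⟨m, h, h0⟩
  · exact Or.inr ⟨m, by simpa using h, fun j hj => by simp [h0 j hj]⟩

theorem IsLexNeg.smul {N : ℕ} {δ : Fin N → ℝ} (hδ : IsLexNeg δ) {c : ℝ} (hc : 0 < c) :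
    IsLexNeg (c • δ) := by
  obtain ⟨i, hi, h0⟩ := hδ
  exact ⟨i, by simpa using mul_neg_of_pos_of_neg hc hi, fun j hj => by simp [h0 j hj]⟩

/-- A nonempty compact set of vectors has a lexicographically minimal element. -/
theorem IsCompact.exists_not_isLexNeg_sub {N : ℕ} {K : Set (Fin N → ℝ)} (hK : IsCompact K)
    (hne : K.Nonempty) : ∃ μ ∈ K, ∀ ν ∈ K, ¬ IsLexNeg (ν - μ) := by
  have key : ∀ m ≤ N, ∃ L ⊆ K, IsCompact L ∧ L.Nonempty ∧
      (∀ μ ∈ L, ∀ ν ∈ K, (∀ j : Fin N, (j : ℕ) < m → ν j = μ j) → ν ∈ L) ∧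
      ∀ μ ∈ L, ∀ ν ∈ K, ∀ i : Fin N, (i : ℕ) < m → (∀ j < i, ν j = μ j) → μ i ≤ ν i := by
    intro m
    induction m with
    | zero =>
      exact fun _ => ⟨K, subset_rfl, hK, hne, fun _ _ ν hν _ => hν,
        fun _ _ _ _ i hi => absurd hi (Nat.not_lt_zero _)⟩
    | succ m ih =>
      intro hm
      obtain ⟨L, hLK, hLc, hLne, hLsat, hLmin⟩ := ih (by omega)
      set q : Fin N := ⟨m, by omega⟩ with hq
      obtain ⟨μ₀, hμ₀, hmin⟩ := hLc.exists_isMinOn hLne (continuous_apply q).continuousOn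
      rw [isMinOn_iff] at hmin
      refine ⟨L ∩ {μ | μ q = μ₀ q}, Set.inter_subset_left.trans hLK,
        hLc.inter_right (isClosed_eq (continuous_apply q) continuous_const), ⟨μ₀, hμ₀, rfl⟩,
        ?_, ?_⟩
      · rintro μ ⟨hμ, hμq⟩ ν hν h
        refine ⟨hLsat μ hμ ν hν fun j hj => h j (by omega), ?_⟩
        exact (h q (by simp [hq])).trans hμq
      · rintro μ ⟨hμ, hμq⟩ ν hν i hi h
        rcases Nat.lt_succ_iff_lt_or_eq.1 hi with hi | hi
        · exact hLmin μ hμ ν hν i hi h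
        · have hiq : i = q := Fin.ext hi
          subst hiq
          have hνL : ν ∈ L := hLsat μ hμ ν hν fun j hj =>
            h j (Fin.lt_def.2 (by simpa [hq] using hj))
          exact (le_of_eq hμq).trans (hmin ν hνL)
  obtain ⟨L, hLK, -, ⟨μ, hμ⟩, -, hmin⟩ := key N le_rfl
  refine ⟨μ, hLK hμ, fun ν hν ⟨i, hi, h0⟩ => ?_⟩
  have := hmin μ hμ ν hν i i.2 fun j hj => sub_eq_zero.1 (h0 j hj)
  simp only [Pi.sub_apply] at hi
  linarith

/-- The support of `μ` spans a cone of the lexicographic triangulation of the cone generated by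
the images under `φ` of the standard basis vectors: no relation whose first nonzero coefficient
is negative is nonnegative off the support of `μ`. -/
def IsLexSupported {N : ℕ} {E : Type*} [AddCommGroup E] [Module ℝ E]
    (φ : (Fin N → ℝ) →ₗ[ℝ] E) (μ : Fin N → ℝ) : Prop :=
  ∀ δ, φ δ = 0 → IsLexNeg δ → ∃ i, μ i = 0 ∧ δ i < 0

section LexSupported

variable {N : ℕ} {E : Type*} [AddCommGroup E] [Module ℝ E] {φ : (Fin N → ℝ) →ₗ[ℝ] E}

theorem IsLexSupported.of_support {μ ν : Fin N → ℝ} (h : IsLexSupported φ μ)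
    (hs : ∀ i, μ i = 0 → ν i = 0) : IsLexSupported φ ν := fun δ hδ hneg =>
  let ⟨i, hi, hi'⟩ := h δ hδ hneg
  ⟨i, hs i hi, hi'⟩

theorem IsLexSupported.eq {μ ν : Fin N → ℝ} (hμ : IsLexSupported φ μ) (hν : IsLexSupported φ ν)
    (hμ0 : 0 ≤ μ) (hν0 : 0 ≤ ν) (h : φ μ = φ ν) : μ = ν := by
  by_contra hne
  rcases isLexNeg_or_isLexNeg_neg (sub_ne_zero.2 hne) with hneg | hneg
  · obtain ⟨i, hi, hi'⟩ := hν _ (by rw [map_sub, h, sub_self]) hneg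
    have := hμ0 i
    simp only [Pi.sub_apply, Pi.zero_apply] at *
    linarith
  · obtain ⟨i, hi, hi'⟩ := hμ _ (by rw [map_neg, map_sub, h, sub_self, neg_zero]) hneg
    have := hν0 i
    simp only [Pi.sub_apply, Pi.neg_apply, Pi.zero_apply] at *
    linarith

theorem exists_isLexSupported {z : E} (hK : IsCompact {μ : Fin N → ℝ | 0 ≤ μ ∧ φ μ = z})
    (hne : ∃ μ : Fin N → ℝ, 0 ≤ μ ∧ φ μ = z) :
    ∃ μ : Fin N → ℝ, 0 ≤ μ ∧ φ μ = z ∧ IsLexSupported φ μ := by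
  obtain ⟨μ, ⟨hμ0, hμz⟩, hmin⟩ := hK.exists_not_isLexNeg_sub hne
  refine ⟨μ, hμ0, hμz, fun δ hδ hneg => ?_⟩
  by_contra! hcon
  have hε : ∀ᶠ ε : ℝ in 𝓝[>] 0, ∀ i, 0 ≤ μ i + ε * δ i := by
    rw [eventually_all]
    intro i
    rcases (hμ0 i).eq_or_lt with h | h
    · filter_upwards [self_mem_nhdsWithin] with ε hε
      have := hcon i h.symm
      rw [← h]
      simp only [Set.mem_Ioi, Pi.zero_apply] at *
      positivity
    · have hc : Tendsto (fun ε : ℝ => μ i + ε * δ i) (𝓝[>] 0) (𝓝 (μ i + 0 * δ i)) :=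
        (Continuous.tendsto (by fun_prop) 0).mono_left nhdsWithin_le_nhds
      rw [zero_mul, add_zero] at hc
      exact (hc.eventually_const_lt h).mono fun ε h => h.le
  obtain ⟨ε, hε0, hεpos⟩ := (hε.and self_mem_nhdsWithin).exists
  refine hmin (μ + ε • δ) ⟨fun i => by simpa using hε0 i, by simp [hμz, hδ]⟩ ?_
  rw [add_sub_cancel_left]
  exact hneg.smul hεpos

end LexSupported

theorem Finset.card_piAntidiag_nat {ι : Type*} [DecidableEq ι] (s : Finset ι) (t : ℕ) :
    (s.piAntidiag t).card = (s.card + t - 1).choose t := by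
  rw [← Finset.card_finsuppAntidiag_nat_eq_choose]
  simp [Finset.finsuppAntidiag]

/-- The total weight together with the vector represented by a coefficient vector. -/
noncomputable def coneMap {N n : ℕ} (w : Fin N → Fin n → ℤ) :
    (Fin N → ℝ) →ₗ[ℝ] ℝ × (Fin n → ℝ) where
  toFun μ := (∑ i, μ i, fun j => ∑ i, μ i * w i j)
  map_add' μ ν := by
    ext <;> simp [add_mul, Finset.sum_add_distrib]
  map_smul' c μ := by
    ext <;> simp [Finset.mul_sum, mul_assoc]

/-- Lexicographic coefficient vectors of the lattice points at height `k` in the cone over a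
polytope with vertices `w i / 2`. -/
def conePoints {N n : ℕ} (w : Fin N → Fin n → ℤ) (k : ℕ) : Set (Fin N → ℝ) :=
  {μ | 0 ≤ μ ∧ IsLexSupported (coneMap w) μ ∧
    ∃ x : Fin n → ℤ, coneMap w μ = ((k : ℝ) / 2, fun j => (x j : ℝ))}

/-- The coefficient vectors with entries in `[0, 1]` at which the lattice points decompose. -/
def boxPoints {N n : ℕ} (w : Fin N → Fin n → ℤ) : Set (Fin N → ℝ) :=
  {r | r ≤ 1 ∧ ∃ h, r ∈ conePoints w h}

section ConePoints

variable {N n : ℕ} {w : Fin N → Fin n → ℤ}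

theorem isCompact_setOf_coneMap_eq (z : ℝ × (Fin n → ℝ)) :
    IsCompact {μ : Fin N → ℝ | 0 ≤ μ ∧ coneMap w μ = z} := by
  refine (isCompact_Icc (a := (0 : Fin N → ℝ)) (b := fun _ => z.1)).of_isClosed_subset ?_ ?_
  · exact isClosed_Ici.inter
      (isClosed_eq (LinearMap.continuous_of_finiteDimensional (coneMap w)) continuous_const)
  · rintro μ ⟨hμ, rfl⟩
    exact ⟨hμ, fun i => Finset.single_le_sum (fun j _ => hμ j) (Finset.mem_univ i)⟩

theorem ncard_conePoints (k : ℕ) : (conePoints w k).ncard =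
    {x : Fin n → ℤ | ∃ μ : Fin N → ℝ, 0 ≤ μ ∧
      coneMap w μ = ((k : ℝ) / 2, fun j => (x j : ℝ))}.ncard := by
  refine Set.ncard_congr (fun μ hμ => hμ.2.2.choose) ?_ ?_ ?_
  · intro μ hμ
    exact ⟨μ, hμ.1, hμ.2.2.choose_spec⟩
  · intro μ ν hμ hν h
    refine hμ.2.1.eq hν.2.1 hμ.1 hν.1 ?_
    rw [hμ.2.2.choose_spec, hν.2.2.choose_spec, h]
  · rintro x hx
    obtain ⟨μ, hμ0, hμ, hlex⟩ := exists_isLexSupported (isCompact_setOf_coneMap_eq _) hx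
    refine ⟨μ, ⟨hμ0, hlex, x, hμ⟩, ?_⟩
    have := (Exists.choose_spec (⟨x, hμ⟩ : ∃ x : Fin n → ℤ,
      coneMap w μ = ((k : ℝ) / 2, fun j => (x j : ℝ)))).symm.trans hμ
    funext j
    exact Int.cast_injective (α := ℝ) (congrFun (congrArg Prod.snd this) j)

theorem finite_boxPoints : (boxPoints w).Finite := by
  set M : ℕ := 2 * N
  set R : Fin n → ℤ := fun j => ∑ i, |w i j|
  refine Set.Finite.of_injOn (f := fun r => coneMap w r)
    (t := (fun p : ℕ × (Fin n → ℤ) => (((p.1 : ℝ) / 2, fun j => (p.2 j : ℝ)) :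
      ℝ × (Fin n → ℝ))) '' (Set.Iic M ×ˢ Set.Icc (-R) R)) ?_ ?_ ?_
  · rintro r ⟨hr1, h, hr0, -, x, hx⟩
    refine ⟨(h, x), ⟨?_, ?_⟩, hx.symm⟩
    · have h1 : ∑ i, r i = (h : ℝ) / 2 := congrArg Prod.fst hx
      have h2 : ∑ i, r i ≤ ∑ _i : Fin N, (1 : ℝ) := Finset.sum_le_sum fun i _ => hr1 i
      simp only [Finset.sum_const, Finset.card_univ, Fintype.card_fin, nsmul_eq_mul, mul_one] at h2
      have : (h : ℝ) ≤ (M : ℕ) := by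
        simp only [M]
        push_cast
        linarith
      exact_mod_cast this
    · have h1 : ∀ j, |(x j : ℝ)| ≤ (R j : ℝ) := fun j => by
        have : ∑ i, r i * w i j = (x j : ℝ) := congrFun (congrArg Prod.snd hx) j
        rw [← this]
        simp only [R]
        push_cast
        refine (Finset.abs_sum_le_sum_abs _ _).trans (Finset.sum_le_sum fun i _ => ?_)
        rw [abs_mul, abs_of_nonneg (hr0 i)]
        exact mul_le_of_le_one_left (abs_nonneg _) (hr1 i)
      exact ⟨fun j => by
        have := (abs_le.1 (h1 j)).1
        simp only [Pi.neg_apply]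
        exact_mod_cast this, fun j => by exact_mod_cast (abs_le.1 (h1 j)).2⟩
  · rintro r ⟨-, h, hr⟩ s ⟨-, h', hs⟩ heq
    exact hr.2.1.eq hs.2.1 hr.1 hs.1 heq
  · exact ((Set.finite_Iic M).prod (Set.finite_Icc _ _)).image _

/-- Coefficient vectors of the integral translates at height `k` of a box point of height `h`
and support `s`. -/
def translates {N : ℕ} (s : Finset (Fin N)) (h k : ℕ) : Finset (Fin N → ℕ) :=
  if h ≤ k ∧ 2 ∣ k - h then s.piAntidiag ((k - h) / 2) else ∅

theorem mem_translates {s : Finset (Fin N)} {h k : ℕ} {m : Fin N → ℕ} :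
    m ∈ translates s h k ↔ h + 2 * ∑ i, m i = k ∧ ∀ i, m i ≠ 0 → i ∈ s := by
  have hsum : (∀ i, m i ≠ 0 → i ∈ s) → s.sum m = ∑ i, m i := fun hm =>
    Finset.sum_subset (Finset.subset_univ s) fun i _ hi => by
      by_contra h0
      exact hi (hm i h0)
  rw [translates]
  split_ifs with hk
  · rw [Finset.mem_piAntidiag]
    refine and_congr_left fun hm => ?_
    rw [hsum hm]
    omega
  · simp only [Finset.notMem_empty, false_iff, not_and]
    intro hm
    omega

theorem exists_polynomial_card_translates (s : Finset (Fin N)) {h a : ℕ} (ha : 1 ≤ a)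
    (hs : h ≤ 2 * s.card) : ∃ p : Polynomial ℚ, ∀ j : ℕ,
      ((translates s h (2 * j + a)).card : ℚ) = p.eval (j : ℚ) := by
  rcases s.eq_empty_or_nonempty with rfl | hne
  · refine ⟨0, fun j => ?_⟩
    have : translates (∅ : Finset (Fin N)) h (2 * j + a) = ∅ := by
      refine Finset.eq_empty_of_forall_notMem fun m hm => ?_
      rw [mem_translates] at hm
      have hm0 : ∀ i, m i = 0 := fun i => by
        by_contra h0
        simpa using hm.2 i h0
      simp only [hm0, Finset.sum_const_zero, Finset.card_empty] at hm hs
      omega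
    simp [this]
  have hcard := hne.card_pos
  by_cases hpar : 2 ∣ a + h
  · obtain ⟨e, he⟩ : ∃ e : ℕ, 2 * e + h + 2 = a + 2 * s.card :=
      ⟨(a + 2 * s.card - h - 2) / 2, by omega⟩
    obtain ⟨q, -, -, hq⟩ := Polynomial.exists_eval_natCast_eq_choose (s.card - 1)
    refine ⟨q.comp (Polynomial.X + Polynomial.C (e : ℚ)), fun j => ?_⟩
    rw [Polynomial.eval_comp, Polynomial.eval_add, Polynomial.eval_X, Polynomial.eval_C,
      ← Nat.cast_add, hq, translates]
    congr 1
    split_ifs with hk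
    · rw [Finset.card_piAntidiag_nat]
      have h1 : s.card + (2 * j + a - h) / 2 - 1 = j + e := by omega
      rw [h1]
      exact Nat.choose_symm_of_eq_add (by omega)
    · rw [Finset.card_empty, Nat.choose_eq_zero_of_lt (by omega)]
  · refine ⟨0, fun j => ?_⟩
    rw [translates, if_neg (by omega)]
    simp

theorem exists_polynomial_ncard_conePoints (w : Fin N → Fin n → ℤ) {a : ℕ} (ha : 1 ≤ a) :
    ∃ p : Polynomial ℚ, ∀ j : ℕ, ((conePoints w (2 * j + a)).ncard : ℚ) = p.eval (j : ℚ) := by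
  classical
  set B := (finite_boxPoints (w := w)).toFinset with hB
  have hex : ∀ r, ∃ h : ℕ, r ∈ boxPoints w → r ∈ conePoints w h := fun r => by
    by_cases hr : r ∈ boxPoints w
    · exact ⟨hr.2.choose, fun _ => hr.2.choose_spec⟩
    · exact ⟨0, fun h => absurd h hr⟩
  choose h hh using hex
  set S : (Fin N → ℝ) → Finset (Fin N) := fun r => Finset.univ.filter fun i => r i ≠ 0 with hS
  have hceil : ∀ r ∈ boxPoints w, ∀ m : Fin N → ℕ, (∀ i, m i ≠ 0 → i ∈ S r) →
      ∀ i, m i = ⌈r i + m i⌉₊ - 1 := by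
    intro r hr m hm i
    by_cases h0 : r i = 0
    · have : m i = 0 := by
        by_contra hc
        have := hm i hc
        simp [hS, h0] at this
      simp [h0, this]
    · have h1 : ⌈r i⌉₊ = 1 := by
        have hpos : 0 < r i := lt_of_le_of_ne ((hh r hr).1 i) (Ne.symm h0)
        refine le_antisymm ?_ (Nat.ceil_pos.2 hpos)
        exact Nat.ceil_le.2 (by simpa using hr.1 i)
      rw [Nat.ceil_add_natCast ((hh r hr).1 i), h1]
      omega
  have hcount : ∀ k, (conePoints w k).ncard = ∑ r ∈ B, (translates (S r) (h r) k).card := by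
    intro k
    rw [← Finset.card_sigma, ← Set.ncard_coe_finset]
    symm
    refine Set.ncard_congr (fun p _ => p.1 + fun i => (p.2 i : ℝ)) ?_ ?_ ?_
    · rintro ⟨r, m⟩ hp
      simp only [Finset.coe_sigma, Set.mem_sigma_iff, Finset.mem_coe, mem_translates, hB,
        Set.Finite.mem_toFinset] at hp
      obtain ⟨hr, hsum, hm⟩ := hp
      obtain ⟨hr0, hlex, x, hx⟩ := hh r hr
      refine ⟨fun i => add_nonneg (hr0 i) (Nat.cast_nonneg _), hlex.of_support fun i hi => ?_,
        fun j => x j + ∑ i, m i * w i j, ?_⟩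
      · have : m i = 0 := by
          by_contra hc
          have := hm i hc
          simp [hS, hi] at this
        simp [hi, this]
      · rw [map_add, hx]
        ext j
        · simp only [coneMap, LinearMap.coe_mk, AddHom.coe_mk, Prod.fst_add, ← hsum]
          push_cast
          ring
        · simp [coneMap]
    · rintro ⟨r, m⟩ ⟨r', m'⟩ hp hp' heq
      simp only [Finset.coe_sigma, Set.mem_sigma_iff, Finset.mem_coe, mem_translates, hB,
        Set.Finite.mem_toFinset] at hp hp'
      have heq' : ∀ i, r i + m i = r' i + m' i := fun i => congrFun heq i
      have hm : m = m' := by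
        funext i
        rw [hceil r hp.1 m hp.2.2 i, hceil r' hp'.1 m' hp'.2.2 i, heq' i]
      subst hm
      have hr : r = r' := by
        funext i
        exact add_right_cancel (heq' i)
      subst hr
      rfl
    · rintro μ ⟨hμ0, hlex, x, hx⟩
      set m : Fin N → ℕ := fun i => ⌈μ i⌉₊ - 1 with hm
      have hmμ : ∀ i, (m i : ℝ) ≤ μ i ∧ μ i ≤ m i + 1 ∧ (μ i ≠ 0 → (m i : ℝ) < μ i) := by
        intro i
        rcases (hμ0 i).eq_or_lt with h | h
        · simp [hm, ← h]
        · have h1 : 1 ≤ ⌈μ i⌉₊ := Nat.ceil_pos.2 h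
          have h2 : (m i : ℝ) = ⌈μ i⌉₊ - 1 := by simp [hm, Nat.cast_sub h1]
          have h3 := Nat.ceil_lt_add_one (hμ0 i)
          have h4 := Nat.le_ceil (μ i)
          exact ⟨by linarith, by linarith, fun _ => by linarith⟩
      set r : Fin N → ℝ := fun i => μ i - m i with hr
      have hμr : μ = r + fun i => (m i : ℝ) := by
        funext i
        simp [hr]
      have hle : 2 * ∑ i, m i ≤ k := by
        have h1 : ∑ i, μ i = (k : ℝ) / 2 := congrArg Prod.fst hx
        have h2 : ∑ i, (m i : ℝ) ≤ ∑ i, μ i := Finset.sum_le_sum fun i _ => (hmμ i).1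
        have : ((2 * ∑ i, m i : ℕ) : ℝ) ≤ k := by
          push_cast
          linarith
        exact_mod_cast this
      have hrc : r ∈ conePoints w (k - 2 * ∑ i, m i) := by
        refine ⟨fun i => sub_nonneg.2 (hmμ i).1, hlex.of_support fun i hi => ?_,
          fun j => x j - ∑ i, m i * w i j, ?_⟩
        · simp [hr, hm, hi]
        · have : r = μ - fun i => (m i : ℝ) := rfl
          rw [this, map_sub, hx]
          ext j
          · rw [Nat.cast_sub hle]
            simp only [coneMap, LinearMap.coe_mk, AddHom.coe_mk, Prod.fst_sub]
            push_cast
            ring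
          · simp [coneMap]
      have hrB : r ∈ boxPoints w := by
        refine ⟨fun i => ?_, _, hrc⟩
        have := (hmμ i).2.1
        simp only [hr, Pi.one_apply]
        linarith
      refine ⟨⟨r, m⟩, ?_, hμr.symm⟩
      simp only [Finset.coe_sigma, Set.mem_sigma_iff, Finset.mem_coe, mem_translates, hB,
        Set.Finite.mem_toFinset]
      refine ⟨hrB, ?_, fun i hi => ?_⟩
      · obtain ⟨-, -, y, hy⟩ := hh r hrB
        obtain ⟨-, -, y', hy'⟩ := hrc
        have h1 : ((h r : ℕ) : ℝ) / 2 = ((k - 2 * ∑ i, m i : ℕ) : ℝ) / 2 :=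
          congrArg Prod.fst (hy.symm.trans hy')
        have h2 : h r = k - 2 * ∑ i, m i := by
          have : ((h r : ℕ) : ℝ) = ((k - 2 * ∑ i, m i : ℕ) : ℝ) := by linarith
          exact_mod_cast this
        omega
      · simp only [hS, Finset.mem_filter, Finset.mem_univ, true_and]
        have : μ i ≠ 0 := fun h0 => hi (by simp [hm, h0])
        have := (hmμ i).2.2 this
        simp only [hr]
        linarith
  have hpoly : ∀ r, ∃ p : Polynomial ℚ, r ∈ B → ∀ j : ℕ,
      ((translates (S r) (h r) (2 * j + a)).card : ℚ) = p.eval (j : ℚ) := by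
    intro r
    by_cases hrB : r ∈ B
    · have hr : r ∈ boxPoints w := by simpa [hB] using hrB
      obtain ⟨hr0, -, x, hx⟩ := hh r hr
      obtain ⟨p, hp⟩ := exists_polynomial_card_translates (S r) (h := h r) ha (by
        have h1 : ∑ i, r i = (h r : ℝ) / 2 := congrArg Prod.fst hx
        have h2 : ∑ i, r i = ∑ i ∈ S r, r i := (Finset.sum_filter_ne_zero _).symm
        have h3 : ∑ i ∈ S r, r i ≤ ∑ _i ∈ S r, (1 : ℝ) := Finset.sum_le_sum fun i _ => hr.1 i
        simp only [Finset.sum_const, nsmul_eq_mul, mul_one] at h3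
        have : (h r : ℝ) ≤ (2 * (S r).card : ℕ) := by
          push_cast
          linarith
        exact_mod_cast this)
      exact ⟨p, fun _ => hp⟩
    · exact ⟨0, fun h => absurd h hrB⟩
  choose p hp using hpoly
  refine ⟨∑ r ∈ B, p r, fun j => ?_⟩
  rw [hcount, Polynomial.eval_finsetSum]
  push_cast
  exact Finset.sum_congr rfl fun r hr => hp r hr j

end ConePoints

section IntrinsicInterior

variable {E : Type*} [NormedAddCommGroup E] [NormedSpace ℝ E] {S : Set E} {x y : E}

/-- A linear functional bounded below on `S` and not attaining its bound everywhere does not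
attain it on the relative interior. -/
theorem lt_of_mem_intrinsicInterior (f : E →ₗ[ℝ] ℝ) {a : ℝ} (hS : ∀ z ∈ S, a ≤ f z)
    (hy : y ∈ S) (hay : a < f y) (hx : x ∈ intrinsicInterior ℝ S) : a < f x := by
  obtain ⟨x', hx', rfl⟩ := hx
  have hy' : y ∈ affineSpan ℝ S := subset_affineSpan ℝ S hy
  let g : ℝ → affineSpan ℝ S := fun t =>
    ⟨AffineMap.lineMap (x' : E) y t, AffineMap.lineMap_mem t x'.2 hy'⟩
  have hg : Continuous g := AffineMap.lineMap_continuous.subtype_mk _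
  have hg0 : g 0 = x' := Subtype.ext (by simp [g])
  have hnear : ∀ᶠ t in 𝓝 (0 : ℝ), g t ∈ interior ((↑) ⁻¹' S : Set (affineSpan ℝ S)) :=
    hg.continuousAt.eventually_mem (by
      rw [hg0]
      exact isOpen_interior.mem_nhds hx')
  obtain ⟨t, ht, htneg⟩ := ((hnear.filter_mono nhdsWithin_le_nhds).and
    (self_mem_nhdsWithin (s := Set.Iio (0 : ℝ)))).exists
  have h0 : g t ∈ ((↑) ⁻¹' S : Set (affineSpan ℝ S)) := interior_subset ht
  have h1 := hS _ h0
  have h2 : f (g t) = f x' + t * (f y - f x') := by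
    simp only [g, AffineMap.lineMap_apply, vsub_eq_sub, vadd_eq_add, map_add, map_smul, map_sub,
      smul_eq_mul]
    ring
  rw [h2] at h1
  by_contra hcon
  nlinarith [mul_pos_of_neg_of_neg htneg (show a - f y < 0 by linarith),
    mul_nonneg_of_nonpos_of_nonpos htneg.le (show f x' - a ≤ 0 by linarith)]

theorem mem_intrinsicInterior_of_isOpen {U : Set E} (hU : IsOpen U) (hxU : x ∈ U) (hx : x ∈ S)
    (h : ∀ z ∈ affineSpan ℝ S, z ∈ U → z ∈ S) : x ∈ intrinsicInterior ℝ S := by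
  refine ⟨⟨x, subset_affineSpan ℝ S hx⟩, mem_interior.2 ⟨((↑) : affineSpan ℝ S → E) ⁻¹' U,
    fun z hz => h z z.2 hz, hU.preimage continuous_subtype_val, hxU⟩, rfl⟩

theorem eq_of_mem_affineSpan (f : E →ₗ[ℝ] ℝ) {a : ℝ} (hS : ∀ z ∈ S, f z = a)
    (hx : x ∈ affineSpan ℝ S) : f x = a := by
  refine affineSpan_induction (p := fun x => f x = a) hx hS fun c u v w hu hv hw => ?_
  simp [hu, hv, hw]

end IntrinsicInterior

section CornerSimplex

variable {n : ℕ}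

theorem intrinsicInterior_cornerSimplex (J : Finset (Fin n)) {c : ℝ} (hc : 0 < c) :
    intrinsicInterior ℝ {x : Fin n → ℝ | (∀ j, 0 ≤ x j) ∧ (∀ j ∉ J, x j = 0) ∧ ∑ j, x j ≤ c} =
      {x | (∀ j ∈ J, 0 < x j) ∧ (∀ j ∉ J, x j = 0) ∧ ∑ j, x j < c} := by
  have hsum : ∀ x : Fin n → ℝ, (∑ j, LinearMap.proj (R := ℝ) (φ := fun _ : Fin n => ℝ) j) x =
      ∑ j, x j := fun x => by simp
  have hsub : ∀ x ∈ {x : Fin n → ℝ | (∀ j ∈ J, 0 < x j) ∧ (∀ j ∉ J, x j = 0) ∧ ∑ j, x j < c},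
      ∀ j, 0 ≤ x j := fun x hx j => by
    by_cases hj : j ∈ J
    · exact (hx.1 j hj).le
    · exact (hx.2.1 j hj).ge
  refine Set.Subset.antisymm (fun x hx => ⟨fun j hj => ?_, fun j hj => ?_, ?_⟩) fun x hx => ?_
  · refine lt_of_mem_intrinsicInterior (LinearMap.proj j) (fun z hz => hz.1 j)
      (y := Pi.single j c) ?_ (by simpa using hc) hx
    refine ⟨fun i => ?_, fun i hi => ?_, ?_⟩
    · by_cases h : i = j
      · subst h
        simpa using hc.le
      · simp [h]
    · have hij : i ≠ j := fun h => hi (h ▸ hj)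
      simp [hij]
    · simp
  · exact (intrinsicInterior_subset hx).2.1 j hj
  · have := lt_of_mem_intrinsicInterior (a := -c)
      (-(∑ j, LinearMap.proj (R := ℝ) (φ := fun _ : Fin n => ℝ) j))
      (fun z hz => by
        rw [LinearMap.neg_apply, hsum]
        exact neg_le_neg hz.2.2)
      (y := 0) (Set.mem_ofPred.2 ⟨by simp, by simp, by simpa using hc.le⟩) (by simpa using hc) hx
    rw [LinearMap.neg_apply, hsum] at this
    exact neg_lt_neg_iff.1 this
  · refine mem_intrinsicInterior_of_isOpen
      (U := (⋂ j ∈ J, {x | 0 < x j}) ∩ {x | ∑ j, x j < c}) ?_ ?_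
      ⟨hsub x hx, hx.2.1, hx.2.2.le⟩ fun z hz hzU => ?_
    · exact (isOpen_biInter_finset fun j _ =>
        isOpen_lt continuous_const (continuous_apply j)).inter
          (isOpen_lt (by fun_prop) continuous_const)
    · exact ⟨by simpa using hx.1, hx.2.2⟩
    · have h0 : ∀ j ∉ J, z j = 0 := fun j hj =>
        eq_of_mem_affineSpan (LinearMap.proj j) (fun y hy => hy.2.1 j hj) hz
      have h1 : ∀ j ∈ J, 0 < z j := by simpa using hzU.1
      exact ⟨hsub z ⟨h1, h0, hzU.2⟩, h0, le_of_lt hzU.2⟩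

theorem intrinsicInterior_faceSimplex {J : Finset (Fin n)} {c : ℝ} (hc : 0 < c) :
    intrinsicInterior ℝ {x : Fin n → ℝ | (∀ j, 0 ≤ x j) ∧ (∀ j ∉ J, x j = 0) ∧ ∑ j, x j = c} =
      {x | (∀ j ∈ J, 0 < x j) ∧ (∀ j ∉ J, x j = 0) ∧ ∑ j, x j = c} := by
  have hsum : ∀ x : Fin n → ℝ, (∑ j, LinearMap.proj (R := ℝ) (φ := fun _ : Fin n => ℝ) j) x =
      ∑ j, x j := fun x => by simp
  have hsub : ∀ x : Fin n → ℝ, (∀ j ∈ J, 0 < x j) → (∀ j ∉ J, x j = 0) →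
      ∀ j, 0 ≤ x j := fun x h1 h0 j => by
    by_cases hj : j ∈ J
    · exact (h1 j hj).le
    · exact (h0 j hj).ge
  refine Set.Subset.antisymm (fun x hx => ⟨fun j hj => ?_, fun j hj => ?_, ?_⟩) fun x hx => ?_
  · refine lt_of_mem_intrinsicInterior (LinearMap.proj j) (fun z hz => hz.1 j)
      (y := Pi.single j c) ?_ (by simpa using hc) hx
    refine ⟨fun i => ?_, fun i hi => ?_, ?_⟩
    · by_cases h : i = j
      · subst h
        simpa using hc.le
      · simp [h]
    · have hij : i ≠ j := fun h => hi (h ▸ hj)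
      simp [hij]
    · simp
  · exact (intrinsicInterior_subset hx).2.1 j hj
  · exact (intrinsicInterior_subset hx).2.2
  · refine mem_intrinsicInterior_of_isOpen (U := ⋂ j ∈ J, {x | 0 < x j})
      (isOpen_biInter_finset fun j _ => isOpen_lt continuous_const (continuous_apply j))
      (by simpa using hx.1) ⟨hsub x hx.1 hx.2.1, hx.2.1, hx.2.2⟩ fun z hz hzU => ?_
    have h0 : ∀ j ∉ J, z j = 0 := fun j hj =>
      eq_of_mem_affineSpan (LinearMap.proj j) (fun y hy => hy.2.1 j hj) hz
    refine ⟨hsub z (by simpa using hzU) h0, h0, ?_⟩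
    rw [← hsum]
    exact eq_of_mem_affineSpan _ (fun y hy => by rw [hsum]; exact hy.2.2) hz

theorem baseSimplex_eq (n i : ℕ) : baseSimplex n i =
    {x : Fin n → ℝ | (∀ j, 0 ≤ x j) ∧ (∀ j ∉ Finset.univ.filter (fun j : Fin n => (j : ℕ) < i),
      x j = 0) ∧ ∑ j, x j ≤ 1} := by
  refine Set.Subset.antisymm (convexHull_min ?_ ?_) ?_
  · rintro _ (rfl | ⟨j, hj, rfl⟩)
    · simp
    · refine ⟨fun l => ?_, fun l hl => Pi.single_eq_of_ne (fun h => hl ?_) _, by simp⟩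
      · by_cases h : l = j
        · subst h
          simp
        · simp [h]
      · subst h
        simpa using hj
  · rintro x ⟨hx, hx0, hx1⟩ y ⟨hy, hy0, hy1⟩ a b ha hb hab
    refine ⟨fun j => ?_, fun j hj => ?_, ?_⟩
    · have := hx j
      have := hy j
      simp only [Pi.add_apply, Pi.smul_apply, smul_eq_mul]
      positivity
    · simp [hx0 j hj, hy0 j hj]
    · simp only [Pi.add_apply, Pi.smul_apply, smul_eq_mul, Finset.sum_add_distrib,
        ← Finset.mul_sum]
      nlinarith
  · rintro x ⟨hx, hx0, hx1⟩
    have key := (convex_convexHull ℝ (insert (0 : Fin n → ℝ)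
      ((fun j : Fin n => (Pi.single j 1 : Fin n → ℝ)) '' {j | (j : ℕ) < i}))).sum_mem
      (t := (Finset.univ : Finset (Option (Fin n))))
      (w := fun o => o.elim (1 - ∑ j, x j) x)
      (z := fun o => o.elim 0 fun j => if (j : ℕ) < i then Pi.single j 1 else 0)
      (by
        rintro (_ | j) -
        · simpa using hx1
        · exact hx j)
      (by simp [Fintype.sum_option])
      (by
        rintro (_ | j) -
        · exact subset_convexHull _ _ (Set.mem_insert _ _)
        · refine subset_convexHull _ _ ?_
          by_cases hj : (j : ℕ) < i
          · simp only [Option.elim, hj, if_true]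
            exact Set.mem_insert_of_mem _ ⟨j, hj, rfl⟩
          · simp [Option.elim, hj])
    convert! key using 1
    rw [Fintype.sum_option]
    simp only [Option.elim, smul_zero, zero_add]
    conv_lhs => rw [← Finset.univ_sum_single x]
    refine Finset.sum_congr rfl fun j _ => ?_
    by_cases hj : (j : ℕ) < i
    · simp only [hj, if_true]
      rw [← Pi.single_smul]
      simp
    · simp [hj, hx0 j (by simpa using hj)]

theorem convexHull_single_eq (n i : ℕ) :
    convexHull ℝ ((fun j : Fin n => (Pi.single j 1 : Fin n → ℝ)) '' {j | (j : ℕ) < i}) =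
    {x : Fin n → ℝ | (∀ j, 0 ≤ x j) ∧ (∀ j ∉ Finset.univ.filter (fun j : Fin n => (j : ℕ) < i),
      x j = 0) ∧ ∑ j, x j = 1} := by
  refine Set.Subset.antisymm (convexHull_min ?_ ?_) ?_
  · rintro _ ⟨j, hj, rfl⟩
    refine ⟨fun l => ?_, fun l hl => Pi.single_eq_of_ne (fun h => hl ?_) _, by simp⟩
    · by_cases h : l = j
      · subst h
        simp
      · simp [h]
    · subst h
      simpa using hj
  · rintro x ⟨hx, hx0, hx1⟩ y ⟨hy, hy0, hy1⟩ a b ha hb hab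
    refine ⟨fun j => ?_, fun j hj => ?_, ?_⟩
    · have := hx j
      have := hy j
      simp only [Pi.add_apply, Pi.smul_apply, smul_eq_mul]
      positivity
    · simp [hx0 j hj, hy0 j hj]
    · simp only [Pi.add_apply, Pi.smul_apply, smul_eq_mul, Finset.sum_add_distrib,
        ← Finset.mul_sum, hx1, hy1]
      linarith
  · rintro x ⟨hx, hx0, hx1⟩
    have hext : ∀ f : Fin n → ℝ → Fin n → ℝ, (∀ j, f j 0 = 0) →
        ∑ j ∈ Finset.univ.filter (fun j : Fin n => (j : ℕ) < i), f j (x j) =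
          ∑ j, f j (x j) := fun f hf =>
      Finset.sum_subset (Finset.subset_univ _) fun j _ hj => by rw [hx0 j hj, hf]
    have key := (convex_convexHull ℝ
      ((fun j : Fin n => (Pi.single j 1 : Fin n → ℝ)) '' {j | (j : ℕ) < i})).sum_mem
      (t := Finset.univ.filter (fun j : Fin n => (j : ℕ) < i)) (w := x)
      (z := fun j => (Pi.single j 1 : Fin n → ℝ)) (fun j _ => hx j)
      (by
        rw [← hx1]
        exact Finset.sum_subset (Finset.subset_univ _) fun j _ hj => hx0 j hj)
      (fun j hj => subset_convexHull _ _ ⟨j, by simpa using hj, rfl⟩)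
    rw [hext (fun j t => t • (Pi.single j 1 : Fin n → ℝ)) (fun j => by simp)] at key
    convert! key using 1
    conv_lhs => rw [← Finset.univ_sum_single x]
    refine Finset.sum_congr rfl fun j _ => ?_
    rw [← Pi.single_smul]
    simp

end CornerSimplex

section Counting

variable {n : ℕ}

/-- Integer vectors with support `J`, positive on `J`, and entries summing to `m`. -/
def compositions (J : Finset (Fin n)) (m : ℕ) : Set (Fin n → ℤ) :=
  {x | (∀ j ∈ J, 0 < x j) ∧ (∀ j ∉ J, x j = 0) ∧ ∑ j, x j = m}

theorem compositions_nonneg {J : Finset (Fin n)} {m : ℕ} {x : Fin n → ℤ}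
    (hx : x ∈ compositions J m) (j : Fin n) : 0 ≤ x j := by
  by_cases hj : j ∈ J
  · exact (hx.1 j hj).le
  · exact (hx.2.1 j hj).ge

theorem finite_compositions (J : Finset (Fin n)) (m : ℕ) : (compositions J m).Finite :=
  (Set.finite_Icc (0 : Fin n → ℤ) (fun _ => m)).subset fun x hx =>
    ⟨compositions_nonneg hx, fun j => by
      have := Finset.single_le_sum (fun i _ => compositions_nonneg hx i) (Finset.mem_univ j)
      rwa [hx.2.2] at this⟩

theorem ncard_compositions_of_le {J : Finset (Fin n)} {m : ℕ} (h : J.card ≤ m) :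
    (compositions J m).ncard = (J.piAntidiag (m - J.card)).card := by
  rw [← Set.ncard_coe_finset]
  symm
  have hind : ∑ j, (if j ∈ J then (1 : ℤ) else 0) = J.card := by simp
  refine Set.ncard_congr (fun y _ j => (y j : ℤ) + if j ∈ J then 1 else 0) ?_ ?_ ?_
  · intro y hy
    rw [Finset.mem_coe, Finset.mem_piAntidiag] at hy
    have hsum : ∑ j, y j = m - J.card := by
      rw [← hy.1]
      exact (Finset.sum_subset (Finset.subset_univ _) fun j _ hj => by
        by_contra h0
        exact hj (hy.2 j h0)).symm
    refine ⟨fun j hj => ?_, fun j hj => ?_, ?_⟩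
    · simp only [hj, if_true]
      positivity
    · have : y j = 0 := by
        by_contra h0
        exact hj (hy.2 j h0)
      simp [hj, this]
    · rw [Finset.sum_add_distrib, hind, ← Nat.cast_sum, hsum]
      omega
  · intro y z _ _ heq
    funext j
    have := congrFun heq j
    omega
  · intro x hx
    have hx1 : ∀ j, 0 ≤ x j - if j ∈ J then 1 else 0 := fun j => by
      by_cases hj : j ∈ J
      · have := hx.1 j hj
        simp only [hj, if_true]
        omega
      · simp [hj, hx.2.1 j hj]
    refine ⟨fun j => (x j - if j ∈ J then 1 else 0).toNat, ?_, ?_⟩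
    · rw [Finset.mem_coe, Finset.mem_piAntidiag]
      have h0 : ∀ j ∉ J, (x j - if j ∈ J then 1 else 0).toNat = 0 := fun j hj => by
        simp [hj, hx.2.1 j hj]
      refine ⟨?_, fun j hj => ?_⟩
      · rw [Finset.sum_subset (Finset.subset_univ J) fun j _ hj => h0 j hj]
        zify [h]
        rw [Finset.sum_congr rfl fun j _ => Int.toNat_of_nonneg (hx1 j),
          Finset.sum_sub_distrib, hind, hx.2.2]
      · by_contra hc
        exact hj (h0 j hc)
    · funext j
      simp only
      rw [Int.toNat_of_nonneg (hx1 j)]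
      ring

theorem compositions_eq_empty {J : Finset (Fin n)} {m : ℕ} (h : m < J.card) :
    compositions J m = ∅ := by
  refine Set.eq_empty_of_forall_notMem fun x hx => ?_
  have h1 : ∑ _j ∈ J, (1 : ℤ) ≤ ∑ j ∈ J, x j := Finset.sum_le_sum fun j hj => hx.1 j hj
  rw [Finset.sum_subset (Finset.subset_univ J) fun j _ hj => hx.2.1 j hj, hx.2.2] at h1
  simp only [Finset.sum_const, nsmul_eq_mul, mul_one] at h1
  omega

theorem ncard_compositions_succ {J : Finset (Fin n)} (hJ : J.Nonempty) (m : ℕ) :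
    (compositions J (m + 1)).ncard = m.choose (J.card - 1) := by
  have hcard := hJ.card_pos
  rcases le_or_gt J.card (m + 1) with h | h
  · rw [ncard_compositions_of_le h, Finset.card_piAntidiag_nat,
      show J.card + (m + 1 - J.card) - 1 = m by omega]
    exact Nat.choose_symm_of_eq_add (by omega)
  · rw [compositions_eq_empty h, Set.ncard_empty, Nat.choose_eq_zero_of_lt (by omega)]

theorem ncard_iUnion_compositions (J : Finset (Fin n)) (M : ℕ) :
    (⋃ m ∈ Finset.range (M + 1), compositions J m).ncard = M.choose J.card := by
  induction M with
  | zero =>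
    simp only [zero_add, Finset.range_one, Finset.mem_singleton, Set.iUnion_iUnion_eq_left]
    rcases J.eq_empty_or_nonempty with rfl | hJ
    · rw [ncard_compositions_of_le (by simp)]
      simp
    · rw [compositions_eq_empty hJ.card_pos, Set.ncard_empty,
        Nat.choose_eq_zero_of_lt hJ.card_pos]
  | succ M ih =>
    have hU : (⋃ m ∈ Finset.range (M + 1 + 1), compositions J m) =
        compositions J (M + 1) ∪ ⋃ m ∈ Finset.range (M + 1), compositions J m := by
      rw [Finset.range_add_one, Finset.set_biUnion_insert]
    have hdisj : Disjoint (compositions J (M + 1))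
        (⋃ m ∈ Finset.range (M + 1), compositions J m) := by
      rw [Set.disjoint_left]
      intro x hx hx'
      obtain ⟨m, hm, hxm⟩ := Set.mem_iUnion₂.1 hx'
      have := hx.2.2.symm.trans hxm.2.2
      rw [Finset.mem_range] at hm
      omega
    rw [hU, Set.ncard_union_eq hdisj (finite_compositions _ _)
      ((Finset.range (M + 1)).finite_toSet.biUnion fun m _ => finite_compositions J m), ih]
    rcases J.eq_empty_or_nonempty with rfl | hJ
    · have : compositions (∅ : Finset (Fin n)) (M + 1) = ∅ := by
        refine Set.eq_empty_of_forall_notMem fun x hx => ?_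
        have := hx.2.2
        rw [Finset.sum_eq_zero fun j _ => hx.2.1 j (Finset.notMem_empty j)] at this
        omega
      simp [this]
    · rw [ncard_compositions_succ hJ]
      obtain ⟨s, hs⟩ := Nat.exists_eq_succ_of_ne_zero hJ.card_pos.ne'
      rw [hs, Nat.succ_eq_add_one, Nat.add_sub_cancel, Nat.choose_succ_succ]

theorem natCast_smul_half_smul {k : ℕ} (S : Set (Fin n → ℝ)) :
    (k : ℝ) • (2⁻¹ : ℝ) • S = ((k : ℝ) / 2) • S := by
  rw [smul_smul, div_eq_mul_inv]

theorem card_filter_val_lt {i : ℕ} (hi : i ≤ n) :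
    (Finset.univ.filter fun j : Fin n => (j : ℕ) < i).card = i := by
  rw [Fin.card_filter_val_lt, min_eq_right hi]

theorem Eone_eq {i k : ℕ} (hi : i ≤ n) (hk : 1 ≤ k) : Eone n i k = ((k - 1) / 2).choose i := by
  have hc : (0 : ℝ) < (k : ℝ) / 2 := by positivity
  set J := Finset.univ.filter fun j : Fin n => (j : ℕ) < i with hJ
  have hS : (k : ℝ) • Δone n i =
      {x | (∀ j, 0 ≤ x j) ∧ (∀ j ∉ J, x j = 0) ∧ ∑ j, x j ≤ (k : ℝ) / 2} := by
    rw [Δone, natCast_smul_half_smul, baseSimplex_eq]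
    ext x
    rw [Set.mem_smul_set_iff_inv_smul_mem₀ hc.ne']
    refine and_congr (forall_congr' fun j => ?_) (and_congr (forall₂_congr fun j _ => ?_) ?_)
    · rw [Pi.smul_apply, smul_eq_mul, mul_nonneg_iff_of_pos_left (inv_pos.2 hc)]
    · simp [(show k ≠ 0 by omega)]
    · simp only [Pi.smul_apply, smul_eq_mul, ← Finset.mul_sum]
      rw [inv_mul_le_iff₀ hc, mul_one]
  rw [Eone, latticeCount, hS, intrinsicInterior_cornerSimplex J hc,
    ← card_filter_val_lt hi, ← hJ, ← ncard_iUnion_compositions J]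
  congr 1
  ext x
  simp only [Set.mem_ofPred_eq, Set.mem_iUnion, compositions, Finset.mem_range, Int.cast_pos,
    Int.cast_eq_zero, exists_prop]
  have hlt : ∀ s : ℤ, (s : ℝ) < (k : ℝ) / 2 ↔ 2 * s < k := fun s => by
    rw [lt_div_iff₀ two_pos, mul_comm]
    exact_mod_cast Iff.rfl
  rw [← Int.cast_sum, hlt]
  constructor
  · rintro ⟨h1, h0, hs⟩
    have hnn : 0 ≤ ∑ j, x j := Finset.sum_nonneg fun j _ => by
      by_cases hj : j ∈ J
      · exact (h1 j hj).le
      · exact (h0 j hj).ge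
    exact ⟨(∑ j, x j).toNat, by omega, h1, h0, (Int.toNat_of_nonneg hnn).symm⟩
  · rintro ⟨m, hm, h1, h0, hs⟩
    exact ⟨h1, h0, by omega⟩

theorem Ezero_eq_ncard {i k : ℕ} (hk : 1 ≤ k) : Ezero n i k =
    {x : Fin n → ℤ | (∀ j ∈ Finset.univ.filter fun j : Fin n => (j : ℕ) < i + 1, 0 < x j) ∧
      (∀ j ∉ Finset.univ.filter fun j : Fin n => (j : ℕ) < i + 1, x j = 0) ∧
        2 * ∑ j, x j = k}.ncard := by
  have hc : (0 : ℝ) < (k : ℝ) / 2 := by positivity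
  set J := Finset.univ.filter fun j : Fin n => (j : ℕ) < i + 1 with hJ
  have hS : (k : ℝ) • Δzero n i =
      {x | (∀ j, 0 ≤ x j) ∧ (∀ j ∉ J, x j = 0) ∧ ∑ j, x j = (k : ℝ) / 2} := by
    rw [Δzero, natCast_smul_half_smul, convexHull_single_eq]
    ext x
    rw [Set.mem_smul_set_iff_inv_smul_mem₀ hc.ne']
    refine and_congr (forall_congr' fun j => ?_) (and_congr (forall₂_congr fun j _ => ?_) ?_)
    · rw [Pi.smul_apply, smul_eq_mul, mul_nonneg_iff_of_pos_left (inv_pos.2 hc)]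
    · simp [(show k ≠ 0 by omega)]
    · simp only [Pi.smul_apply, smul_eq_mul, ← Finset.mul_sum]
      rw [inv_mul_eq_iff_eq_mul₀ hc.ne', mul_one]
  rw [Ezero, latticeCount, hS, intrinsicInterior_faceSimplex hc]
  congr 1
  ext x
  simp only [Set.mem_ofPred_eq, Int.cast_pos, Int.cast_eq_zero]
  have heq : ∀ s : ℤ, (s : ℝ) = (k : ℝ) / 2 ↔ 2 * s = k := fun s => by
    rw [eq_div_iff two_ne_zero, mul_comm]
    exact_mod_cast Iff.rfl
  rw [← Int.cast_sum, heq]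

theorem Ezero_even {i : ℕ} (hi : i < n) (j : ℕ) : Ezero n i (2 * j + 2) = j.choose i := by
  set J := Finset.univ.filter fun j : Fin n => (j : ℕ) < i + 1 with hJ
  have hcard : J.card = i + 1 := card_filter_val_lt hi
  rw [Ezero_eq_ncard (by omega)]
  have := ncard_compositions_succ (J := J) (Finset.card_pos.1 (by omega)) j
  rw [hcard, Nat.add_sub_cancel] at this
  rw [← this]
  congr 1
  ext x
  refine and_congr_right' (and_congr_right' ?_)
  push_cast
  omega

theorem Ezero_odd (i j : ℕ) : Ezero n i (2 * j + 1) = 0 := by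
  rw [Ezero_eq_ncard (by omega)]
  convert! Set.ncard_empty (Fin n → ℤ)
  refine Set.eq_empty_of_forall_notMem fun x hx => ?_
  have := hx.2.2
  omega

end Counting

section Polytope

variable {n : ℕ}

theorem mem_convexHull_range_iff {ι E : Type*} [Fintype ι] [AddCommGroup E] [Module ℝ E]
    {v : ι → E} {x : E} : x ∈ convexHull ℝ (Set.range v) ↔
      ∃ ν : ι → ℝ, 0 ≤ ν ∧ ∑ i, ν i = 1 ∧ ∑ i, ν i • v i = x := by
  classical
  refine ⟨fun hx => ?_, fun ⟨ν, h0, h1, h⟩ =>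
    mem_convexHull_of_exists_fintype ν v h0 h1 (fun i => Set.mem_range_self i) h⟩
  rw [convexHull_range_eq_exists_affineCombination] at hx
  obtain ⟨s, ν, h0, h1, rfl⟩ := hx
  rw [Finset.affineCombination_eq_linear_combination _ _ _ h1]
  refine ⟨fun i => if i ∈ s then ν i else 0, fun i => ?_, by simpa using h1, by simp⟩
  by_cases hi : i ∈ s
  · simpa [hi] using h0 i hi
  · simp [hi]

theorem mem_smul_convexHull_range_iff {N : ℕ} {w : Fin N → Fin n → ℤ} {v : Fin N → Fin n → ℝ}
    (hv : ∀ i j, v i j = (w i j : ℝ) / 2) {c : ℝ} (hc : 0 < c) (x : Fin n → ℝ) :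
    x ∈ c • convexHull ℝ (Set.range v) ↔ ∃ μ : Fin N → ℝ, 0 ≤ μ ∧ coneMap w μ = (c / 2, x) := by
  rw [Set.mem_smul_set]
  constructor
  · rintro ⟨y, hy, rfl⟩
    obtain ⟨ν, h0, h1, rfl⟩ := mem_convexHull_range_iff.1 hy
    refine ⟨fun i => c / 2 * ν i, fun i => mul_nonneg (by positivity) (h0 i), Prod.ext ?_ ?_⟩
    · change ∑ i, c / 2 * ν i = c / 2
      rw [← Finset.mul_sum, h1, mul_one]
    · funext j
      change ∑ i, c / 2 * ν i * w i j = (c • ∑ i, ν i • v i) j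
      simp only [Pi.smul_apply, Finset.sum_apply, smul_eq_mul, hv, Finset.mul_sum]
      exact Finset.sum_congr rfl fun i _ => by ring
  · rintro ⟨μ, h0, h⟩
    have h1 : ∑ i, μ i = c / 2 := congrArg Prod.fst h
    have h2 : (fun j => ∑ i, μ i * w i j) = x := congrArg Prod.snd h
    refine ⟨∑ i, (2 / c * μ i) • v i, mem_convexHull_range_iff.2
      ⟨fun i => 2 / c * μ i, fun i => mul_nonneg (by positivity) (h0 i), ?_, rfl⟩, ?_⟩
    · rw [← Finset.mul_sum, h1]
      field_simp
    · rw [← h2]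
      funext j
      simp only [Pi.smul_apply, Finset.sum_apply, smul_eq_mul, hv, Finset.mul_sum]
      refine Finset.sum_congr rfl fun i _ => ?_
      field_simp

theorem exists_latticeCount_eq_ncard_conePoints {V : Finset (Fin n → ℝ)}
    (hV : ∀ v ∈ V, ∀ i, ∃ m : ℤ, v i = (m : ℝ) / 2) :
    ∃ w : Fin V.card → Fin n → ℤ, ∀ k : ℕ, 1 ≤ k →
      latticeCount ((k : ℝ) • convexHull ℝ (V : Set (Fin n → ℝ))) = (conePoints w k).ncard := by
  choose w hw using fun i : Fin V.card => hV (V.equivFin.symm i) (V.equivFin.symm i).2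
  have hrange : Set.range (fun i => (V.equivFin.symm i : Fin n → ℝ)) = V := by
    rw [← Function.comp_def, V.equivFin.symm.surjective.range_comp]
    exact Subtype.range_coe
  refine ⟨w, fun k hk => ?_⟩
  rw [ncard_conePoints, latticeCount, ← hrange]
  congr 1
  ext x
  exact mem_smul_convexHull_range_iff hw (by exact_mod_cast hk) _

/-- A polytope with vertices in `½ℤ^n` has an Ehrhart quasi-polynomial of period two whose
constituents have the same leading coefficient. -/
theorem exists_polynomial_latticeCount {V : Finset (Fin n → ℝ)}
    (hV : ∀ v ∈ V, ∀ i, ∃ m : ℤ, v i = (m : ℝ) / 2) {a : ℕ} (ha : 1 ≤ a) :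
    ∃ p : Polynomial ℚ, p.natDegree ≤ n ∧
      (p.coeff n : ℝ) = volume.real (convexHull ℝ (V : Set (Fin n → ℝ))) * 2 ^ n ∧
      ∀ j : ℕ, (latticeCount (((2 * j + a : ℕ) : ℝ) • convexHull ℝ (V : Set (Fin n → ℝ))) : ℚ) =
        p.eval (j : ℚ) := by
  obtain ⟨w, hw⟩ := exists_latticeCount_eq_ncard_conePoints hV
  obtain ⟨p, hp⟩ := exists_polynomial_ncard_conePoints w ha
  have hL : ∀ j : ℕ, (latticeCount (((2 * j + a : ℕ) : ℝ) •
      convexHull ℝ (V : Set (Fin n → ℝ))) : ℚ) = p.eval (j : ℚ) := fun j => by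
    rw [hw _ (by omega), hp]
  have hlim := tendsto_latticeCount_arith (V.finite_toSet.isCompact_convexHull ℝ)
    (convex_convexHull ℝ _) a
  obtain ⟨hdeg, hcoeff⟩ := Polynomial.natDegree_le_and_coeff_eq_of_tendsto p n _
    (hlim.congr fun j => by rw [← hL, Rat.cast_natCast])
  exact ⟨p, hdeg, hcoeff, hL⟩

end Polytope

/-- For every polytope `P ⊂ ℝ^n` with vertices in `½ℤ^n`, the Ehrhart counting function of
`P` is a rational linear combination of the `E_i^1` and `E_i^0`. -/
theorem ehrhart_in_span (n : ℕ) (hn : 1 ≤ n) (P : Set (Fin n → ℝ))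
    (hP : ∃ V : Finset (Fin n → ℝ),
      (∀ v ∈ V, ∀ i, ∃ m : ℤ, v i = (m : ℝ) / 2) ∧ P = convexHull ℝ (V : Set (Fin n → ℝ))) :
    ∃ (c1 : Fin (n + 1) → ℚ) (c0 : Fin n → ℚ), ∀ k : ℕ, 1 ≤ k →
      (latticeCount ((k : ℝ) • P) : ℚ) =
        (∑ i : Fin (n + 1), c1 i * (Eone n i k : ℚ)) +
          ∑ i : Fin n, c0 i * (Ezero n i k : ℚ) := by
  obtain ⟨V, hV, rfl⟩ := hP
  obtain ⟨p, hp, hpn, hpL⟩ := exists_polynomial_latticeCount hV one_le_two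
  obtain ⟨q, hq, hqn, hqL⟩ := exists_polynomial_latticeCount hV le_rfl
  obtain ⟨a, ha, han⟩ := p.exists_eval_natCast_eq_sum_choose n hp
  obtain ⟨b, hb, hbn⟩ := q.exists_eval_natCast_eq_sum_choose n hq
  have hab : a n = b n := by
    rw [han, hbn, Rat.cast_injective (hpn.trans hqn.symm)]
  refine ⟨fun i => b i, fun i => a i - b i, fun k hk => ?_⟩
  have hone : ∀ i : Fin (n + 1), Eone n i k = ((k - 1) / 2).choose i := fun i =>
    Eone_eq (Nat.lt_succ_iff.1 i.2) hk
  simp only [hone]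
  obtain ⟨j, rfl | rfl⟩ : ∃ j, k = 2 * j + 2 ∨ k = 2 * j + 1 := ⟨(k - 1) / 2, by omega⟩
  · have hzero : ∀ i : Fin n, Ezero n i (2 * j + 2) = j.choose i := fun i => Ezero_even i.2 j
    simp only [hzero, show (2 * j + 2 - 1) / 2 = j by omega]
    rw [hpL, ha, Fin.sum_univ_castSucc, Finset.sum_range_succ, Finset.sum_range, hab]
    simp only [Fin.val_castSucc, Fin.val_last, sub_mul, Finset.sum_sub_distrib]
    ring
  · simp only [Ezero_odd, show (2 * j + 1 - 1) / 2 = j by omega]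
    rw [hqL, hb, Finset.sum_range]
    simp
end
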